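/- arXiv:2510.08862 — 7 statements merged into one kernel-verified Lean document; each statement's English description precedes it below -/
import Mathlib

section
/- For each ε ∈ (0, 1/2) and each positive integer k, there exist a threshold N₀(ε) and a constant C(k, ε) > 0 such that the following holds. Let N > N₀(ε) be an integer and let p₀ be a real number with p₀ ≤ (log N)^{1/ε}/2. For each prime p with p₀ ≤ p ≤ (log N)^{1/ε}, let R_p^{(1)}, …, R_p^{(k)} ⊆ ℤ/pℤ be arithmetic progressions each of length at most p^{1/2−ε}, and set R_p = R_p^{(1)} ∪ ⋯ ∪ R_p^{(k)}. Let A be the set of all integers n ∈ {0, 1, …, N} such that for every prime p with p₀ ≤ p ≤ (log N)^{1/ε} the residue of n mod p lies in R_p. Then |A| ≤ C(k, ε)·((log N)^{1/2−ε} + p₀^{1/2−ε}). -/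
/-- `R ⊆ ℤ/pℤ` is an arithmetic progression with exactly `k` terms. -/
def IsAPZModLen (p : ℕ) (R : Set (ZMod p)) (k : ℕ) : Prop :=
  ∃ a d : ZMod p, R = (fun j : ℕ => a + (j : ZMod p) * d) '' {j : ℕ | j < k}

open Finset in
theorem sum_log_le_card_mul_log {ι : Type*} {P : Finset ℕ} (hP : ∀ p ∈ P, p.Prime)
    {T : Finset ι} {f : ι → ℤ} {B : ℝ} (hne : ∀ t ∈ T, f t ≠ 0)
    (hB : ∀ t ∈ T, |(f t : ℝ)| ≤ B) (hdvd : ∀ p ∈ P, ∃ t ∈ T, (p : ℤ) ∣ f t) :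
    ∑ p ∈ P, Real.log p ≤ #T * Real.log B := by
  have hdiv : ∏ p ∈ P, p ∣ ∏ t ∈ T, (f t).natAbs := by
    refine prod_primes_dvd _ (fun p hp => (hP p hp).prime) fun p hp => ?_
    obtain ⟨t, ht, h⟩ := hdvd p hp
    exact (Int.natCast_dvd.1 h).trans (dvd_prod_of_mem _ ht)
  have hpos : 0 < ∏ t ∈ T, (f t).natAbs := prod_pos fun t ht => Int.natAbs_pos.2 (hne t ht)
  have hPpos : 0 < ∏ p ∈ P, p := prod_pos fun p hp => (hP p hp).pos
  calc ∑ p ∈ P, Real.log p = Real.log ((∏ p ∈ P, p : ℕ) : ℝ) := by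
        rw [Nat.cast_prod, Real.log_prod]
        exact fun p hp => by exact_mod_cast (hP p hp).ne_zero
    _ ≤ Real.log ((∏ t ∈ T, (f t).natAbs : ℕ) : ℝ) :=
        Real.log_le_log (by exact_mod_cast hPpos) (by exact_mod_cast Nat.le_of_dvd hpos hdiv)
    _ = ∑ t ∈ T, Real.log |(f t : ℝ)| := by
        rw [Nat.cast_prod, Real.log_prod]
        · simp [Nat.cast_natAbs]
        · exact fun t ht => by simpa using hne t ht
    _ ≤ ∑ _t ∈ T, Real.log B := sum_le_sum fun t ht =>
        Real.log_le_log (abs_pos.2 (by exact_mod_cast hne t ht)) (hB t ht)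
    _ = #T * Real.log B := by simp

open Finset in
theorem centralBinom_le_mul_prod_primes {n : ℕ} (hn : 2 < n) :
    n.centralBinom ≤ (2 * n) ^ Nat.sqrt (2 * n) * 4 ^ (2 * n / 3) *
      ∏ p ∈ Ioc n (2 * n) with p.Prime, p := by
  set f : ℕ → ℕ := fun p => p ^ n.centralBinom.factorization p with hf
  have hf1 : ∀ p, p.Prime → 1 ≤ f p := fun p hp => Nat.one_le_pow _ _ hp.pos
  have hsmall : ∀ p, p.Prime → Nat.sqrt (2 * n) < p → f p ≤ p := fun p hp h =>
    (pow_right_mono₀ hp.one_lt.le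
      (Nat.factorization_choose_le_one (Nat.sqrt_lt'.mp h))).trans (pow_one p).le
  set S := (range (2 * n + 1)).filter Nat.Prime with hS
  set S₁ := (Icc 1 (Nat.sqrt (2 * n))).filter Nat.Prime
  set S₂ := (Ioc (Nat.sqrt (2 * n)) (2 * n / 3)).filter Nat.Prime
  set S₃ := (Ioc n (2 * n)).filter Nat.Prime
  have hprod : n.centralBinom = ∏ p ∈ S, f p := by
    rw [← n.prod_pow_factorization_centralBinom]
    refine (prod_filter_of_ne fun p _ h => ?_).symm
    contrapose h
    simp [Nat.factorization_eq_zero_of_not_prime _ h]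
  have hle : ∏ p ∈ S, f p ≤ ∏ p ∈ S₁ ∪ S₂ ∪ S₃, f p := by
    rw [← prod_filter_mul_prod_filter_not S (fun p => p ∈ S₁ ∪ S₂ ∪ S₃)]
    rw [prod_eq_one (s := S.filter fun p => p ∉ S₁ ∪ S₂ ∪ S₃), mul_one]
    · refine prod_le_prod_of_subset_of_one_le' (fun p hp => (mem_filter.1 hp).2) fun p hp _ => ?_
      apply hf1
      simp only [S₁, S₂, S₃, mem_union, mem_filter] at hp
      tauto
    · intro p hp
      simp only [S, S₁, S₂, S₃, mem_union, mem_filter, mem_range, mem_Ioc, mem_Icc] at hp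
      obtain ⟨⟨h1, h2⟩, h3⟩ := hp
      have := h2.one_lt
      simp only [h2, and_true] at h3
      have h4 : p ≤ n := by omega
      have h5 : 2 * n < 3 * p := by omega
      simp [hf, Nat.factorization_centralBinom_of_two_mul_self_lt_three_mul hn h4 h5]
  have hunion : ∏ p ∈ S₁ ∪ S₂ ∪ S₃, f p ≤ (∏ p ∈ S₁, f p) * (∏ p ∈ S₂, f p) * ∏ p ∈ S₃, f p := by
    have key : ∀ U V : Finset ℕ, (∀ p ∈ U, p.Prime) →
        ∏ p ∈ U ∪ V, f p ≤ (∏ p ∈ U, f p) * ∏ p ∈ V, f p := by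
      intro U V hU
      rw [← prod_union_inter]
      refine Nat.le_mul_of_pos_right _ (prod_pos fun p hp => hf1 p (hU p (mem_inter.1 hp).1))
    refine (key _ _ ?_).trans (Nat.mul_le_mul_right _ (key _ _ ?_))
    · simp only [S₁, S₂, mem_union, mem_filter]
      tauto
    · simp only [S₁, mem_filter]
      tauto
  rw [hprod]
  refine hle.trans (hunion.trans (Nat.mul_le_mul (Nat.mul_le_mul ?_ ?_) ?_))
  · refine (prod_le_prod' fun p _ =>
      (Nat.pow_factorization_choose_le (by omega) : f p ≤ 2 * n)).trans ?_
    rw [prod_const]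
    refine Nat.pow_le_pow_right (by omega) ((card_filter_le _ _).trans (by simp))
  · refine le_trans ?_ (primorial_le_four_pow (2 * n / 3))
    refine (prod_le_prod' fun p hp => ?_ : ∏ p ∈ S₂, f p ≤ ∏ p ∈ S₂, p).trans ?_
    · simp only [S₂, mem_filter, mem_Ioc] at hp
      exact hsmall p hp.2 hp.1.1
    · refine prod_le_prod_of_subset_of_one_le' (fun p hp => ?_) fun p hp _ => ?_
      · simp only [S₂, mem_filter, mem_Ioc] at hp
        simp only [mem_filter, mem_range]
        exact ⟨by omega, hp.2⟩
      · exact (mem_filter.1 hp).2.one_lt.le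
  · refine prod_le_prod' fun p hp => ?_
    simp only [S₃, mem_filter, mem_Ioc] at hp
    refine hsmall p hp.2 (lt_of_le_of_lt ?_ hp.1.1)
    rw [← Nat.lt_succ_iff, Nat.sqrt_lt']
    nlinarith

open Finset in
theorem sum_log_primes_Ioc_ge {n : ℕ} (hn : 4 ≤ n) :
    n * Real.log 4 / 3 - Real.log n - √(2 * n) * Real.log (2 * n) ≤
      ∑ p ∈ Ioc n (2 * n) with p.Prime, Real.log p := by
  have h1 := (Nat.four_pow_lt_mul_centralBinom n hn).le.trans
    (Nat.mul_le_mul_left n (centralBinom_le_mul_prod_primes (by omega : 2 < n)))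
  have hn0 : (0 : ℝ) < n := by exact_mod_cast (by omega : 0 < n)
  have hP : ∀ p ∈ (Ioc n (2 * n)).filter Nat.Prime, (p : ℝ) ≠ 0 := fun p hp => by
    exact_mod_cast (mem_filter.1 hp).2.ne_zero
  have hP' := prod_ne_zero_iff.2 hP
  have h2 : ((4 : ℝ)) ^ n ≤ n * ((2 * n) ^ Nat.sqrt (2 * n) * 4 ^ (2 * n / 3) *
      ∏ p ∈ Ioc n (2 * n) with p.Prime, (p : ℝ)) := by
    simpa only [Nat.cast_mul, Nat.cast_pow, Nat.cast_prod, Nat.cast_ofNat]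
      using (Nat.cast_le (α := ℝ)).2 h1
  have h3 := Real.log_le_log (by positivity) h2
  rw [Real.log_mul (by positivity) (by positivity), Real.log_mul (by positivity) hP',
    Real.log_mul (by positivity) (by positivity), Real.log_prod hP, Real.log_pow, Real.log_pow,
    Real.log_pow] at h3
  have h4 : (Nat.sqrt (2 * n) : ℝ) ≤ √(2 * n) := by
    exact_mod_cast Real.nat_sqrt_le_real_sqrt (a := 2 * n)
  have h5 : ((2 * n / 3 : ℕ) : ℝ) ≤ 2 * n / 3 := by
    exact_mod_cast Nat.cast_div_le (α := ℝ) (m := 2 * n) (n := 3)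
  have h6 : (0 : ℝ) ≤ Real.log 4 := Real.log_nonneg (by norm_num)
  have h7 : (0 : ℝ) ≤ Real.log (2 * n) := Real.log_nonneg (by
    have : (4 : ℝ) ≤ n := by exact_mod_cast hn
    linarith)
  nlinarith [mul_le_mul_of_nonneg_right h4 h7, mul_le_mul_of_nonneg_right h5 h6]

open Finset Filter in
theorem eventually_div_eight_le_sum_log_primes :
    ∀ᶠ x : ℝ in atTop, x / 8 ≤ ∑ p ∈ Ioc ⌊x⌋₊ (2 * ⌊x⌋₊) with p.Prime, Real.log p := by
  have h1 : ∀ᶠ y : ℝ in atTop, Real.log y ≤ (1 / 40 : ℝ) * y := by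
    filter_upwards [Real.isLittleO_log_id_atTop.bound (by norm_num : (0 : ℝ) < 1 / 40),
      eventually_ge_atTop 1] with y hy hy1
    have := (le_abs_self _).trans hy
    simpa [abs_of_nonneg (zero_le_one.trans hy1)] using this
  have h2 : ∀ᶠ y : ℝ in atTop, Real.log y ≤ (1 / 40 : ℝ) * √y := by
    have := isLittleO_log_rpow_atTop (by norm_num : (0 : ℝ) < 1 / 2)
    filter_upwards [this.bound (by norm_num : (0 : ℝ) < 1 / 40),
      eventually_ge_atTop 1] with y hy hy1
    have := (le_abs_self _).trans hy
    rw [← Real.sqrt_eq_rpow] at this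
    simpa [abs_of_nonneg (Real.sqrt_nonneg y)] using this
  have hfl : Tendsto (fun x : ℝ => (⌊x⌋₊ : ℝ)) atTop atTop :=
    tendsto_natCast_atTop_atTop.comp tendsto_nat_floor_atTop
  filter_upwards [hfl.eventually h1, (hfl.const_mul_atTop (two_pos : (0 : ℝ) < 2)).eventually h2,
    eventually_ge_atTop 5] with x hx1 hx2 hx
  have hn : 4 ≤ ⌊x⌋₊ := Nat.le_floor (by norm_num; linarith)
  have hlow := sum_log_primes_Ioc_ge hn
  have hlt := Nat.lt_floor_add_one x
  set n := ⌊x⌋₊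
  have hn' : (4 : ℝ) ≤ n := by exact_mod_cast hn
  have hlog4 : (1.38 : ℝ) ≤ Real.log 4 := by
    rw [show (4 : ℝ) = 2 ^ 2 by norm_num, Real.log_pow]
    have := Real.log_two_gt_d9
    push_cast
    linarith
  have hsq := Real.mul_self_sqrt (by positivity : (0 : ℝ) ≤ 2 * n)
  have := mul_le_mul_of_nonneg_left hx2 (Real.sqrt_nonneg (2 * n))
  refine le_trans ?_ hlow
  nlinarith

/-- `w` lies on the line through `x` and `y`, with a parameter of height at most `H`. -/
def HasBoundedRatio (H x y w : ℤ) : Prop :=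
  ∃ b g : ℤ, g ≠ 0 ∧ |b| ≤ H ∧ |g| ≤ H ∧ g * (w - x) = b * (y - x)

/-- The differences `y - x` and `z - x` satisfy a nontrivial linear relation with coefficients
bounded by `H`. -/
def HasBoundedRelation (H x y z : ℤ) : Prop :=
  ∃ b g : ℤ, (b ≠ 0 ∨ g ≠ 0) ∧ |b| ≤ H ∧ |g| ≤ H ∧ b * (y - x) + g * (z - x) = 0

/-- Modulo `p`, the elements of `A` lie in `k` arithmetic progressions with `L` terms. -/
def IsCoveredMod (k L p : ℕ) (A : Finset ℤ) : Prop :=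
  ∃ a d : Fin k → ZMod p, ∀ x ∈ A, ∃ i, ∃ j < L, (x : ZMod p) = a i + (j : ZMod p) * d i

theorem IsCoveredMod.mono {k L p : ℕ} {A B : Finset ℤ} (h : IsCoveredMod k L p A) (hBA : B ⊆ A) :
    IsCoveredMod k L p B := by
  obtain ⟨a, d, h⟩ := h
  exact ⟨a, d, fun x hx => h x (hBA hx)⟩

theorem HasBoundedRelation.swap {H x y z : ℤ} (h : HasBoundedRelation H x y z) :
    HasBoundedRelation H x z y := by
  obtain ⟨b, g, hne, hb, hg, h⟩ := h
  exact ⟨g, b, hne.symm, hg, hb, by linarith⟩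

theorem HasBoundedRelation.hasBoundedRatio_right {H x y w : ℤ} (hxy : x ≠ y)
    (h : HasBoundedRelation H x y w) : HasBoundedRatio (2 * H) x y w := by
  obtain ⟨b, g, hne, hb, hg, h⟩ := h
  refine ⟨-b, g, ?_, by rw [abs_neg]; linarith [abs_nonneg b], by linarith [abs_nonneg g],
    by linarith⟩
  rintro rfl
  have : b * (y - x) = 0 := by linarith
  rcases mul_eq_zero.1 this with h0 | h0
  · simp [h0] at hne
  · exact hxy (by linarith)

theorem HasBoundedRelation.hasBoundedRatio_left {H w y z : ℤ} (hyz : y ≠ z)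
    (h : HasBoundedRelation H w y z) : HasBoundedRatio (2 * H) y z w := by
  obtain ⟨b, g, hne, hb, hg, h⟩ := h
  refine ⟨g, b + g, fun h0 => ?_, by linarith [abs_nonneg g], by linarith [abs_add_le b g],
    by linarith⟩
  obtain rfl : b = -g := by linarith
  have : g * (z - y) = 0 := by linarith
  rcases mul_eq_zero.1 this with h0 | h0
  · simp [h0] at hne
  · exact hyz (by linarith)

open Finset in
theorem exists_subset_card_le_forall_hasBoundedRatio {A : Finset ℤ} {m : ℕ} {H : ℤ}
    (h : ∀ M ⊆ A, m < #M → ∃ x ∈ M, ∃ y ∈ M, ∃ z ∈ M, x ≠ y ∧ x ≠ z ∧ y ≠ z ∧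
      HasBoundedRelation H x y z) :
    ∃ M ⊆ A, #M ≤ m ∧ ∀ w ∈ A, w ∉ M →
      ∃ x ∈ M, ∃ y ∈ M, x ≠ y ∧ HasBoundedRatio (2 * H) x y w := by
  classical
  let Q : Finset ℤ → Prop := fun M => ¬ ∃ x ∈ M, ∃ y ∈ M, ∃ z ∈ M, x ≠ y ∧ x ≠ z ∧ y ≠ z ∧
    HasBoundedRelation H x y z
  obtain ⟨M, hM, hmax⟩ := exists_max_image (A.powerset.filter Q) card ⟨∅, by simp [Q]⟩
  simp only [mem_filter, mem_powerset] at hM hmax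
  refine ⟨M, hM.1, not_lt.1 fun hlt => hM.2 (h M hM.1 hlt), fun w hw hwM => ?_⟩
  have hins : ¬ Q (insert w M) := fun hQ => by
    have := hmax (insert w M) ⟨insert_subset hw hM.1, hQ⟩
    rw [card_insert_of_notMem hwM] at this
    omega
  simp only [Q, not_not] at hins
  obtain ⟨x, hx, y, hy, z, hz, hxy, hxz, hyz, hr⟩ := hins
  rcases mem_insert.1 hx with rfl | hxM
  · exact ⟨y, mem_of_mem_insert_of_ne hy hxy.symm, z, mem_of_mem_insert_of_ne hz hxz.symm, hyz,
      hr.hasBoundedRatio_left hyz⟩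
  rcases mem_insert.1 hy with rfl | hyM
  · exact ⟨x, hxM, z, mem_of_mem_insert_of_ne hz hyz.symm, hxz, hr.swap.hasBoundedRatio_right hxz⟩
  rcases mem_insert.1 hz with rfl | hzM
  · exact ⟨x, hxM, y, hyM, hxy, hr.hasBoundedRatio_right hxy⟩
  · exact absurd ⟨x, hxM, y, hyM, z, hzM, hxy, hxz, hyz, hr⟩ hM.2

theorem exists_dvd_linear_combination {p L : ℕ} {a d : ZMod p} {x y z : ℤ} {i j l : ℕ}
    (hi : i < L) (hj : j < L) (hl : l < L) (hx : (x : ZMod p) = a + (i : ZMod p) * d)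
    (hy : (y : ZMod p) = a + (j : ZMod p) * d) (hz : (z : ZMod p) = a + (l : ZMod p) * d) :
    ∃ b g : ℤ, (b ≠ 0 ∨ g ≠ 0) ∧ |b| ≤ L ∧ |g| ≤ L ∧
      (p : ℤ) ∣ b * (y - x) + g * (z - x) := by
  by_cases hij : i = j
  · refine ⟨1, 0, by simp, by simp; omega, by simp, ?_⟩
    rw [← ZMod.intCast_zmod_eq_zero_iff_dvd]
    push_cast
    rw [hx, hy, hij]
    ring
  · refine ⟨(l : ℤ) - i, (i : ℤ) - j, Or.inr (by omega), abs_le.2 (by omega), abs_le.2 (by omega), ?_⟩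
    rw [← ZMod.intCast_zmod_eq_zero_iff_dvd]
    push_cast
    rw [hx, hy, hz]
    ring

open Finset in
theorem exists_hasBoundedRelation {k L N : ℕ} {A : Finset ℤ}
    (hA : 2 * k < #A) (hAN : ∀ x ∈ A, 0 ≤ x ∧ x ≤ N) {P : Finset ℕ} (hP : ∀ p ∈ P, p.Prime)
    (hcov : ∀ p ∈ P, IsCoveredMod k L p A)
    (hbig : (2 * k + 1) ^ 3 * (2 * L + 1) ^ 2 * Real.log (2 * L * N) < ∑ p ∈ P, Real.log p) :
    ∃ x ∈ A, ∃ y ∈ A, ∃ z ∈ A, x ≠ y ∧ x ≠ z ∧ y ≠ z ∧ HasBoundedRelation L x y z := by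
  obtain ⟨M, hMA, hM⟩ := exists_subset_card_eq (Nat.succ_le_of_lt hA)
  by_contra! hno
  set C := Icc (-L : ℤ) L
  set T₀ := (M ×ˢ M ×ˢ M) ×ˢ (C ×ˢ C) with hT₀
  set T := T₀.filter fun t => t.2.1 * (t.1.2.1 - t.1.1) + t.2.2 * (t.1.2.2 - t.1.1) ≠ 0
  have hT₀c : #T₀ = (2 * k + 1) ^ 3 * (2 * L + 1) ^ 2 := by
    simp only [hT₀, card_product, hM, C, Int.card_Icc]
    rw [show ((L : ℤ) + 1 - -L).toNat = 2 * L + 1 by omega, Nat.succ_eq_add_one]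
    ring
  have hle := sum_log_le_card_mul_log hP (T := T)
    (f := fun t => t.2.1 * (t.1.2.1 - t.1.1) + t.2.2 * (t.1.2.2 - t.1.1)) (B := 2 * L * N)
    (fun t ht => (mem_filter.1 ht).2) ?_ ?_
  · refine hbig.not_ge (hle.trans ?_)
    have hc : (#T : ℝ) ≤ (2 * k + 1) ^ 3 * (2 * L + 1) ^ 2 := by
      have : #T ≤ (2 * k + 1) ^ 3 * (2 * L + 1) ^ 2 := hT₀c ▸ card_filter_le _ _
      exact_mod_cast this
    refine mul_le_mul_of_nonneg_right hc ?_
    have := Real.log_natCast_nonneg (2 * L * N)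
    push_cast at this
    exact this
  · intro t ht
    simp only [T, T₀, C, mem_filter, mem_product, mem_Icc] at ht
    obtain ⟨⟨⟨hx, hy, hz⟩, hb, hg⟩, -⟩ := ht
    have hx := hAN _ (hMA hx)
    have hy := hAN _ (hMA hy)
    have hz := hAN _ (hMA hz)
    have h1 : |t.2.1 * (t.1.2.1 - t.1.1) + t.2.2 * (t.1.2.2 - t.1.1)| ≤ 2 * L * N := by
      refine (abs_add_le _ _).trans ?_
      rw [abs_mul, abs_mul]
      have e1 := mul_le_mul (abs_le.2 hb) (abs_le.2 (by omega) : |t.1.2.1 - t.1.1| ≤ (N : ℤ))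
        (abs_nonneg _) (by positivity)
      have e2 := mul_le_mul (abs_le.2 hg) (abs_le.2 (by omega) : |t.1.2.2 - t.1.1| ≤ (N : ℤ))
        (abs_nonneg _) (by positivity)
      linarith
    exact_mod_cast h1
  · intro p hp
    obtain ⟨a, d, hc⟩ := hcov p hp
    obtain ⟨x₀, hx₀⟩ : M.Nonempty := card_pos.1 (by omega)
    have : Nonempty (Fin k) := ⟨(hc x₀ (hMA hx₀)).choose⟩
    choose! i hi using hc
    obtain ⟨c, -, hc⟩ := exists_lt_card_fiber_of_mul_lt_card_of_maps_to (s := M)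
      (t := (univ : Finset (Fin k))) (f := i) (n := 2) (fun _ _ => mem_univ _) (by simp; omega)
    obtain ⟨x, hx, y, hy, z, hz, hxy, hxz, hyz⟩ := two_lt_card.1 hc
    simp only [mem_filter] at hx hy hz
    obtain ⟨jx, hjx, ex⟩ := hi x (hMA hx.1)
    obtain ⟨jy, hjy, ey⟩ := hi y (hMA hy.1)
    obtain ⟨jz, hjz, ez⟩ := hi z (hMA hz.1)
    rw [hx.2] at ex
    rw [hy.2] at ey
    rw [hz.2] at ez
    obtain ⟨b, g, hne, hb, hg, hdvd⟩ := exists_dvd_linear_combination hjx hjy hjz ex ey ez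
    refine ⟨((x, y, z), (b, g)), ?_, hdvd⟩
    simp only [T, T₀, C, mem_filter, mem_product, mem_Icc]
    refine ⟨⟨⟨hx.1, hy.1, hz.1⟩, abs_le.1 hb, abs_le.1 hg⟩, fun h0 => ?_⟩
    exact hno x (hMA hx.1) y (hMA hy.1) z (hMA hz.1) hxy hxz hyz ⟨b, g, hne, hb, hg, h0⟩

open Finset in
theorem card_le_of_hasBoundedRatio {k L : ℕ} {H u v : ℤ} {S : Finset ℤ}
    (hS : ∀ w ∈ S, HasBoundedRatio H u v w) {P : Finset ℕ} (hP : ∀ p ∈ P, p.Prime)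
    (hPuv : ∀ p ∈ P, ¬ (p : ℤ) ∣ v - u) (hcov : ∀ p ∈ P, IsCoveredMod k L p S)
    (hH : 1 ≤ H)
    (hbig : (k * L + 1) ^ 2 * Real.log (2 * H ^ 2) < ∑ p ∈ P, Real.log p) :
    #S ≤ k * L := by
  by_contra! hlt
  obtain ⟨M, hMS, hM⟩ := exists_subset_card_eq (Nat.succ_le_of_lt hlt)
  choose! b g hg0 hb hg heq using hS
  have hH' : (1 : ℝ) ≤ H := by exact_mod_cast hH
  set T := (M ×ˢ M).filter fun t => t.1 ≠ t.2 with hT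
  have key : ∀ z ∈ M, ∀ w ∈ M, g z * g w * (z - w) = (b z * g w - b w * g z) * (v - u) := by
    intro z hz w hw
    have e1 := heq z (hMS hz)
    have e2 := heq w (hMS hw)
    linear_combination g w * e1 - g z * e2
  have hle := sum_log_le_card_mul_log hP (T := T)
    (f := fun t => b t.1 * g t.2 - b t.2 * g t.1) (B := 2 * H ^ 2) ?_ ?_ ?_
  · refine hbig.not_ge (hle.trans ?_)
    refine mul_le_mul_of_nonneg_right ?_ (Real.log_nonneg (by nlinarith))
    have : #T ≤ (k * L + 1) ^ 2 := by
      refine (card_filter_le _ _).trans ?_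
      rw [card_product, hM, pow_two]
    exact_mod_cast this
  · intro t ht h0
    simp only [hT, mem_filter, mem_product] at ht
    have := key _ ht.1.1 _ ht.1.2
    rw [h0, zero_mul] at this
    have h1 := hg0 _ (hMS ht.1.1)
    have h2 := hg0 _ (hMS ht.1.2)
    exact mul_ne_zero (mul_ne_zero h1 h2) (sub_ne_zero.2 ht.2) this
  · intro t ht
    simp only [hT, mem_filter, mem_product] at ht
    have h1 := hMS ht.1.1
    have h2 := hMS ht.1.2
    have h3 : |b t.1 * g t.2 - b t.2 * g t.1| ≤ 2 * H ^ 2 := by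
      refine (abs_sub _ _).trans ?_
      rw [abs_mul, abs_mul]
      have e1 := mul_le_mul (hb _ h1) (hg _ h2) (abs_nonneg _) (by positivity)
      have e2 := mul_le_mul (hb _ h2) (hg _ h1) (abs_nonneg _) (by positivity)
      linarith
    exact_mod_cast h3
  · intro p hp
    obtain ⟨a, d, hc⟩ := hcov p hp
    obtain ⟨x₀, hx₀⟩ : M.Nonempty := card_pos.1 (by omega)
    have : Nonempty (Fin k) := ⟨(hc x₀ (hMS hx₀)).choose⟩
    choose! i j hj hc using hc
    obtain ⟨z, hz, w, hw, hzw, hzw'⟩ := exists_ne_map_eq_of_card_lt_of_maps_to (s := M)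
      (t := (univ : Finset (Fin k)) ×ˢ range L) (f := fun x => (i x, j x))
      (by simp [hM]) (fun x hx => by simpa using hj x (hMS hx))
    simp only [Prod.mk.injEq] at hzw'
    refine ⟨(z, w), by simp [hT, hz, hw, hzw], ?_⟩
    have hdvd : (p : ℤ) ∣ z - w := by
      rw [← ZMod.intCast_zmod_eq_zero_iff_dvd]
      push_cast
      rw [hc z (hMS hz), hc w (hMS hw), hzw'.1, hzw'.2, sub_self]
    have h1 := key z hz w hw ▸ hdvd.mul_left (g z * g w)
    exact ((Nat.prime_iff_prime_int.1 (hP p hp)).dvd_or_dvd h1).resolve_right (hPuv p hp)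

open Finset in
theorem card_le_of_isCoveredMod {k L₁ L₂ N : ℕ} {A : Finset ℤ} (hAN : ∀ x ∈ A, 0 ≤ x ∧ x ≤ N)
    {P₁ P₂ : Finset ℕ} (hP₁ : ∀ p ∈ P₁, p.Prime) (hP₂ : ∀ p ∈ P₂, p.Prime)
    (hcov₁ : ∀ p ∈ P₁, IsCoveredMod k L₁ p A) (hcov₂ : ∀ p ∈ P₂, IsCoveredMod k L₂ p A)
    (hL₁ : 1 ≤ L₁)
    (hbig₁ : (2 * k + 1) ^ 3 * (2 * L₁ + 1) ^ 2 * Real.log (2 * L₁ * N) <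
      ∑ p ∈ P₁, Real.log p)
    (hbig₂ : (k * L₂ + 1) ^ 2 * Real.log (8 * L₁ ^ 2) + Real.log N < ∑ p ∈ P₂, Real.log p) :
    #A ≤ 2 * k + (2 * k) ^ 2 * (k * L₂) := by
  classical
  obtain ⟨M, hMA, hM, hcover⟩ := exists_subset_card_le_forall_hasBoundedRatio (A := A)
    (m := 2 * k) (H := L₁) fun M hMA hM => exists_hasBoundedRelation hM
      (fun x hx => hAN x (hMA hx)) hP₁ (fun p hp => (hcov₁ p hp).mono hMA) hbig₁
  let S : ℤ × ℤ → Finset ℤ := fun t => A.filter fun w => HasBoundedRatio (2 * L₁) t.1 t.2 w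
  let U := (M ×ˢ M).filter fun t => t.1 ≠ t.2
  have hsub : A ⊆ M ∪ U.biUnion S := by
    intro w hw
    by_cases hwM : w ∈ M
    · exact mem_union_left _ hwM
    obtain ⟨x, hx, y, hy, hxy, hr⟩ := hcover w hw hwM
    refine mem_union_right _ (mem_biUnion.2 ⟨(x, y), ?_, mem_filter.2 ⟨hw, hr⟩⟩)
    simp [U, hx, hy, hxy]
  have hS : ∀ t ∈ U, #(S t) ≤ k * L₂ := by
    intro t ht
    simp only [U, mem_filter, mem_product] at ht
    have hx := hAN _ (hMA ht.1.1)
    have hy := hAN _ (hMA ht.1.2)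
    refine card_le_of_hasBoundedRatio (H := 2 * L₁) (u := t.1) (v := t.2)
      (P := P₂.filter fun p => ¬ (p : ℤ) ∣ t.2 - t.1) (fun w hw => (mem_filter.1 hw).2)
      (fun p hp => hP₂ p (mem_filter.1 hp).1) (fun p hp => (mem_filter.1 hp).2)
      (fun p hp => (hcov₂ p (mem_filter.1 hp).1).mono (filter_subset _ _)) (by omega) ?_
    have hbad := sum_log_le_card_mul_log (P := P₂.filter fun p => (p : ℤ) ∣ t.2 - t.1)
      (fun p hp => hP₂ p (mem_filter.1 hp).1) (T := {()}) (f := fun _ => t.2 - t.1) (B := N)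
      (fun _ _ => sub_ne_zero.2 ht.2.symm)
      (fun _ _ => by
        have : |t.2 - t.1| ≤ (N : ℤ) := abs_le.2 (by omega)
        exact_mod_cast this)
      (fun p hp => ⟨(), by simp, (mem_filter.1 hp).2⟩)
    rw [← sum_filter_add_sum_filter_not P₂ (fun p => (p : ℤ) ∣ t.2 - t.1)] at hbig₂
    simp only [card_singleton, Nat.cast_one, one_mul] at hbad
    push_cast
    rw [show (2 : ℝ) * (2 * L₁) ^ 2 = 8 * L₁ ^ 2 by ring]
    linarith
  calc #A ≤ #M + #(U.biUnion S) := (card_le_card hsub).trans (card_union_le _ _)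
    _ ≤ 2 * k + #U * (k * L₂) := add_le_add hM (card_biUnion_le_card_mul _ _ _ hS)
    _ ≤ 2 * k + (2 * k) ^ 2 * (k * L₂) := by
      gcongr
      refine (card_filter_le _ _).trans ?_
      rw [card_product, ← pow_two]
      gcongr

open Filter Real in
theorem eventually_parameters {ε : ℝ} (hε : 0 < ε) (hε' : ε < 1 / 2) (K₁ K₂ x₀ : ℝ) :
    ∀ᶠ l : ℝ in atTop, 1 ≤ l ∧ K₁ < l ∧ x₀ ≤ l ∧ 32 * l ≤ l ^ (1 / ε) ∧
      2 * l ^ (1 / ε) ≤ exp l ∧ K₂ * log (8 * l ^ (1 / ε)) < l ^ (2 * ε) := by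
  have h4 : ∀ᶠ l : ℝ in atTop, 32 * l ≤ l ^ (1 / ε) := by
    filter_upwards [eventually_ge_atTop 32] with l hl
    have h2 : (2 : ℝ) ≤ 1 / ε := by
      rw [le_div_iff₀ hε]
      linarith
    calc 32 * l ≤ l ^ (2 : ℝ) := by
          rw [rpow_two]
          nlinarith
      _ ≤ l ^ (1 / ε) := rpow_le_rpow_of_exponent_le (by linarith) h2
  have h5 : ∀ᶠ l : ℝ in atTop, 2 * l ^ (1 / ε) ≤ exp l := by
    have := (isLittleO_rpow_exp_pos_mul_atTop (1 / ε) one_pos).bound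
      (by norm_num : (0 : ℝ) < 1 / 2)
    filter_upwards [this, eventually_ge_atTop 0] with l hl h0
    rw [one_mul, norm_of_nonneg (by positivity), norm_of_nonneg (by positivity)] at hl
    linarith
  have h6 : ∀ᶠ l : ℝ in atTop, K₂ * log (8 * l ^ (1 / ε)) < l ^ (2 * ε) := by
    have ho : (fun l : ℝ => K₂ * log (8 * l ^ (1 / ε))) =o[atTop] fun l : ℝ => l ^ (2 * ε) := by
      have hc : (fun _ : ℝ => K₂ * log 8) =o[atTop] fun l : ℝ => l ^ (2 * ε) :=
        Asymptotics.isLittleO_const_left.2 (Or.inr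
          (tendsto_norm_atTop_atTop.comp (tendsto_rpow_atTop (by positivity))))
      have hl := (isLittleO_log_rpow_atTop (by positivity : 0 < 2 * ε)).const_mul_left (K₂ * (1 / ε))
      refine (hc.add hl).congr' ?_ EventuallyEq.rfl
      filter_upwards [eventually_gt_atTop 0] with l hl
      rw [log_mul (by norm_num) (by positivity), log_rpow hl]
      ring
    filter_upwards [ho.bound (by norm_num : (0 : ℝ) < 1 / 2), eventually_gt_atTop 0] with l hl h0
    have hp : 0 < l ^ (2 * ε) := by positivity
    rw [norm_of_nonneg hp.le] at hl
    have := (le_abs_self _).trans hl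
    linarith
  filter_upwards [eventually_ge_atTop 1, eventually_gt_atTop K₁, eventually_ge_atTop x₀, h4, h5, h6]
    with l a b c d e f using ⟨a, b, c, d, e, f⟩

theorem rpow_nonneg_of_le_half (x : ℝ) {s : ℝ} (hs : 0 ≤ s) (hs' : s ≤ 1 / 2) : 0 ≤ x ^ s := by
  rcases le_or_gt 0 x with h | h
  · positivity
  · rw [Real.rpow_def_of_neg h]
    refine mul_nonneg (Real.exp_pos _).le (Real.cos_nonneg_of_mem_Icc ⟨?_, ?_⟩) <;>
      nlinarith [Real.pi_pos]

theorem eq_sq_rpow_mul_rpow (ε : ℝ) {y : ℝ} (hy : 0 < y) :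
    y = (y ^ ((1 : ℝ) / 2 - ε)) ^ 2 * y ^ (2 * ε) := by
  rw [← Real.rpow_natCast, ← Real.rpow_mul hy.le, ← Real.rpow_add hy]
  norm_num
  ring_nf
  simp

theorem mul_log_lt_of_le {ε l N : ℝ} {k : ℕ} (hε : 0 < ε) (hε' : ε < 1 / 2) (hl1 : 1 ≤ l)
    (hQexp : 2 * l ^ (1 / ε) ≤ N) (hlK : (2 * k + 1) ^ 3 * 288 < l) (hl : l = Real.log N) :
    (2 * k + 1) ^ 3 * (2 * ⌊(l ^ (1 / ε)) ^ ((1 : ℝ) / 2 - ε)⌋₊ + 1) ^ 2 *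
      Real.log (2 * ⌊(l ^ (1 / ε)) ^ ((1 : ℝ) / 2 - ε)⌋₊ * N) < l ^ (1 / ε) / 2 / 8 := by
  set s := (1 : ℝ) / 2 - ε with hs
  have hs0 : 0 < s := by rw [hs]; linarith
  have hs1 : s < 1 / 2 := by rw [hs]; linarith
  have hl0 : 0 < l := by linarith
  have hQ1 : 1 ≤ l ^ (1 / ε) := Real.one_le_rpow hl1 (by positivity)
  have h3 : (l ^ (1 / ε)) ^ (2 * ε) = l ^ 2 := by
    rw [← Real.rpow_mul hl0.le, ← Real.rpow_natCast]
    congr 1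
    field_simp
    norm_num
  set Q := l ^ (1 / ε)
  have hN0 : 0 < N := by linarith
  have hQs1 : 1 ≤ Q ^ s := Real.one_le_rpow hQ1 hs0.le
  have hQsQ : Q ^ s ≤ Q := Real.rpow_le_self_of_one_le hQ1 (by linarith)
  have hL : (⌊Q ^ s⌋₊ : ℝ) ≤ Q ^ s := Nat.floor_le (by linarith)
  have hL1 : (1 : ℝ) ≤ ⌊Q ^ s⌋₊ := by exact_mod_cast Nat.le_floor (by simpa using hQs1)
  have h4 := eq_sq_rpow_mul_rpow ε (by linarith : 0 < Q)
  have h1 : Real.log (2 * ⌊Q ^ s⌋₊ * N) ≤ 2 * l := by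
    have : (2 : ℝ) * ⌊Q ^ s⌋₊ * N ≤ N * N := by
      gcongr
      nlinarith
    refine (Real.log_le_log (by positivity) this).trans ?_
    rw [Real.log_mul hN0.ne' hN0.ne', ← hl]
    linarith
  have h2 : (2 * (⌊Q ^ s⌋₊ : ℝ) + 1) ^ 2 ≤ 9 * (Q ^ s) ^ 2 := by
    calc (2 * (⌊Q ^ s⌋₊ : ℝ) + 1) ^ 2 ≤ (3 * Q ^ s) ^ 2 := by
          gcongr
          linarith
      _ = _ := by ring
  rw [h3] at h4
  have h5 : 0 < (Q ^ s) ^ 2 := by positivity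
  have h6 : 0 ≤ Real.log (2 * ⌊Q ^ s⌋₊ * N) :=
    Real.log_nonneg (by nlinarith)
  calc (2 * (k : ℝ) + 1) ^ 3 * (2 * ⌊Q ^ s⌋₊ + 1) ^ 2 * Real.log (2 * ⌊Q ^ s⌋₊ * N)
      ≤ (2 * k + 1) ^ 3 * (9 * (Q ^ s) ^ 2) * (2 * l) := by gcongr
    _ = ((2 * k + 1) ^ 3 * 288) * ((Q ^ s) ^ 2 * l) / 16 := by ring
    _ < l * ((Q ^ s) ^ 2 * l) / 16 := by gcongr
    _ = ((Q ^ s) ^ 2 * l ^ 2) / 2 / 8 := by ring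
    _ = Q / 2 / 8 := by rw [← h4]

theorem sq_mul_log_add_log_lt {ε l Q X : ℝ} {k : ℕ} (hε : 0 < ε) (hε' : ε < 1 / 2)
    (hk : 0 < k) (hl1 : 1 ≤ l) (hX : 16 * l ≤ X) (hQ1 : 1 ≤ Q)
    (hQlog : 128 * k ^ 2 * Real.log (8 * Q) < l ^ (2 * ε)) :
    (k * ⌊(2 * X) ^ ((1 : ℝ) / 2 - ε)⌋₊ + 1) ^ 2 *
      Real.log (8 * ⌊Q ^ ((1 : ℝ) / 2 - ε)⌋₊ ^ 2) + l < X / 8 := by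
  set s := (1 : ℝ) / 2 - ε with hs
  have hs0 : 0 < s := by rw [hs]; linarith
  have hs1 : s < 1 / 2 := by rw [hs]; linarith
  have hk1 : (1 : ℝ) ≤ k := by exact_mod_cast hk
  have hQs1 : 1 ≤ Q ^ s := Real.one_le_rpow hQ1 hs0.le
  have hXs1 : 1 ≤ (2 * X) ^ s := Real.one_le_rpow (by linarith) hs0.le
  have hQsQ : (Q ^ s) ^ 2 ≤ Q := by
    rw [← Real.rpow_natCast, ← Real.rpow_mul (by linarith)]
    exact Real.rpow_le_self_of_one_le hQ1 (by push_cast; linarith)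
  have hL₁ : (⌊Q ^ s⌋₊ : ℝ) ≤ Q ^ s := Nat.floor_le (by linarith)
  have hL₂ : (⌊(2 * X) ^ s⌋₊ : ℝ) ≤ (2 * X) ^ s := Nat.floor_le (by linarith)
  have hL₁1 : (1 : ℝ) ≤ ⌊Q ^ s⌋₊ := by exact_mod_cast Nat.le_floor (by simpa using hQs1)
  have h1 : Real.log (8 * ⌊Q ^ s⌋₊ ^ 2) ≤ Real.log (8 * Q) := by
    refine Real.log_le_log (by positivity) ?_
    have : (⌊Q ^ s⌋₊ : ℝ) ^ 2 ≤ (Q ^ s) ^ 2 := by gcongr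
    linarith
  have h2 : ((k : ℝ) * ⌊(2 * X) ^ s⌋₊ + 1) ^ 2 ≤ 4 * k ^ 2 * ((2 * X) ^ s) ^ 2 := by
    calc ((k : ℝ) * ⌊(2 * X) ^ s⌋₊ + 1) ^ 2 ≤ (2 * (k * (2 * X) ^ s)) ^ 2 := by
          gcongr
          nlinarith
      _ = _ := by ring
  have h3 : l ^ (2 * ε) ≤ (2 * X) ^ (2 * ε) :=
    Real.rpow_le_rpow (by linarith) (by linarith) (by positivity)
  have h4 := eq_sq_rpow_mul_rpow ε (by linarith : 0 < 2 * X)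
  have h5 : 0 < ((2 * X) ^ s) ^ 2 := by positivity
  have h6 : 0 ≤ Real.log (8 * ⌊Q ^ s⌋₊ ^ 2) := Real.log_nonneg (by nlinarith)
  have h7 : (k * ⌊(2 * X) ^ s⌋₊ + 1) ^ 2 * Real.log (8 * ⌊Q ^ s⌋₊ ^ 2) < X / 16 := by
    calc ((k : ℝ) * ⌊(2 * X) ^ s⌋₊ + 1) ^ 2 * Real.log (8 * ⌊Q ^ s⌋₊ ^ 2)
        ≤ (4 * k ^ 2 * ((2 * X) ^ s) ^ 2) * Real.log (8 * Q) := by gcongr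
      _ = ((2 * X) ^ s) ^ 2 * (128 * k ^ 2 * Real.log (8 * Q)) / 32 := by ring
      _ < ((2 * X) ^ s) ^ 2 * (2 * X) ^ (2 * ε) / 32 := by
        gcongr
        exact hQlog.trans_le h3
      _ = X / 16 := by rw [← h4]; ring
  linarith

theorem stmt5 :
    ∀ ε : ℝ, ε ∈ Set.Ioo (0 : ℝ) (1/2) → ∀ k : ℕ, 0 < k →
      ∃ N₀ : ℕ, ∃ C : ℝ, 0 < C ∧
        ∀ N : ℕ, N₀ < N → ∀ p₀ : ℝ, p₀ ≤ (Real.log N) ^ (1 / ε) / 2 →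
          ∀ R : (p : ℕ) → Fin k → Set (ZMod p),
            (∀ p : ℕ, Nat.Prime p → p₀ ≤ (p : ℝ) → (p : ℝ) ≤ (Real.log N) ^ (1 / ε) →
              ∀ i : Fin k, ∃ m : ℕ, (m : ℝ) ≤ (p : ℝ) ^ ((1 : ℝ)/2 - ε) ∧
                IsAPZModLen p (R p i) m) →
            ∀ A : Set ℤ,
              A = {n : ℤ | 0 ≤ n ∧ n ≤ (N : ℤ) ∧
                    ∀ p : ℕ, Nat.Prime p → p₀ ≤ (p : ℝ) →
                      (p : ℝ) ≤ (Real.log N) ^ (1 / ε) →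
                        ∃ i : Fin k, (n : ZMod p) ∈ R p i} →
              (A.ncard : ℝ) ≤ C * ((Real.log N) ^ ((1 : ℝ)/2 - ε) + p₀ ^ ((1 : ℝ)/2 - ε)) := by
  rintro ε ⟨hε, hε'⟩ k hk
  obtain ⟨x₀, hx₀⟩ := Filter.eventually_atTop.1 eventually_div_eight_le_sum_log_primes
  obtain ⟨N₀, hN₀⟩ := Filter.eventually_atTop.1 ((Real.tendsto_log_atTop.comp
    tendsto_natCast_atTop_atTop).eventually (eventually_parameters hε hε'
      ((2 * k + 1) ^ 3 * 288) (128 * k ^ 2) x₀))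
  refine ⟨N₀, 2 * k + 128 * k ^ 3, by positivity, fun N hN p₀ hp₀ R hR A hA => ?_⟩
  obtain ⟨hl1, hlK, hlx, hQl, hQexp, hQlog⟩ := hN₀ N hN.le
  simp only [Function.comp] at hl1 hlK hlx hQl hQexp hQlog
  have hN0 : (0 : ℝ) < N := by
    rcases Nat.eq_zero_or_pos N with rfl | h
    · norm_num at hl1
    · exact_mod_cast h
  rw [Real.exp_log hN0] at hQexp
  set l := Real.log N with hl
  set Q := l ^ (1 / ε) with hQ
  set s := (1 : ℝ) / 2 - ε with hs
  have hs0 : 0 < s := by rw [hs]; linarith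
  have hs1 : s < 1 / 2 := by rw [hs]; linarith
  have hl0 : 0 < l := by linarith
  have hQ1 : 1 ≤ Q := by linarith
  have hfin : A.Finite := by
    refine (Set.finite_Icc (0 : ℤ) N).subset fun n hn => ?_
    rw [hA] at hn
    exact ⟨hn.1, hn.2.1⟩
  lift A to Finset ℤ using hfin
  rw [Set.ncard_coe_finset]
  have hmem : ∀ n ∈ A, 0 ≤ n ∧ n ≤ (N : ℤ) ∧ ∀ p : ℕ, Nat.Prime p → p₀ ≤ (p : ℝ) →
      (p : ℝ) ≤ Q → ∃ i : Fin k, (n : ZMod p) ∈ R p i := fun n hn => by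
    have : n ∈ (A : Set ℤ) := hn
    rwa [hA] at this
  have hcov : ∀ X : ℝ, p₀ ≤ X → 0 ≤ X → 2 * X ≤ Q →
      ∀ p ∈ (Finset.Ioc ⌊X⌋₊ (2 * ⌊X⌋₊)).filter Nat.Prime, IsCoveredMod k ⌊(2 * X) ^ s⌋₊ p A := by
    intro X hX hX0 hXQ p hp
    simp only [Finset.mem_filter, Finset.mem_Ioc] at hp
    have hpX : X < p := (Nat.floor_lt hX0).1 hp.1.1
    have hpX' : (p : ℝ) ≤ 2 * X := by
      have h1 : (p : ℝ) ≤ 2 * (⌊X⌋₊ : ℝ) := by exact_mod_cast hp.1.2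
      linarith [Nat.floor_le hX0]
    choose m hm a d had using hR p hp.2 (by linarith) (by linarith)
    refine ⟨a, d, fun n hn => ?_⟩
    obtain ⟨i, hi⟩ := (hmem n hn).2.2 p hp.2 (by linarith) (by linarith)
    rw [had i] at hi
    obtain ⟨j, hj, hjn⟩ := hi
    refine ⟨i, j, lt_of_lt_of_le hj (Nat.le_floor ((hm i).trans ?_)), hjn.symm⟩
    exact Real.rpow_le_rpow (by positivity) hpX' hs0.le
  have hprime : ∀ X : ℝ, ∀ p ∈ (Finset.Ioc ⌊X⌋₊ (2 * ⌊X⌋₊)).filter Nat.Prime, p.Prime :=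
    fun X p hp => (Finset.mem_filter.1 hp).2
  set X := max p₀ (16 * l) with hXdef
  have hX16 : 16 * l ≤ X := le_max_right _ _
  have hX0 : 0 < X := by linarith
  have hXQ : 2 * X ≤ Q := by
    have : X ≤ Q / 2 := max_le hp₀ (by linarith)
    linarith
  have hQs1 : 1 ≤ Q ^ s := Real.one_le_rpow hQ1 hs0.le
  have hL₂ : (⌊(2 * X) ^ s⌋₊ : ℝ) ≤ (2 * X) ^ s := Nat.floor_le (by positivity)
  have hL₁1 : 1 ≤ ⌊Q ^ s⌋₊ := Nat.le_floor (by simpa using hQs1)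
  have hbig₁ : (2 * k + 1) ^ 3 * (2 * ⌊Q ^ s⌋₊ + 1) ^ 2 * Real.log (2 * ⌊Q ^ s⌋₊ * N) <
      ∑ p ∈ Finset.Ioc ⌊Q / 2⌋₊ (2 * ⌊Q / 2⌋₊) with p.Prime, Real.log p :=
    (mul_log_lt_of_le hε hε' hl1 hQexp hlK hl).trans_le (hx₀ (Q / 2) (by linarith))
  have hbig₂ : (k * ⌊(2 * X) ^ s⌋₊ + 1) ^ 2 * Real.log (8 * ⌊Q ^ s⌋₊ ^ 2) + Real.log N <
      ∑ p ∈ Finset.Ioc ⌊X⌋₊ (2 * ⌊X⌋₊) with p.Prime, Real.log p :=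
    (sq_mul_log_add_log_lt hε hε' hk hl1 hX16 hQ1 hQlog).trans_le
      (hx₀ X (by linarith))
  have hQ2 : 2 * (Q / 2) = Q := by ring
  have hcard := card_le_of_isCoveredMod (fun x hx => ⟨(hmem x hx).1, (hmem x hx).2.1⟩)
    (hprime (Q / 2)) (hprime X)
    (by simpa only [hQ2] using hcov (Q / 2) hp₀ (by linarith) hQ2.le)
    (hcov X (le_max_left _ _) hX0.le hXQ) hL₁1 hbig₁ hbig₂
  have hcard' : (A.card : ℝ) ≤ 2 * k + (2 * k) ^ 2 * (k * ⌊(2 * X) ^ s⌋₊) := by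
    exact_mod_cast hcard
  have hp₀s : 0 ≤ p₀ ^ s := rpow_nonneg_of_le_half p₀ hs0.le hs1.le
  have hls : 1 ≤ l ^ s := Real.one_le_rpow hl1 hs0.le
  have hscale : ∀ c : ℝ, 1 ≤ c → c ^ s ≤ c := fun c hc =>
    Real.rpow_le_self_of_one_le hc (by linarith)
  have hXs : (2 * X) ^ s ≤ 32 * (l ^ s + p₀ ^ s) := by
    rcases le_total p₀ (16 * l) with h | h
    · rw [hXdef, max_eq_right h, show 2 * (16 * l) = 32 * l by ring,
        Real.mul_rpow (by norm_num) hl0.le]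
      nlinarith [hscale 32 (by norm_num)]
    · rw [hXdef, max_eq_left h, Real.mul_rpow (by norm_num) (by linarith)]
      nlinarith [hscale 2 (by norm_num)]
  calc (A.card : ℝ) ≤ 2 * k + (2 * k) ^ 2 * (k * ⌊(2 * X) ^ s⌋₊) := hcard'
    _ ≤ 2 * k * (l ^ s + p₀ ^ s) + (2 * k) ^ 2 * (k * (32 * (l ^ s + p₀ ^ s))) := by
      refine add_le_add (le_mul_of_one_le_right (by positivity) (by linarith)) ?_
      gcongr
      exact hL₂.trans hXs
    _ = (2 * k + 128 * k ^ 3) * (l ^ s + p₀ ^ s) := by ring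
end

section
/- For each ε ∈ (0, 1) and each η > 0 there are constants c₁(ε, η), C₂(ε, η) > 0 such that the following holds. Let r be a positive integer, δ ∈ (0, 1), let N be a positive integer, and let y be a real number with (log N)^{2/(1−ε)} < y ≤ N. Let S ⊆ {1, …, N} be a set such that for every prime p ∈ [y, 2y] there exists a GAP R_p over ℤ/pℤ of rank at most r with S_p ⊆ R_p and |R_p| ≤ δ^{−1}·|S_p| ≤ p^ε. Then there exist a subset S' ⊆ S and a GAP Q over ℤ of rank at most C₂(ε,η)·(r + log δ^{−1})^{3+η} such that S' ⊆ Q, |S'| ≥ c₁(ε,η)·δ^{C₂(ε,η)}·exp(−C₂(ε,η)·r·(r + log δ^{−1})^{3+η})·|S|, and |Q| ≤ exp(C₂(ε,η)·(r + log δ^{−1})^{3+η})·|S'|. -/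
/-- `P` is a generalized arithmetic progression of rank `r` over the abelian group `G`. -/
def IsGAP {G : Type*} [AddCommGroup G] (P : Set G) (r : ℕ) : Prop :=
  ∃ (a : G) (v : Fin r → G) (M L : Fin r → ℤ),
    P = {x : G | ∃ n : Fin r → ℤ, (∀ i, M i ≤ n i ∧ n i ≤ L i) ∧ x = a + ∑ i, n i • v i}

/-- An upper bound for the central binomial coefficient in terms of the number of primes in
`(n, 2n]`. -/
theorem centralBinom_le_mul_pow_card_primes (n : ℕ) (hn : 2 < n) :
    n.centralBinom ≤ (2 * n) ^ Nat.sqrt (2 * n) * 4 ^ (2 * n / 3) *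
      (2 * n) ^ ((Finset.Ioc n (2 * n)).filter Nat.Prime).card := by
  have n_pos : 0 < n := by omega
  have n2_pos : 1 ≤ 2 * n := by omega
  let f x := x ^ n.centralBinom.factorization x
  have hf : ∀ p, f p ≤ 2 * n := fun p => Nat.pow_factorization_choose_le (by omega)
  have hprod : n.centralBinom = ∏ p ∈ (Finset.range (2 * n + 1)).filter Nat.Prime, f p := by
    rw [← n.prod_pow_factorization_centralBinom]
    symm
    refine Finset.prod_filter_of_ne fun p _ h => ?_
    contrapose h
    dsimp only [f]
    rw [Nat.factorization_eq_zero_of_not_prime _ h, pow_zero]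
  rw [hprod, ← Finset.prod_filter_mul_prod_filter_not _ (· ≤ 2 * n / 3),
    ← Finset.prod_filter_mul_prod_filter_not
      (((Finset.range (2 * n + 1)).filter Nat.Prime).filter (· ≤ 2 * n / 3))
      (· ≤ Nat.sqrt (2 * n))]
  refine mul_le_mul' (mul_le_mul' ?_ ?_) ?_
  · refine (Finset.prod_le_prod' fun p _ => hf p).trans ?_
    have : (Finset.Icc 1 (Nat.sqrt (2 * n))).card = Nat.sqrt (2 * n) := by simp
    rw [Finset.prod_const]
    refine pow_right_mono₀ n2_pos ((Finset.card_le_card fun x hx => ?_).trans this.le)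
    simp only [Finset.mem_filter] at hx
    exact Finset.mem_Icc.mpr ⟨hx.1.1.2.one_lt.le, hx.2⟩
  · refine le_trans ?_ (primorial_le_four_pow (2 * n / 3))
    refine (Finset.prod_le_prod' fun p hp => (?_ : f p ≤ p)).trans ?_
    · simp only [Finset.mem_filter, not_le] at hp
      refine (pow_right_mono₀ hp.1.1.2.one_lt.le ?_).trans (pow_one p).le
      exact Nat.factorization_choose_le_one (Nat.sqrt_lt'.mp hp.2)
    refine Finset.prod_le_prod_of_subset_of_one_le' ?_ ?_
    · intro p hp
      simp only [Finset.mem_filter, Finset.mem_range] at hp ⊢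
      exact ⟨by omega, hp.1.1.2⟩
    · exact fun p hp _ => (Finset.mem_filter.1 hp).2.one_lt.le
  · calc _ ≤ ∏ p ∈ ((Finset.range (2 * n + 1)).filter Nat.Prime).filter (¬ · ≤ 2 * n / 3),
          (if n < p then 2 * n else 1) := by
          refine Finset.prod_le_prod' fun p hp => ?_
          split_ifs with h
          · exact hf p
          · simp only [Finset.mem_filter, not_le] at hp
            dsimp only [f]
            rw [Nat.factorization_centralBinom_of_two_mul_self_lt_three_mul hn (by omega)
              (by omega), pow_zero]
      _ ≤ _ := by
          rw [← Finset.prod_filter, Finset.prod_const]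
          refine pow_right_mono₀ n2_pos (Finset.card_le_card fun p hp => ?_)
          simp only [Finset.mem_filter, Finset.mem_range, Finset.mem_Ioc] at hp ⊢
          exact ⟨⟨hp.2, by omega⟩, hp.1.1.2⟩

theorem eventually_le_card_primes_mul_log :
    ∀ᶠ n : ℕ in Filter.atTop,
      (n : ℝ) / 4 ≤ ((Finset.Ioc n (2 * n)).filter Nat.Prime).card * Real.log (2 * n) := by
  have h1 : (fun x : ℝ => Real.log x) =o[Filter.atTop] fun x : ℝ => x ^ (1 / 4 : ℝ) :=
    isLittleO_log_rpow_atTop (by norm_num)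
  have h2 : Filter.Tendsto (fun n : ℕ => 2 * (n : ℝ)) Filter.atTop Filter.atTop :=
    tendsto_natCast_atTop_atTop.const_mul_atTop (by norm_num)
  have h3 := h2.eventually ((h1.bound (show (0 : ℝ) < 1 by norm_num)))
  have h4 := h2.eventually
    ((tendsto_rpow_atTop (show (0 : ℝ) < 1 / 4 by norm_num)).eventually_ge_atTop 100)
  filter_upwards [h3, h4, Filter.eventually_ge_atTop 4] with n h3 h4 hn
  set P := ((Finset.Ioc n (2 * n)).filter Nat.Prime).card
  have hn0 : (4 : ℝ) ≤ n := by exact_mod_cast hn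
  set u : ℝ := (2 * (n : ℝ)) ^ (1 / 4 : ℝ) with hu
  have hu4 : u ^ 4 = 2 * n := by
    rw [hu, ← Real.rpow_natCast, ← Real.rpow_mul (by positivity)]; norm_num
  have hlog0 : 0 ≤ Real.log (2 * n) := Real.log_nonneg (by linarith)
  have hlog : Real.log (2 * n) ≤ u := by
    rw [Real.norm_of_nonneg hlog0, Real.norm_of_nonneg (by positivity)] at h3
    linarith
  have hsq : (Nat.sqrt (2 * n) : ℝ) ≤ u ^ 2 := by
    refine Real.nat_sqrt_le_real_sqrt.trans ?_
    rw [Real.sqrt_le_left (by positivity)]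
    push_cast
    rw [← hu4]; ring_nf; rfl
  have hmain : (4 : ℝ) ^ n ≤ (2 * n) * ((2 * n) ^ Nat.sqrt (2 * n) * 4 ^ (2 * n / 3) *
      (2 * n) ^ P) := by
    have := (Nat.four_pow_lt_mul_centralBinom n hn).le.trans
      (Nat.mul_le_mul_left n (centralBinom_le_mul_pow_card_primes n (by omega)))
    have h' : (4 : ℝ) ^ n ≤ n * ((2 * n) ^ Nat.sqrt (2 * n) * 4 ^ (2 * n / 3) *
      (2 * n) ^ P) := by exact_mod_cast this
    refine h'.trans ?_
    gcongr
    linarith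
  have hl := Real.log_le_log (by positivity) hmain
  rw [Real.log_mul (x := 2 * (n : ℝ)) (by positivity) (by positivity),
    Real.log_mul (y := (2 * (n : ℝ)) ^ P) (by positivity) (by positivity),
    Real.log_mul (y := (4 : ℝ) ^ (2 * n / 3)) (by positivity) (by positivity),
    Real.log_pow, Real.log_pow, Real.log_pow, Real.log_pow] at hl
  have hdiv : ((2 * n / 3 : ℕ) : ℝ) ≤ 2 * n / 3 := by
    have := @Nat.cast_div_le ℝ _ _ _ (2 * n) 3
    push_cast at this
    exact this
  have hl4 : (1 : ℝ) ≤ Real.log 4 := by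
    rw [show (4 : ℝ) = 2 ^ 2 by norm_num, Real.log_pow]
    have := Real.log_two_gt_d9
    push_cast; linarith
  have hA : (Nat.sqrt (2 * n) : ℝ) * Real.log (2 * n) ≤ u ^ 2 * u := by gcongr
  have hB : ((2 * n / 3 : ℕ) : ℝ) * Real.log 4 ≤ 2 * n / 3 * Real.log 4 := by gcongr
  have hC : (n : ℝ) / 3 ≤ n / 3 * Real.log 4 := by nlinarith
  have hu3 : 100 * u ^ 3 ≤ u ^ 4 := by
    have : 0 ≤ u ^ 3 := by positivity
    nlinarith
  have hu1 : u ≤ u ^ 3 := by nlinarith [sq_nonneg u, sq_nonneg (u - 1)]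
  nlinarith

/-- The primes in the real interval `[y, 2y]`. -/
noncomputable def primesBetween (y : ℝ) : Finset ℕ :=
  (Finset.range (⌊2 * y⌋₊ + 1)).filter fun p => p.Prime ∧ y ≤ p

theorem mem_primesBetween {y : ℝ} (hy : 0 ≤ y) {p : ℕ} :
    p ∈ primesBetween y ↔ p.Prime ∧ y ≤ p ∧ (p : ℝ) ≤ 2 * y := by
  simp only [primesBetween, Finset.mem_filter, Finset.mem_range, Nat.lt_succ_iff,
    Nat.le_floor_iff (show 0 ≤ 2 * y by linarith)]
  tauto

theorem eventually_le_card_primesBetween_mul_log :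
    ∃ y₀ : ℝ, 1 < y₀ ∧ ∀ y ≥ y₀, y / 16 ≤ (primesBetween y).card * Real.log y := by
  obtain ⟨n₀, hn₀⟩ := Filter.eventually_atTop.1 eventually_le_card_primes_mul_log
  refine ⟨n₀ + 2, by linarith [Nat.cast_nonneg (α := ℝ) n₀], fun y hy => ?_⟩
  have hy2 : 2 ≤ y := by linarith [Nat.cast_nonneg (α := ℝ) n₀]
  have hn := hn₀ ⌊y⌋₊ (Nat.le_floor (by linarith))
  have hfl := Nat.floor_le (show 0 ≤ y by linarith)
  have hfl' := Nat.lt_floor_add_one y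
  have hcard : ((Finset.Ioc ⌊y⌋₊ (2 * ⌊y⌋₊)).filter Nat.Prime).card ≤ (primesBetween y).card := by
    refine Finset.card_le_card fun p hp => ?_
    simp only [Finset.mem_filter, Finset.mem_Ioc] at hp
    rw [mem_primesBetween (by linarith)]
    refine ⟨hp.2, ((Nat.floor_lt (by linarith)).1 hp.1.1).le, ?_⟩
    have : (p : ℝ) ≤ 2 * ⌊y⌋₊ := by exact_mod_cast hp.1.2
    linarith
  have hpos : (0 : ℝ) < ⌊y⌋₊ := by linarith
  have hlog : Real.log (2 * ⌊y⌋₊) ≤ 2 * Real.log y := by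
    rw [show 2 * Real.log y = Real.log (y ^ 2) by rw [Real.log_pow]; norm_num]
    exact Real.log_le_log (by positivity) (by nlinarith)
  have hlog0 : 0 ≤ Real.log y := Real.log_nonneg (by linarith)
  calc y / 16 ≤ (⌊y⌋₊ / 4) / 2 := by linarith
    _ ≤ ((primesBetween y).card * (2 * Real.log y)) / 2 := by
      gcongr
      exact hn.trans (by gcongr; exact Real.log_nonneg (by linarith))
    _ = _ := by ring

theorem card_primesBetween_dvd_mul_log_le {y X : ℝ} (hy : 1 < y) {n : ℤ} (hn : n ≠ 0)
    (hX : |(n : ℝ)| ≤ X) :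
    (((primesBetween y).filter fun p : ℕ => (p : ℤ) ∣ n).card : ℝ) * Real.log y ≤ Real.log X := by
  have hdvd : ∏ p ∈ (primesBetween y).filter fun p : ℕ => (p : ℤ) ∣ n, p ∣ n.natAbs := by
    refine Finset.prod_primes_dvd _ (fun p hp => ?_) fun p hp => ?_
    · rw [Finset.mem_filter, mem_primesBetween (by linarith)] at hp
      exact hp.1.1.prime
    · exact Int.natCast_dvd.1 (Finset.mem_filter.1 hp).2
  have hle := Nat.le_of_dvd (Int.natAbs_pos.2 hn) hdvd
  have hle' : ((∏ p ∈ (primesBetween y).filter fun p : ℕ => (p : ℤ) ∣ n, p : ℕ) : ℝ) ≤ X := by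
    refine le_trans ?_ hX
    rw [← Int.cast_abs, Int.abs_eq_natAbs]
    exact_mod_cast hle
  rw [← Real.log_pow]
  refine Real.log_le_log (by positivity) (le_trans ?_ hle')
  push_cast
  rw [← Finset.prod_const]
  refine Finset.prod_le_prod (fun _ _ => by linarith) fun p hp => ?_
  rw [Finset.mem_filter, mem_primesBetween (by linarith)] at hp
  exact hp.1.2.1

open scoped Pointwise

/-- The `k`-fold sumset `D + ⋯ + D`. -/
def sumset {G : Type*} [AddCommGroup G] [DecidableEq G] (D : Finset G) : ℕ → Finset G
  | 0 => {0}
  | k + 1 => sumset D k + D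

section Sumset

variable {G H : Type*} [AddCommGroup G] [DecidableEq G] [AddCommGroup H] [DecidableEq H]
  {D : Finset G} {E : Finset H}

theorem add_mem_sumset {j k : ℕ} {a b : G} (ha : a ∈ sumset D j) (hb : b ∈ sumset D k) :
    a + b ∈ sumset D (j + k) := by
  induction k generalizing b with
  | zero =>
    obtain rfl : b = 0 := by simpa [sumset] using hb
    simpa using ha
  | succ k ih =>
    obtain ⟨c, hc, d, hd, rfl⟩ := Finset.mem_add.1 hb
    rw [← add_assoc a]
    exact Finset.add_mem_add (ih hc) hd

theorem sumset_one (D : Finset G) : sumset D 1 = D := by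
  rw [sumset, sumset, Finset.singleton_zero, zero_add]

theorem sumset_mono (h0 : 0 ∈ D) : Monotone (sumset D) :=
  monotone_nat_of_le_succ fun k x hx => by
    simpa [sumset] using Finset.add_mem_add hx h0

theorem zero_mem_sumset (h0 : 0 ∈ D) (k : ℕ) : 0 ∈ sumset D k :=
  sumset_mono h0 (Nat.zero_le k) (by simp [sumset])

theorem neg_mem_sumset (hneg : ∀ d ∈ D, -d ∈ D) {k : ℕ} {x : G} (hx : x ∈ sumset D k) :
    -x ∈ sumset D k := by
  induction k generalizing x with
  | zero => simpa [sumset] using hx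
  | succ k ih =>
    obtain ⟨c, hc, d, hd, rfl⟩ := Finset.mem_add.1 hx
    rw [neg_add]
    exact Finset.add_mem_add (ih hc) (hneg d hd)

theorem map_mem_sumset (f : G →+ H) (hf : ∀ d ∈ D, f d ∈ E) {k : ℕ} {x : G}
    (hx : x ∈ sumset D k) : f x ∈ sumset E k := by
  induction k generalizing x with
  | zero =>
    obtain rfl : x = 0 := by simpa [sumset] using hx
    simp [sumset]
  | succ k ih =>
    obtain ⟨c, hc, d, hd, rfl⟩ := Finset.mem_add.1 hx
    rw [map_add]
    exact Finset.add_mem_add (ih hc) (hf d hd)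

theorem exists_of_mem_sumset_image (f : G →+ H) {k : ℕ} {y : H}
    (hy : y ∈ sumset (D.image f) k) : ∃ x ∈ sumset D k, f x = y := by
  induction k generalizing y with
  | zero =>
    obtain rfl : y = 0 := by simpa [sumset] using hy
    exact ⟨0, by simp [sumset]⟩
  | succ k ih =>
    obtain ⟨c, hc, d, hd, rfl⟩ := Finset.mem_add.1 hy
    obtain ⟨x, hx, rfl⟩ := ih hc
    obtain ⟨e, he, rfl⟩ := Finset.mem_image.1 hd
    exact ⟨x + e, Finset.add_mem_add hx he, map_add f x e⟩

theorem sum_mem_sumset {r k : ℕ} {x : Fin r → G} (hx : ∀ i, x i ∈ sumset D k) :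
    ∑ i, x i ∈ sumset D (r * k) := by
  induction r with
  | zero => simp [sumset]
  | succ r ih =>
    rw [Fin.sum_univ_castSucc, Nat.succ_mul]
    exact add_mem_sumset (ih fun i => hx i.castSucc) (hx _)

theorem zsmul_mem_sumset (h0 : 0 ∈ D) (hneg : ∀ d ∈ D, -d ∈ D) {g : G} (hg : g ∈ D) {t : ℤ}
    {k : ℕ} (ht : |t| ≤ k) : t • g ∈ sumset D k := by
  have hnat : ∀ n : ℕ, n • g ∈ sumset D n := fun n => by
    induction n with
    | zero => simp [sumset]
    | succ n ih =>
      rw [succ_nsmul]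
      exact Finset.add_mem_add ih hg
  obtain ⟨n, rfl | rfl⟩ := t.eq_nat_or_neg
  · rw [natCast_zsmul]
    exact sumset_mono h0 (by simpa using ht) (hnat n)
  · rw [neg_zsmul, natCast_zsmul]
    exact neg_mem_sumset hneg (sumset_mono h0 (by simpa using ht) (hnat n))

theorem abs_le_of_mem_sumset {D : Finset ℤ} {X : ℤ} (hD : ∀ d ∈ D, |d| ≤ X) {k : ℕ} {x : ℤ}
    (hx : x ∈ sumset D k) : |x| ≤ k * X := by
  induction k generalizing x with
  | zero =>
    obtain rfl : x = 0 := by simpa [sumset] using hx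
    simp
  | succ k ih =>
    obtain ⟨c, hc, d, hd, rfl⟩ := Finset.mem_add.1 hx
    push_cast
    linarith [abs_add_le c d, ih hc, hD d hd]

theorem sumset_subset_of_stable (h0 : 0 ∈ D) {j : ℕ} (hj : sumset D (j + 1) ⊆ sumset D j)
    (m : ℕ) : sumset D m ⊆ sumset D j := by
  induction m with
  | zero => exact sumset_mono h0 (Nat.zero_le j)
  | succ m ih => exact (Finset.add_subset_add_right ih).trans hj

theorem exists_stable_or_mul_card_le (h0 : 0 ∈ D) (hneg : ∀ d ∈ D, -d ∈ D) (i : ℕ) :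
    (∃ j ≤ 3 * i, sumset D (j + 1) ⊆ sumset D j) ∨ i * D.card ≤ (sumset D (3 * i)).card := by
  induction i with
  | zero => right; simp
  | succ i ih =>
    rcases ih with ⟨j, hj, hs⟩ | ih
    · exact Or.inl ⟨j, by omega, hs⟩
    by_cases hs : sumset D (3 * i + 1 + 1) ⊆ sumset D (3 * i + 1)
    · exact Or.inl ⟨3 * i + 1, by omega, hs⟩
    right
    obtain ⟨x, hx, hx'⟩ := Finset.not_subset.1 hs
    have hdisj : Disjoint (sumset D (3 * i)) (D.image (x + ·)) := by
      rw [Finset.disjoint_left]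
      intro y hy hy'
      obtain ⟨d, hd, rfl⟩ := Finset.mem_image.1 hy'
      refine hx' ?_
      have := Finset.add_mem_add hy (hneg d hd)
      simpa [sumset] using this
    have hsub : sumset D (3 * i) ∪ D.image (x + ·) ⊆ sumset D (3 * (i + 1)) := by
      refine Finset.union_subset (sumset_mono h0 (by omega)) fun y hy => ?_
      obtain ⟨d, hd, rfl⟩ := Finset.mem_image.1 hy
      exact Finset.add_mem_add hx hd
    calc (i + 1) * D.card = i * D.card + D.card := by ring
      _ ≤ (sumset D (3 * i)).card + (D.image (x + ·)).card := by
        rw [Finset.card_image_of_injective _ (add_right_injective x)]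
        omega
      _ = (sumset D (3 * i) ∪ D.image (x + ·)).card := (Finset.card_union_of_disjoint hdisj).symm
      _ ≤ _ := Finset.card_le_card hsub

theorem closure_subset_sumset [Fintype G] (h0 : 0 ∈ D) (hneg : ∀ d ∈ D, -d ∈ D) {n : ℕ}
    (hn : Fintype.card G < n * D.card) {x : G} (hx : x ∈ AddSubgroup.closure (D : Set G)) :
    x ∈ sumset D (3 * n) := by
  rcases exists_stable_or_mul_card_le h0 hneg n with ⟨j, hj, hs⟩ | h
  · refine sumset_mono h0 hj ?_
    induction hx using AddSubgroup.closure_induction with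
    | mem x hx =>
      exact sumset_subset_of_stable h0 hs 1 (by rw [sumset_one]; exact hx)
    | zero => exact zero_mem_sumset h0 j
    | add x y _ _ hx hy => exact sumset_subset_of_stable h0 hs _ (add_mem_sumset hx hy)
    | neg x _ hx => exact neg_mem_sumset hneg hx
  · exact absurd (h.trans (Finset.card_le_univ _)) (by omega)

theorem neg_mem_sub_self (A : Finset G) : ∀ d ∈ A - A, -d ∈ A - A := by
  intro d hd
  obtain ⟨a, ha, b, hb, rfl⟩ := Finset.mem_sub.1 hd
  rw [neg_sub]
  exact Finset.sub_mem_sub hb ha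

theorem zero_mem_sub_self {A : Finset G} (hA : A.Nonempty) : 0 ∈ A - A := by
  obtain ⟨a, ha⟩ := hA
  simpa using Finset.sub_mem_sub ha ha

/-- A `G`-valued arithmetic progression in a `k`-fold sumset lifts along a homomorphism that is
injective on a larger sumset. -/
theorem exists_lift_of_zsmul_mem_sumset (f : G →+ H) (h0 : 0 ∈ D) (hneg : ∀ d ∈ D, -d ∈ D)
    {k₀ k₁ : ℕ} (hinj : ∀ x ∈ sumset D k₀, f x = 0 → x = 0) (hk : 3 * k₁ ≤ k₀) {w : H} {n : ℕ}
    (hw : ∀ j : ℤ, |j| ≤ n → j • w ∈ sumset (D.image f) k₁) :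
    ∃ u : G, ∀ j : ℤ, |j| ≤ n → j • u ∈ sumset D k₁ ∧ f (j • u) = j • w := by
  rcases Nat.eq_zero_or_pos n with rfl | hn
  · refine ⟨0, fun j hj => ?_⟩
    obtain rfl : j = 0 := by simpa using hj
    simpa using zero_mem_sumset h0 k₁
  obtain ⟨u, hu, hfu⟩ := exists_of_mem_sumset_image f (hw 1 (by rw [abs_one]; exact_mod_cast hn))
  rw [one_zsmul] at hfu
  have hnat : ∀ m : ℕ, m ≤ n → m • u ∈ sumset D k₁ := by
    intro m
    induction m with
    | zero => intro _; simpa using zero_mem_sumset h0 k₁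
    | succ m ih =>
      intro hm
      obtain ⟨z, hz, hfz⟩ := exists_of_mem_sumset_image f (hw (m + 1 : ℕ)
        (by rw [Nat.abs_cast]; exact_mod_cast hm))
      have hmem : z + -(m • u) + -u ∈ sumset D k₀ :=
        sumset_mono h0 (by omega) (add_mem_sumset (add_mem_sumset hz
          (neg_mem_sumset hneg (ih (by omega)))) (neg_mem_sumset hneg hu))
      have hzero := hinj _ hmem (by
        rw [map_add, map_add, map_neg, map_neg, map_nsmul, hfz, hfu, natCast_zsmul, succ_nsmul]
        abel)
      have : z = (m + 1) • u := by
        rw [succ_nsmul, ← sub_eq_zero, ← hzero]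
        abel
      rwa [← this]
  refine ⟨u, fun j hj => ⟨?_, by rw [map_zsmul, hfu]⟩⟩
  obtain ⟨m, rfl | rfl⟩ := j.eq_nat_or_neg
  · rw [natCast_zsmul]
    exact hnat m (by simpa using hj)
  · rw [neg_zsmul, natCast_zsmul]
    exact neg_mem_sumset hneg (hnat m (by simpa using hj))

end Sumset

/-- A dense set `A` of integers in an interval has an iterated difference set containing a long
homogeneous arithmetic progression, boundedly many translates of which cover the interval. -/
theorem exists_progression_subset_sumset {A : Finset ℤ} {len κ : ℕ}
    (hA : A ⊆ Finset.Icc 0 (len : ℤ)) (hne : A.Nonempty) (hκ : len + 1 ≤ κ * A.card) :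
    ∃ (q : ℤ) (n : ℕ) (F : Finset ℤ), F.card ≤ 4 * κ ∧
      (∀ u ∈ Finset.Icc 0 (len : ℤ), ∃ f ∈ F, ∃ j : ℤ, |j| ≤ n ∧ u = f + j * q) ∧
      ∀ j : ℤ, |j| ≤ n → j * q ∈ sumset (A - A) (12 * κ + 1) := by
  have h0 := zero_mem_sub_self hne
  have hneg := neg_mem_sub_self A
  rcases (Nat.succ_le_of_lt hne.card_pos).eq_or_lt with h1 | h2
  · refine ⟨0, 0, Finset.Icc 0 (len : ℤ), ?_, fun u hu => ⟨u, hu, 0, by simp⟩, fun j _ => ?_⟩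
    · simp only [Int.card_Icc, ← h1] at hκ ⊢
      omega
    · simpa using zero_mem_sumset h0 _
  set m := A.min' hne with hm
  set m' := A.max' hne with hm'
  have hmA : m ∈ A := A.min'_mem hne
  have hmA' : m' ∈ A := A.max'_mem hne
  have hbd : ∀ a ∈ A, m ≤ a ∧ a ≤ m' := fun a ha => ⟨A.min'_le a ha, A.le_max' a ha⟩
  obtain ⟨l, hl⟩ : ∃ l : ℕ, m' - m = l := ⟨(m' - m).toNat, by
    rw [Int.toNat_of_nonneg]; linarith [hbd m' hmA']⟩
  have hcard_l : A.card ≤ l + 1 := by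
    have : A ⊆ Finset.Icc m m' := fun a ha => Finset.mem_Icc.2 (hbd a ha)
    have := Finset.card_le_card this
    rw [Int.card_Icc] at this
    omega
  have hl_len : l ≤ len := by
    have h1 := Finset.mem_Icc.1 (hA hmA)
    have h2 := Finset.mem_Icc.1 (hA hmA')
    omega
  have hl_mem : (l : ℤ) ∈ A - A := hl ▸ Finset.sub_mem_sub hmA' hmA
  have hl_pos : 0 < l := by omega
  obtain ⟨q', hq'⟩ := Int.subgroup_cyclic (AddSubgroup.closure ((A - A : Finset ℤ) : Set ℤ))
  have hmem_iff : ∀ x : ℤ, x ∈ AddSubgroup.closure ((A - A : Finset ℤ) : Set ℤ) ↔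
      ((q'.natAbs : ℕ) : ℤ) ∣ x := by
    intro x
    rw [hq', ← AddSubgroup.zmultiples_eq_closure, Int.mem_zmultiples_iff, Int.natAbs_dvd]
  set q := q'.natAbs
  obtain ⟨n, hn⟩ : q ∣ l :=
    Int.natCast_dvd_natCast.1 ((hmem_iff l).1 (AddSubgroup.subset_closure hl_mem))
  have hq_pos : 0 < q := Nat.pos_of_ne_zero fun h => by simp [h] at hn; omega
  have hn_pos : 0 < n := Nat.pos_of_ne_zero fun h => by simp [h] at hn; omega
  have hcard_n : A.card ≤ n + 1 := by
    have : A ⊆ (Finset.range (n + 1)).image fun j : ℕ => m + q * j := by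
      intro a ha
      obtain ⟨j, hj⟩ := (hmem_iff (a - m)).1
        (AddSubgroup.subset_closure (Finset.sub_mem_sub ha hmA))
      have ha' := hbd a ha
      have hq0 : (0 : ℤ) < q := by exact_mod_cast hq_pos
      have hj0 : 0 ≤ j := by
        by_contra h
        nlinarith
      have hjn : j ≤ n := by
        have : (q : ℤ) * j ≤ q * n := by
          rw [← hj]
          have : (l : ℤ) = q * n := by exact_mod_cast hn
          linarith
        exact le_of_mul_le_mul_left this hq0
      refine Finset.mem_image.2 ⟨j.toNat, by simp; omega, ?_⟩
      rw [Int.toNat_of_nonneg hj0]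
      linarith
    simpa using (Finset.card_le_card this).trans Finset.card_image_le
  have hlen : len ≤ 2 * κ * n := by
    have : κ * A.card ≤ κ * (n + 1) := Nat.mul_le_mul_left _ hcard_n
    have : κ * 1 ≤ κ * n := Nat.mul_le_mul_left _ hn_pos
    nlinarith
  refine ⟨q, n, (Finset.range q ×ˢ Finset.range (len / l + 1)).image
    fun z => (z.1 : ℤ) + l * z.2, ?_, ?_, ?_⟩
  · refine Finset.card_image_le.trans ?_
    rw [Finset.card_product, Finset.card_range, Finset.card_range]
    have hq2 : q ≤ 2 * κ := by
      have : q * n ≤ 2 * κ * n := by rw [← hn]; exact hl_len.trans hlen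
      exact Nat.le_of_mul_le_mul_right this hn_pos
    have h3 : q * (len / l) ≤ 2 * κ := by
      have : len / l * l ≤ len := Nat.div_mul_le_self len l
      have : q * (len / l) * n ≤ 2 * κ * n := by
        calc q * (len / l) * n = len / l * l := by rw [hn]; ring
          _ ≤ _ := this.trans hlen
      exact Nat.le_of_mul_le_mul_right this hn_pos
    rw [mul_add]
    omega
  · intro u hu
    obtain ⟨v, rfl⟩ := Int.eq_ofNat_of_zero_le (Finset.mem_Icc.1 hu).1
    have hv : v ≤ len := by exact_mod_cast (Finset.mem_Icc.1 hu).2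
    refine ⟨_, Finset.mem_image.2 ⟨(v % q, v / l), ?_, rfl⟩, ((v / q % n : ℕ) : ℤ), ?_, ?_⟩
    · simp only [Finset.mem_product, Finset.mem_range]
      exact ⟨Nat.mod_lt _ hq_pos, Nat.lt_succ_of_le (Nat.div_le_div_right hv)⟩
    · rw [Nat.abs_cast]
      exact_mod_cast (Nat.mod_lt _ hn_pos).le
    · have h1 := Nat.mod_add_div v q
      have h2 := Nat.mod_add_div (v / q) n
      rw [Nat.div_div_eq_div_mul, ← hn] at h2
      have : v = v % q + l * (v / l) + v / q % n * q := by
        calc v = v % q + q * (v / q) := h1.symm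
          _ = v % q + q * (v / q % n + n * (v / l)) := by rw [h2]
          _ = v % q + (q * n) * (v / l) + v / q % n * q := by ring
          _ = _ := by rw [← hn]
      exact_mod_cast this
  · have : NeZero l := ⟨hl_pos.ne'⟩
    intro j hj
    let f : ℤ →+ ZMod l := Int.castAddHom (ZMod l)
    set E := (A - A).image f with hE
    have hE0 : 0 ∈ E := Finset.mem_image.2 ⟨0, h0, map_zero f⟩
    have hEneg : ∀ d ∈ E, -d ∈ E := by
      intro d hd
      obtain ⟨e, he, rfl⟩ := Finset.mem_image.1 hd
      exact Finset.mem_image.2 ⟨-e, hneg e he, map_neg f e⟩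
    have hEcard : A.card ≤ E.card + 1 := by
      have hsub : (A.erase m').image (fun a => f (a - m)) ⊆ E := by
        intro y hy
        obtain ⟨a, ha, rfl⟩ := Finset.mem_image.1 hy
        exact Finset.mem_image_of_mem _ (Finset.sub_mem_sub (Finset.mem_of_mem_erase ha) hmA)
      have hinj : Set.InjOn (fun a => f (a - m)) (A.erase m' : Finset ℤ) := by
        intro a ha b hb hab
        simp only [Finset.coe_erase, Set.mem_sdiff, Finset.mem_coe, Set.mem_singleton_iff] at ha hb
        have ha' := hbd a ha.1
        have hb' := hbd b hb.1
        have hd : (l : ℤ) ∣ (b - m) - (a - m) := (ZMod.intCast_eq_intCast_iff_dvd_sub _ _ _).1 hab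
        have hlt : |(b - m) - (a - m)| < l := by
          rw [abs_lt]
          have := lt_of_le_of_ne ha'.2 ha.2
          have := lt_of_le_of_ne hb'.2 hb.2
          constructor <;> linarith
        have := Int.eq_zero_of_abs_lt_dvd hd hlt
        linarith
      have := Finset.card_le_card hsub
      rw [Finset.card_image_of_injOn hinj, Finset.card_erase_of_mem hmA'] at this
      omega
    have hcl : Fintype.card (ZMod l) < 2 * κ * E.card := by
      rw [ZMod.card]
      have : κ * A.card ≤ κ * (2 * E.card) := Nat.mul_le_mul_left _ (by omega)
      nlinarith
    have hjq : f (j * q) ∈ AddSubgroup.closure (E : Set (ZMod l)) := by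
      have h1 : (j * q) ∈ AddSubgroup.closure ((A - A : Finset ℤ) : Set ℤ) :=
        (hmem_iff _).2 (Dvd.intro_left j rfl)
      have h2 := AddSubgroup.mem_map_of_mem f h1
      rwa [AddMonoidHom.map_closure, ← Finset.coe_image] at h2
    obtain ⟨d, hd, hfd⟩ :=
      exists_of_mem_sumset_image f (closure_subset_sumset hE0 hEneg hcl hjq)
    obtain ⟨t, ht⟩ : (l : ℤ) ∣ j * q - d := (ZMod.intCast_eq_intCast_iff_dvd_sub _ _ _).1 hfd
    have hdl : |d| ≤ (3 * (2 * κ) : ℕ) * (l : ℤ) := by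
      refine abs_le_of_mem_sumset (fun e he => ?_) hd
      obtain ⟨a, ha, b, hb, rfl⟩ := Finset.mem_sub.1 he
      have ha' := hbd a ha
      have hb' := hbd b hb
      rw [abs_le]
      constructor <;> linarith
    have hjl : |j * q| ≤ (l : ℤ) := by
      rw [abs_mul, Nat.abs_cast, hn, mul_comm]
      push_cast
      gcongr
    have htl : |t| ≤ (6 * κ + 1 : ℕ) := by
      have : |t| * l ≤ (6 * κ + 1 : ℕ) * l := by
        calc |t| * l = |j * q - d| := by rw [ht, abs_mul, Nat.abs_cast, mul_comm]
          _ ≤ |j * q| + |d| := abs_sub _ _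
          _ ≤ l + (3 * (2 * κ) : ℕ) * l := add_le_add hjl hdl
          _ = _ := by push_cast; ring
      exact le_of_mul_le_mul_right this (by exact_mod_cast hl_pos)
    have hsum := add_mem_sumset hd (zsmul_mem_sumset h0 hneg hl_mem htl)
    have heq : j * q = d + t • (l : ℤ) := by
      rw [smul_eq_mul]
      linarith
    rw [heq]
    exact sumset_mono h0 (by omega) hsum

section Gap

variable {G : Type*} [AddCommGroup G] [DecidableEq G] {r : ℕ}

/-- The generalized arithmetic progression `{a + ∑ nᵢ vᵢ : Mᵢ ≤ nᵢ ≤ Lᵢ}` as a finset. -/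
noncomputable def gap (a : G) (v : Fin r → G) (M L : Fin r → ℤ) : Finset G :=
  (Fintype.piFinset fun i => Finset.Icc (M i) (L i)).image fun n => a + ∑ i, n i • v i

theorem mem_gap {a : G} {v : Fin r → G} {M L : Fin r → ℤ} {x : G} :
    x ∈ gap a v M L ↔
      ∃ n : Fin r → ℤ, (∀ i, M i ≤ n i ∧ n i ≤ L i) ∧ a + ∑ i, n i • v i = x := by
  simp [gap]

theorem isGAP_gap (a : G) (v : Fin r → G) (M L : Fin r → ℤ) : IsGAP (gap a v M L : Set G) r :=
  ⟨a, v, M, L, by ext x; simp only [Finset.mem_coe, mem_gap, Set.mem_ofPred_eq, eq_comm]⟩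

theorem IsGAP.exists_eq_gap {R : Set G} (hR : IsGAP R r) (hne : R.Nonempty) :
    ∃ (a : G) (v : Fin r → G) (len : Fin r → ℕ), R = gap a v 0 (fun i => len i) := by
  obtain ⟨a, v, M, L, rfl⟩ := hR
  obtain ⟨_, n₀, hn₀, -⟩ := hne
  have hlen : ∀ i, ((L i - M i).toNat : ℤ) = L i - M i := fun i =>
    Int.toNat_of_nonneg (by linarith [(hn₀ i).1, (hn₀ i).2])
  refine ⟨a + ∑ i, M i • v i, v, fun i => (L i - M i).toNat, ?_⟩
  ext x
  simp only [Finset.mem_coe, mem_gap, Set.mem_ofPred_eq, hlen, Pi.zero_apply]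
  constructor
  · rintro ⟨n, hn, rfl⟩
    refine ⟨fun i => n i - M i, fun i => ⟨by linarith [(hn i).1], by linarith [(hn i).2]⟩, ?_⟩
    simp only [sub_zsmul, Finset.sum_add_distrib, Finset.sum_neg_distrib]
    abel
  · rintro ⟨n, hn, rfl⟩
    refine ⟨fun i => n i + M i, fun i => ⟨by linarith [(hn i).1], by linarith [(hn i).2]⟩, ?_⟩
    simp only [add_zsmul, Finset.sum_add_distrib]
    abel

/-- A subset of a generalized arithmetic progression is dense on some line in any of the
directions of the progression. -/
theorem exists_dense_line {a : G} {v : Fin r → G} {len : Fin r → ℕ} {U : Finset G} {κ : ℕ}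
    (hU : U ⊆ gap a v 0 (fun i => len i)) (hne : U.Nonempty)
    (hκ : 2 * (gap a v 0 (fun i => (len i : ℤ))).card ≤ κ * U.card) (i : Fin r) :
    ∃ (A : Finset ℤ) (x : G), A ⊆ Finset.Icc 0 (len i : ℤ) ∧ A.Nonempty ∧
      len i + 1 ≤ κ * A.card ∧ ∀ n ∈ A, x + n • v i ∈ U := by
  set R := gap a v 0 (fun i => (len i : ℤ)) with hR
  set I := Finset.Icc 0 (len i : ℤ) with hI
  have hIcard : I.card = len i + 1 := by simp [hI]
  set X := (U ×ˢ I).image fun z => z.1 - z.2 • v i with hX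
  have hXne : X.Nonempty := (hne.product ⟨0, by simp [hI]⟩).image _
  have hXsub : X ⊆ R ∪ R.image (fun x => x - ((len i : ℤ) + 1) • v i) := by
    intro x hx
    obtain ⟨⟨u, m⟩, hz, rfl⟩ := Finset.mem_image.1 hx
    obtain ⟨hu, hm⟩ := Finset.mem_product.1 hz
    obtain ⟨n, hn, rfl⟩ := mem_gap.1 (hU hu)
    obtain ⟨hm0, hm1⟩ := Finset.mem_Icc.1 hm
    have hsum : ∀ t : ℤ, ∑ j, (Function.update n i (n i + t)) j • v j =
        ∑ j, n j • v j + t • v i := by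
      intro t
      have : ∀ j, (Function.update n i (n i + t)) j • v j =
          n j • v j + if j = i then t • v i else 0 := by
        intro j
        by_cases h : j = i
        · subst h
          simp [add_zsmul]
        · simp [h]
      simp [this, Finset.sum_add_distrib]
    have hupd : ∀ t : ℤ, 0 ≤ n i + t → n i + t ≤ len i →
        a + ∑ j, n j • v j + t • v i ∈ R := by
      intro t h0 h1
      refine mem_gap.2 ⟨Function.update n i (n i + t), fun j => ?_, by rw [hsum, add_assoc]⟩
      by_cases h : j = i
      · subst h
        simp [h0, h1]
      · simpa [h] using hn j
    have hni := hn i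
    simp only [Pi.zero_apply] at hni
    by_cases h : 0 ≤ n i - m
    · refine Finset.mem_union_left _ ?_
      have := hupd (-m) (by linarith) (by linarith)
      rwa [neg_zsmul, ← sub_eq_add_neg] at this
    · refine Finset.mem_union_right _ (Finset.mem_image.2
        ⟨_, hupd ((len i : ℤ) + 1 - m) (by linarith) (by linarith), ?_⟩)
      dsimp only
      rw [sub_zsmul]
      abel
  have hXcard : X.card ≤ 2 * R.card := by
    refine (Finset.card_le_card hXsub).trans ((Finset.card_union_le _ _).trans ?_)
    have := Finset.card_image_le (s := R) (f := fun x => x - ((len i : ℤ) + 1) • v i)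
    omega
  have hcount : I.card * U.card ≤ ∑ x ∈ X, (I.filter fun m => x + m • v i ∈ U).card := by
    have hswap : ∑ x ∈ X, (I.filter fun m => x + m • v i ∈ U).card =
        ∑ m ∈ I, (X.filter fun x => x + m • v i ∈ U).card :=
      Finset.sum_card_bipartiteAbove_eq_sum_card_bipartiteBelow fun x m => x + m • v i ∈ U
    rw [hswap, ← smul_eq_mul]
    refine Finset.card_nsmul_le_sum _ _ _ fun m hm => ?_
    rw [← Finset.card_image_of_injective U (sub_left_injective (b := m • v i))]
    refine Finset.card_le_card fun x hx => ?_
    obtain ⟨u, hu, rfl⟩ := Finset.mem_image.1 hx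
    exact Finset.mem_filter.2
      ⟨Finset.mem_image.2 ⟨(u, m), Finset.mem_product.2 ⟨hu, hm⟩, rfl⟩, by simpa using hu⟩
  obtain ⟨x, -, hx⟩ : ∃ x ∈ X, I.card ≤ κ * (I.filter fun m => x + m • v i ∈ U).card := by
    by_contra! h
    have h1 := Finset.sum_lt_sum_of_nonempty hXne h
    rw [← Finset.mul_sum, Finset.sum_const, smul_eq_mul] at h1
    have h2 : κ * (I.card * U.card) ≤ κ * ∑ x ∈ X, (I.filter fun m => x + m • v i ∈ U).card :=
      Nat.mul_le_mul_left κ hcount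
    have h3 : X.card * I.card ≤ κ * U.card * I.card := Nat.mul_le_mul_right _ (hXcard.trans hκ)
    nlinarith
  rw [hIcard] at hx
  refine ⟨I.filter fun m => x + m • v i ∈ U, x, Finset.filter_subset _ _, ?_, hx,
    fun n hn => (Finset.mem_filter.1 hn).2⟩
  rw [Finset.nonempty_iff_ne_empty]
  rintro h
  simp [h] at hx

/-- A dense subset `U` of a generalized arithmetic progression has an iterated difference set
containing multiples of the generators that span a large progression. -/
theorem exists_gap_of_dense {a : G} {v : Fin r → G} {len : Fin r → ℕ} {U : Finset G} {κ : ℕ}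
    (hU : U ⊆ gap a v 0 (fun i => len i)) (hne : U.Nonempty)
    (hκ : 2 * (gap a v 0 (fun i => (len i : ℤ))).card ≤ κ * U.card) :
    ∃ (w : Fin r → G) (n : Fin r → ℕ),
      (∀ i, ∀ j : ℤ, |j| ≤ n i → j • w i ∈ sumset (U - U) (12 * κ + 1)) ∧
      (gap a v 0 (fun i => (len i : ℤ))).card ≤
        (4 * κ) ^ r * (gap 0 w (fun i => -(n i : ℤ)) (fun i => n i)).card := by
  have hline : ∀ i, ∃ (q : ℤ) (n : ℕ) (F : Finset ℤ), F.card ≤ 4 * κ ∧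
      (∀ u ∈ Finset.Icc 0 (len i : ℤ), ∃ f ∈ F, ∃ j : ℤ, |j| ≤ n ∧ u = f + j * q) ∧
      ∀ j : ℤ, |j| ≤ n → j • q • v i ∈ sumset (U - U) (12 * κ + 1) := by
    intro i
    obtain ⟨A, x, hA, hAne, hAκ, hAU⟩ := exists_dense_line hU hne hκ i
    obtain ⟨q, n, F, hF, hcov, hmem⟩ := exists_progression_subset_sumset hA hAne hAκ
    refine ⟨q, n, F, hF, hcov, fun j hj => ?_⟩
    have := map_mem_sumset (E := U - U) (zmultiplesHom G (v i)) (fun d hd => ?_) (hmem j hj)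
    · rwa [zmultiplesHom_apply, mul_zsmul] at this
    · obtain ⟨b, hb, c, hc, rfl⟩ := Finset.mem_sub.1 hd
      have := Finset.sub_mem_sub (hAU b hb) (hAU c hc)
      rw [zmultiplesHom_apply, sub_zsmul, ← sub_eq_add_neg]
      rwa [add_sub_add_left_eq_sub] at this
  choose q n F hF hcov hmem using hline
  refine ⟨fun i => q i • v i, n, hmem, ?_⟩
  have hsub : gap a v 0 (fun i => (len i : ℤ)) ⊆
      (Fintype.piFinset F).image (fun f => a + ∑ i, f i • v i) +
        gap 0 (fun i => q i • v i) (fun i => -(n i : ℤ)) (fun i => n i) := by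
    intro x hx
    obtain ⟨u, hu, rfl⟩ := mem_gap.1 hx
    choose f hf j hj huf using fun i => hcov i (u i) (Finset.mem_Icc.2 (hu i))
    refine Finset.mem_add.2 ⟨a + ∑ i, f i • v i,
      Finset.mem_image_of_mem (fun f : Fin r → ℤ => a + ∑ i, f i • v i)
        (Fintype.mem_piFinset.2 hf),
      ∑ i, j i • q i • v i, mem_gap.2 ⟨j, fun i => abs_le.1 (hj i), by simp⟩, ?_⟩
    rw [add_assoc, ← Finset.sum_add_distrib]
    congr 1
    refine Finset.sum_congr rfl fun i _ => ?_
    rw [huf i, add_zsmul, mul_zsmul]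
  refine (Finset.card_le_card hsub).trans (Finset.card_add_le.trans ?_)
  refine Nat.mul_le_mul_right _ (Finset.card_image_le.trans ?_)
  rw [Fintype.card_piFinset]
  exact (Finset.prod_le_prod' fun i _ => hF i).trans (by simp)

/-- Iterated difference sets of a subset of a generalized arithmetic progression grow at most
polynomially. -/
theorem card_sumset_sub_le {a : G} {v : Fin r → G} {len : Fin r → ℕ} {U : Finset G}
    (hU : U ⊆ gap a v 0 (fun i => len i)) {k : ℕ} (hk : 0 < k) :
    (sumset (U - U) k).card ≤ (2 * k) ^ r * (gap a v 0 (fun i => (len i : ℤ))).card := by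
  have hrep : ∀ j : ℕ, ∀ x ∈ sumset (U - U) j, ∃ n : Fin r → ℤ,
      (∀ i, |n i| ≤ j * len i) ∧ x = ∑ i, n i • v i := by
    intro j
    induction j with
    | zero =>
      intro x hx
      obtain rfl : x = 0 := by simpa [sumset] using hx
      exact ⟨0, by simp⟩
    | succ j ih =>
      intro x hx
      obtain ⟨c, hc, d, hd, rfl⟩ := Finset.mem_add.1 hx
      obtain ⟨n, hn, rfl⟩ := ih c hc
      obtain ⟨s, hs, t, ht, rfl⟩ := Finset.mem_sub.1 hd
      obtain ⟨m, hm, rfl⟩ := mem_gap.1 (hU hs)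
      obtain ⟨m', hm', rfl⟩ := mem_gap.1 (hU ht)
      refine ⟨fun i => n i + (m i - m' i), fun i => ?_, ?_⟩
      · have h1 := hm i
        have h2 := hm' i
        simp only [Pi.zero_apply] at h1 h2
        have : |m i - m' i| ≤ len i := by
          rw [abs_le]
          constructor <;> linarith
        push_cast
        linarith [abs_add_le (n i) (m i - m' i), hn i]
      · simp only [add_zsmul, sub_zsmul, Finset.sum_add_distrib, Finset.sum_neg_distrib]
        abel
  have hsub : sumset (U - U) k ⊆
      (Fintype.piFinset fun _ : Fin r => Finset.range (2 * k)).image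
        (fun t => ∑ i, ((t i : ℤ) * (len i + 1) - k * len i) • v i - a) +
        gap a v 0 (fun i => (len i : ℤ)) := by
    intro x hx
    obtain ⟨n, hn, rfl⟩ := hrep k x hx
    have hn' : ∀ i, 0 ≤ n i + k * len i ∧ n i + k * len i ≤ 2 * k * len i := fun i => by
      have := abs_le.1 (hn i)
      constructor <;> linarith
    have hpos : ∀ i, (0 : ℤ) < len i + 1 := fun i => by positivity
    refine Finset.mem_add.2 ⟨_, Finset.mem_image.2
      ⟨fun i => ((n i + k * len i) / (len i + 1)).toNat, ?_, rfl⟩, a + ∑ i,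
        ((n i + k * len i) % (len i + 1)) • v i, mem_gap.2
          ⟨fun i => (n i + k * len i) % (len i + 1), fun i => ⟨?_, ?_⟩, rfl⟩, ?_⟩
    · refine Fintype.mem_piFinset.2 fun i => Finset.mem_range.2 ?_
      have h1 : (n i + k * len i) / (len i + 1) < 2 * k := by
        rw [Int.ediv_lt_iff_lt_mul (hpos i)]
        have : (0 : ℤ) < k := by exact_mod_cast hk
        nlinarith [(hn' i).2]
      have h2 : 0 ≤ (n i + k * len i) / (len i + 1) := Int.ediv_nonneg (hn' i).1 (hpos i).le
      omega
    · exact Int.emod_nonneg _ (hpos i).ne'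
    · exact Int.lt_add_one_iff.1 (Int.emod_lt_of_pos _ (hpos i))
    · have : ∀ i, n i • v i = ((((n i + k * len i) / (len i + 1)).toNat : ℤ) * (len i + 1) -
          k * len i) • v i + ((n i + k * len i) % (len i + 1)) • v i := by
        intro i
        rw [← add_zsmul, Int.toNat_of_nonneg (Int.ediv_nonneg (hn' i).1 (hpos i).le)]
        congr 1
        linarith [Int.emod_add_mul_ediv (n i + k * len i) (len i + 1)]
      simp only [this, Finset.sum_add_distrib]
      abel
  refine (Finset.card_le_card hsub).trans (Finset.card_add_le.trans ?_)
  refine Nat.mul_le_mul_right _ (Finset.card_image_le.trans ?_)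
  rw [Fintype.card_piFinset]
  simp

/-- Some translate of `P` meets `S` in at least the average number of points. -/
theorem exists_card_mul_card_le_card_filter_mul {S P : Finset G} (hS : S.Nonempty)
    (hP : P.Nonempty) :
    ∃ x, S.card * P.card ≤ (S.filter fun s => s - x ∈ P).card * (S - P).card := by
  have hcount : S.card * P.card ≤ ∑ x ∈ S - P, (S.filter fun s => s - x ∈ P).card := by
    have hswap : ∑ x ∈ S - P, (S.filter fun s => s - x ∈ P).card =
        ∑ s ∈ S, ((S - P).filter fun x => s - x ∈ P).card :=
      Finset.sum_card_bipartiteAbove_eq_sum_card_bipartiteBelow fun x s => s - x ∈ P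
    rw [hswap, ← smul_eq_mul]
    refine Finset.card_nsmul_le_sum _ _ _ fun s hs => ?_
    rw [← Finset.card_image_of_injective P (sub_right_injective (b := s))]
    refine Finset.card_le_card fun x hx => ?_
    obtain ⟨u, hu, rfl⟩ := Finset.mem_image.1 hx
    exact Finset.mem_filter.2 ⟨Finset.sub_mem_sub hs hu, by simpa using hu⟩
  by_contra! h
  have h1 := Finset.sum_lt_sum_of_nonempty (hS.sub hP) fun x (_ : x ∈ S - P) => h x
  rw [← Finset.sum_mul, Finset.sum_const, smul_eq_mul, mul_comm (S - P).card] at h1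
  exact absurd (Nat.mul_le_mul_right (S - P).card hcount) (not_le.2 h1)

end Gap

theorem card_sq_le_card_image_mul {α β : Type*} [DecidableEq β] (T : Finset α) (f : α → β) :
    T.card ^ 2 ≤ (T.image f).card * ((T ×ˢ T).filter fun z => f z.1 = f z.2).card := by
  have h1 : T.card = ∑ b ∈ T.image f, (T.filter fun a => f a = b).card :=
    Finset.card_eq_sum_card_fiberwise fun a ha => Finset.mem_image_of_mem f ha
  have h2 : ((T ×ˢ T).filter fun z => f z.1 = f z.2).card =
      ∑ b ∈ T.image f, (T.filter fun a => f a = b).card ^ 2 := by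
    rw [Finset.card_eq_sum_card_fiberwise (f := fun z => f z.1) (t := T.image f)]
    · refine Finset.sum_congr rfl fun b _ => ?_
      rw [sq, ← Finset.card_product]
      congr 1
      ext z
      simp only [Finset.mem_filter, Finset.mem_product]
      constructor
      · rintro ⟨⟨⟨h1, h2⟩, h3⟩, h4⟩
        exact ⟨⟨h1, h4⟩, h2, h3 ▸ h4⟩
      · rintro ⟨⟨h1, h2⟩, h3, h4⟩
        exact ⟨⟨⟨h1, h3⟩, h2.trans h4.symm⟩, h2⟩
    · intro z hz
      simp only [Finset.coe_filter, Finset.mem_product, Set.mem_ofPred_eq] at hz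
      exact Finset.mem_image_of_mem f hz.1.1
  rw [h2]
  conv_lhs => rw [h1]
  exact sq_sum_le_card_mul_sum_sq

/-- A form of Gallagher's larger sieve. -/
theorem card_le_of_card_image_le {T : Finset ℤ} {X y Z : ℝ} (hy : 1 < y) (hX : 1 ≤ X)
    (hT : ∀ t ∈ T, |(t : ℝ)| ≤ X)
    (hZ : ∀ p ∈ primesBetween y, ((T.image fun n : ℤ => (n : ZMod p)).card : ℝ) ≤ Z)
    (hpos : 0 < (primesBetween y).card * Real.log y)
    (hsieve : 2 * Z * Real.log (2 * X) ≤ (primesBetween y).card * Real.log y) :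
    (T.card : ℝ) ≤ 2 * Z := by
  have hlog : 0 < Real.log y := Real.log_pos hy
  obtain ⟨p₀, hp₀⟩ : (primesBetween y).Nonempty := by
    rw [Finset.nonempty_iff_ne_empty]
    rintro h
    simp [h] at hpos
  have hZ0 : 0 ≤ Z := le_trans (by positivity) (hZ p₀ hp₀)
  rcases T.eq_empty_or_nonempty with rfl | hne
  · simpa using hZ0
  set P : ℝ := (primesBetween y).card * Real.log y with hP
  have hpairs : ∑ p ∈ primesBetween y,
      ((T ×ˢ T).filter fun z => (z.1 : ZMod p) = (z.2 : ZMod p)).card * Real.log y ≤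
      T.card * P + T.card ^ 2 * Real.log (2 * X) := by
    have hswap : ∑ p ∈ primesBetween y,
        ((T ×ˢ T).filter fun z => (z.1 : ZMod p) = (z.2 : ZMod p)).card =
        ∑ z ∈ T ×ˢ T, ((primesBetween y).filter
          fun p : ℕ => (z.1 : ZMod p) = (z.2 : ZMod p)).card :=
      Finset.sum_card_bipartiteAbove_eq_sum_card_bipartiteBelow
        fun (p : ℕ) (z : ℤ × ℤ) => (z.1 : ZMod p) = (z.2 : ZMod p)
    have hz : ∀ z ∈ T ×ˢ T, (((primesBetween y).filter
          fun p : ℕ => (z.1 : ZMod p) = (z.2 : ZMod p)).card : ℝ) * Real.log y ≤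
          (if z.1 = z.2 then P else 0) + Real.log (2 * X) := by
      intro z hz
      obtain ⟨h1, h2⟩ := Finset.mem_product.1 hz
      have hX1 := hT _ h1
      have hX2 := hT _ h2
      split_ifs with h
      · have hcard : (((primesBetween y).filter
            fun p : ℕ => (z.1 : ZMod p) = (z.2 : ZMod p)).card : ℝ) ≤ (primesBetween y).card := by
          exact_mod_cast Finset.card_filter_le _ _
        linarith [mul_le_mul_of_nonneg_right hcard hlog.le,
          Real.log_nonneg (show 1 ≤ 2 * X by linarith)]
      · rw [zero_add]
        simp only [ZMod.intCast_eq_intCast_iff_dvd_sub]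
        refine card_primesBetween_dvd_mul_log_le hy (sub_ne_zero.2 (Ne.symm h)) ?_
        push_cast
        linarith [abs_sub (z.2 : ℝ) (z.1 : ℝ)]
    rw [← Finset.sum_mul, ← Nat.cast_sum, hswap, Nat.cast_sum, Finset.sum_mul]
    refine (Finset.sum_le_sum hz).trans_eq ?_
    rw [Finset.sum_add_distrib, Finset.sum_const, Finset.card_product, Finset.sum_product]
    simp [sq]
  have hlow : ∀ p ∈ primesBetween y, (T.card : ℝ) ^ 2 * Real.log y ≤
      Z * (((T ×ˢ T).filter fun z => (z.1 : ZMod p) = (z.2 : ZMod p)).card * Real.log y) := by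
    intro p hp
    rw [← mul_assoc]
    refine mul_le_mul_of_nonneg_right ?_ hlog.le
    have := card_sq_le_card_image_mul T fun n : ℤ => (n : ZMod p)
    have h' : (T.card : ℝ) ^ 2 ≤ ((T.image fun n : ℤ => (n : ZMod p)).card : ℝ) *
      ((T ×ˢ T).filter fun z => (z.1 : ZMod p) = (z.2 : ZMod p)).card := by exact_mod_cast this
    exact h'.trans (mul_le_mul_of_nonneg_right (hZ p hp) (by positivity))
  have hsum := Finset.sum_le_sum hlow
  rw [Finset.sum_const, nsmul_eq_mul, ← Finset.mul_sum] at hsum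
  have hmain : P * (T.card : ℝ) ^ 2 ≤ Z * (T.card * P + T.card ^ 2 * Real.log (2 * X)) := by
    calc P * (T.card : ℝ) ^ 2 = _ := by rw [hP]; ring
      _ ≤ _ := hsum
      _ ≤ _ := mul_le_mul_of_nonneg_left hpairs hZ0
  have hTpos : (0 : ℝ) < T.card := by exact_mod_cast hne.card_pos
  have h3 : (T.card : ℝ) ^ 2 * (2 * Z * Real.log (2 * X)) ≤ T.card ^ 2 * P := by gcongr
  have h4 : (T.card * P) * (T.card : ℝ) ≤ (T.card * P) * (2 * Z) := by nlinarith
  exact le_of_mul_le_mul_left h4 (by positivity)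

theorem exists_prime_forall_eq_zero {T : Finset ℤ} {X y : ℝ} (hy : 1 < y) (hX : 1 ≤ X)
    (hT : ∀ t ∈ T, |(t : ℝ)| ≤ X)
    (h : T.card * Real.log X < (primesBetween y).card * Real.log y) :
    ∃ p ∈ primesBetween y, ∀ t ∈ T, (t : ZMod p) = 0 → t = 0 := by
  by_contra! hcon
  have h1 : (primesBetween y).card ≤ ∑ t ∈ T.filter (· ≠ 0),
      ((primesBetween y).filter fun p : ℕ => (p : ℤ) ∣ t).card := by
    have hswap : ∑ t ∈ T.filter (· ≠ 0),
        ((primesBetween y).filter fun p : ℕ => (p : ℤ) ∣ t).card =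
        ∑ p ∈ primesBetween y, ((T.filter (· ≠ 0)).filter fun t => (p : ℤ) ∣ t).card :=
      Finset.sum_card_bipartiteAbove_eq_sum_card_bipartiteBelow fun t (p : ℕ) => (p : ℤ) ∣ t
    rw [hswap, Finset.card_eq_sum_ones]
    refine Finset.sum_le_sum fun p hp => Finset.card_pos.2 ?_
    obtain ⟨t, ht, h0, hne⟩ := hcon p hp
    exact ⟨t, Finset.mem_filter.2 ⟨Finset.mem_filter.2 ⟨ht, hne⟩,
      (ZMod.intCast_zmod_eq_zero_iff_dvd _ _).1 h0⟩⟩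
  have hlog : 0 < Real.log y := Real.log_pos hy
  have h2 : ((primesBetween y).card : ℝ) * Real.log y ≤
      ∑ t ∈ T.filter (· ≠ 0), Real.log X := by
    calc ((primesBetween y).card : ℝ) * Real.log y ≤ (∑ t ∈ T.filter (· ≠ 0),
          ((primesBetween y).filter fun p : ℕ => (p : ℤ) ∣ t).card : ℕ) * Real.log y := by
          gcongr
      _ = ∑ t ∈ T.filter (· ≠ 0),
          (((primesBetween y).filter fun p : ℕ => (p : ℤ) ∣ t).card : ℝ) * Real.log y := by
          rw [← Finset.sum_mul]; push_cast; rfl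
      _ ≤ _ := Finset.sum_le_sum fun t ht => card_primesBetween_dvd_mul_log_le hy
          (Finset.mem_filter.1 ht).2 (hT t (Finset.mem_filter.1 ht).1)
  rw [Finset.sum_const, nsmul_eq_mul] at h2
  have h3 : ((T.filter (· ≠ 0)).card : ℝ) * Real.log X ≤ T.card * Real.log X := by
    refine mul_le_mul_of_nonneg_right ?_ (Real.log_nonneg hX)
    exact_mod_cast Finset.card_filter_le _ _
  linarith

/-- If reduction modulo `p` is injective on an iterated difference set of `S` and `S` reduces to a
dense subset of a generalized arithmetic progression, then a large part of `S` is a dense subset of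
a generalized arithmetic progression of integers. -/
theorem exists_gap_of_gap_mod {S : Finset ℤ} {p r κ k₀ : ℕ} [NeZero p] {R : Set (ZMod p)}
    (hS : S.Nonempty) (hR : IsGAP R r) (hSR : ↑(S.image fun n : ℤ => (n : ZMod p)) ⊆ R)
    (hκ : 2 * R.ncard ≤ κ * (S.image fun n : ℤ => (n : ZMod p)).card)
    (hk : 3 * (12 * κ + 1) ≤ k₀) (hk' : r * (12 * κ + 1) + 1 ≤ k₀)
    (hinj : ∀ t ∈ sumset (S - S) k₀, (t : ZMod p) = 0 → t = 0) :
    ∃ S' ⊆ S, ∃ Q : Finset ℤ, IsGAP (Q : Set ℤ) r ∧ S' ⊆ Q ∧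
      S.card * Q.card ≤ S'.card * (sumset (S - S) k₀).card ∧
      S.card * S.card ≤ (4 * κ) ^ r * (S'.card * (sumset (S - S) k₀).card) := by
  set f : ℤ →+ ZMod p := Int.castAddHom (ZMod p) with hf
  set U := S.image f with hU
  have hUS : (S.image fun n : ℤ => (n : ZMod p)) = U := rfl
  have hUne : U.Nonempty := hS.image _
  rw [hUS] at hSR hκ
  obtain ⟨a, v, len, rfl⟩ := hR.exists_eq_gap ((Finset.coe_nonempty.2 hUne).mono hSR)
  rw [Set.ncard_coe_finset] at hκ
  have hUR : U ⊆ gap a v 0 (fun i => (len i : ℤ)) := Finset.coe_subset.1 hSR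
  obtain ⟨w, n, hw, hcard⟩ := exists_gap_of_dense hUR hUne hκ
  have h0 := zero_mem_sub_self hS
  have hneg := neg_mem_sub_self S
  have hUU : U - U = (S - S).image f := (Finset.image_image₂_distrib fun a b => map_sub f a b).symm
  rw [hUU] at hw
  choose u hu using fun i => exists_lift_of_zsmul_mem_sumset f h0 hneg hinj hk (hw i)
  set T := sumset (S - S) k₀ with hT
  set P := gap 0 u (fun i => -(n i : ℤ)) (fun i => n i) with hP
  have hPne : P.Nonempty := ⟨_, mem_gap.2 ⟨0, fun i => by simp, rfl⟩⟩
  have hPsub : ∀ x ∈ P, x ∈ sumset (S - S) (r * (12 * κ + 1)) := by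
    intro x hx
    obtain ⟨j, hj, rfl⟩ := mem_gap.1 hx
    rw [zero_add]
    exact sum_mem_sumset fun i => (hu i (j i) (abs_le.2 (hj i))).1
  have hPimage : gap 0 w (fun i => -(n i : ℤ)) (fun i => n i) ⊆ P.image f := by
    intro x hx
    obtain ⟨j, hj, rfl⟩ := mem_gap.1 hx
    refine Finset.mem_image.2 ⟨_, mem_gap.2 ⟨j, hj, rfl⟩, ?_⟩
    rw [map_add, map_zero, map_sum]
    exact congrArg _ (Finset.sum_congr rfl fun i _ => (hu i (j i) (abs_le.2 (hj i))).2)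
  have hUcard : U.card = S.card := by
    refine Finset.card_image_of_injOn fun s hs t ht hst => sub_eq_zero.1 (hinj _ ?_ ?_)
    · refine sumset_mono h0 (show 1 ≤ k₀ by omega) ?_
      rw [sumset_one]
      exact Finset.sub_mem_sub hs ht
    · have : f (s - t) = 0 := by rw [map_sub, hst, sub_self]
      exact this
  have hSP : S.card ≤ (4 * κ) ^ r * P.card := by
    rw [← hUcard]
    exact (Finset.card_le_card hUR).trans (hcard.trans (Nat.mul_le_mul_left _
      ((Finset.card_le_card hPimage).trans Finset.card_image_le)))
  have hdiff : (S - P).card ≤ T.card := by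
    obtain ⟨s₀, hs₀⟩ := hS
    rw [← Finset.card_image_of_injective (S - P) (sub_left_injective (b := s₀))]
    refine Finset.card_le_card fun x hx => ?_
    obtain ⟨y, hy, rfl⟩ := Finset.mem_image.1 hx
    obtain ⟨s, hs, t, ht, rfl⟩ := Finset.mem_sub.1 hy
    have h1 : -t + (s - s₀) ∈ sumset (S - S) (r * (12 * κ + 1) + 1) :=
      Finset.add_mem_add (neg_mem_sumset hneg (hPsub t ht)) (Finset.sub_mem_sub hs hs₀)
    have h2 := sumset_mono h0 hk' h1
    rwa [show -t + (s - s₀) = s - t - s₀ by ring] at h2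
  obtain ⟨x, hx⟩ := exists_card_mul_card_le_card_filter_mul hS hPne
  have hx' := hx.trans (Nat.mul_le_mul_left _ hdiff)
  refine ⟨S.filter fun s => s - x ∈ P, Finset.filter_subset _ _,
    gap x u (fun i => -(n i : ℤ)) (fun i => n i), isGAP_gap _ _ _ _, ?_, ?_, ?_⟩
  · intro s hs
    obtain ⟨j, hj, hjs⟩ := mem_gap.1 (Finset.mem_filter.1 hs).2
    exact mem_gap.2 ⟨j, hj, by linarith⟩
  · refine le_trans (Nat.mul_le_mul_left _ ?_) hx'
    have hsub : gap x u (fun i => -(n i : ℤ)) (fun i => n i) ⊆ P.image fun t => x + t := by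
      intro t ht
      obtain ⟨j, hj, rfl⟩ := mem_gap.1 ht
      exact Finset.mem_image.2 ⟨_, mem_gap.2 ⟨j, hj, rfl⟩, by simp⟩
    exact (Finset.card_le_card hsub).trans Finset.card_image_le
  · calc S.card * S.card ≤ S.card * ((4 * κ) ^ r * P.card) := Nat.mul_le_mul_left _ hSP
      _ = (4 * κ) ^ r * (S.card * P.card) := by ring
      _ ≤ _ := Nat.mul_le_mul_left _ hx'

/-- The set `S` occupies a `δ`-dense part of a generalized arithmetic progression of rank at most
`r` and size at most `p ^ ε` modulo each prime `p ∈ [y, 2y]`. -/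
def DenseInGAPs (S : Finset ℤ) (ε δ y : ℝ) (r : ℕ) : Prop :=
  ∀ p : ℕ, Nat.Prime p → y ≤ (p : ℝ) → (p : ℝ) ≤ 2 * y →
    ∃ R : Set (ZMod p), (∃ r' : ℕ, r' ≤ r ∧ IsGAP R r') ∧
      ↑(S.image fun n : ℤ => (n : ZMod p)) ⊆ R ∧
      (R.ncard : ℝ) ≤ δ⁻¹ * ((S.image fun n : ℤ => (n : ZMod p)).card : ℝ) ∧
      δ⁻¹ * ((S.image fun n : ℤ => (n : ZMod p)).card : ℝ) ≤ (p : ℝ) ^ ε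

namespace DenseInGAPs

variable {S : Finset ℤ} {ε δ y : ℝ} {r N : ℕ}

theorem card_le (h : DenseInGAPs S ε δ y r) (hε : 0 ≤ ε) (hδ : δ ∈ Set.Ioo (0 : ℝ) 1)
    (hN : 0 < N) (hS : S ⊆ Finset.Icc (1 : ℤ) N) (hy : 1 < y)
    (hprimes : y / 16 ≤ (primesBetween y).card * Real.log y)
    (hsieve : 2 * (2 * y) ^ ε * Real.log (2 * N) ≤ y / 16) :
    (S.card : ℝ) ≤ 2 * (2 * y) ^ ε := by
  have hN1 : (1 : ℝ) ≤ N := by exact_mod_cast hN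
  refine card_le_of_card_image_le hy hN1 (fun t ht => ?_) (fun p hp => ?_) (by linarith)
    (hsieve.trans hprimes)
  · obtain ⟨h1, h2⟩ := Finset.mem_Icc.1 (hS ht)
    have h1' : (1 : ℝ) ≤ t := by exact_mod_cast h1
    rw [abs_of_nonneg (by linarith)]
    exact_mod_cast h2
  · obtain ⟨hp, hyp, hpy⟩ := (mem_primesBetween (by linarith)).1 hp
    obtain ⟨R, -, -, -, hR⟩ := h p hp hyp hpy
    have hδ1 : 1 ≤ δ⁻¹ := (one_le_inv₀ hδ.1).2 hδ.2.le
    calc _ ≤ δ⁻¹ * ((S.image fun n : ℤ => (n : ZMod p)).card : ℝ) :=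
          le_mul_of_one_le_left (by positivity) hδ1
      _ ≤ (p : ℝ) ^ ε := hR
      _ ≤ (2 * y) ^ ε := Real.rpow_le_rpow (by positivity) hpy hε

theorem exists_gap (h : DenseInGAPs S ε δ y r) (hε : 0 ≤ ε) (hδ : δ ∈ Set.Ioo (0 : ℝ) 1)
    (hN : 0 < N) (hS : S ⊆ Finset.Icc (1 : ℤ) N) (hne : S.Nonempty) (hy : 1 < y)
    (hprimes : y / 16 ≤ (primesBetween y).card * Real.log y) {κ k₀ : ℕ} (hκ : 2 * δ⁻¹ ≤ κ)
    (hk : 3 * (12 * κ + 1) ≤ k₀) (hk' : r * (12 * κ + 1) + 1 ≤ k₀)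
    (hsieve : 2 * ((2 * k₀) ^ r * (2 * y) ^ ε) * Real.log (2 * (k₀ * N)) ≤ y / 16) :
    ∃ S' ⊆ S, ∃ Q : Finset ℤ, ∃ r' ≤ r, IsGAP (Q : Set ℤ) r' ∧ S' ⊆ Q ∧
      (Q.card : ℝ) ≤ 2 * ((2 * k₀) ^ r * δ⁻¹) * S'.card ∧
      (S.card : ℝ) ≤ (4 * κ) ^ r * (2 * ((2 * k₀) ^ r * δ⁻¹)) * S'.card := by
  set T := sumset (S - S) k₀ with hT
  set A : ℝ := (2 * k₀) ^ r with hA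
  set Z : ℝ := A * min ((2 * y) ^ ε) (δ⁻¹ * S.card) with hZ
  have hδ0 : 0 < δ⁻¹ := inv_pos.2 hδ.1
  have hδ1 : 1 ≤ δ⁻¹ := (one_le_inv₀ hδ.1).2 hδ.2.le
  have hk₀ : 1 ≤ k₀ := by omega
  have hk₀' : (1 : ℝ) ≤ k₀ := by exact_mod_cast hk₀
  have hκ' : (1 : ℝ) ≤ κ := by linarith
  have hScard : (0 : ℝ) < S.card := by exact_mod_cast hne.card_pos
  have hN1 : (1 : ℝ) ≤ N := by exact_mod_cast hN
  have hX : (1 : ℝ) ≤ k₀ * N := one_le_mul_of_one_le_of_one_le hk₀' hN1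
  have hApos : 0 < A := by positivity
  have hZpos : 0 < Z := mul_pos hApos (lt_min (by positivity) (by positivity))
  have hlog : 0 ≤ Real.log (2 * (k₀ * N)) := Real.log_nonneg (by linarith)
  have hTX : ∀ t ∈ T, |(t : ℝ)| ≤ k₀ * N := by
    intro t ht
    have : |t| ≤ k₀ * (N : ℤ) := by
      refine abs_le_of_mem_sumset (fun d hd => ?_) ht
      obtain ⟨s, hs, s', hs', rfl⟩ := Finset.mem_sub.1 hd
      have h1 := Finset.mem_Icc.1 (hS hs)
      have h2 := Finset.mem_Icc.1 (hS hs')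
      rw [abs_le]
      constructor <;> linarith [h1.1, h1.2, h2.1, h2.2]
    exact_mod_cast this
  have hTZ : ∀ p ∈ primesBetween y, ((T.image fun n : ℤ => (n : ZMod p)).card : ℝ) ≤ Z := by
    intro p hp
    obtain ⟨hp, hyp, hpy⟩ := (mem_primesBetween (by linarith)).1 hp
    have := Fact.mk hp
    obtain ⟨R, ⟨r', hr', hR⟩, hSR, hRcard, hε'⟩ := h p hp hyp hpy
    set U := S.image fun n : ℤ => (n : ZMod p) with hU
    obtain ⟨a, v, len, rfl⟩ := hR.exists_eq_gap ((Finset.coe_nonempty.2 (hne.image _)).mono hSR)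
    rw [Set.ncard_coe_finset] at hRcard
    have hsub : (T.image fun n : ℤ => (n : ZMod p)) ⊆ sumset (U - U) k₀ := by
      intro x hx
      obtain ⟨t, ht, rfl⟩ := Finset.mem_image.1 hx
      refine map_mem_sumset (Int.castAddHom (ZMod p)) (fun d hd => ?_) ht
      obtain ⟨s, hs, s', hs', rfl⟩ := Finset.mem_sub.1 hd
      rw [map_sub]
      exact Finset.sub_mem_sub (Finset.mem_image_of_mem _ hs) (Finset.mem_image_of_mem _ hs')
    have h1 : ((T.image fun n : ℤ => (n : ZMod p)).card : ℝ) ≤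
        (2 * k₀) ^ r' * (gap a v 0 (fun i => (len i : ℤ))).card := by
      exact_mod_cast (Finset.card_le_card hsub).trans
        (card_sumset_sub_le (Finset.coe_subset.1 hSR) hk₀)
    refine h1.trans (mul_le_mul (pow_le_pow_right₀ (by linarith) hr')
      (le_min (hRcard.trans (hε'.trans (Real.rpow_le_rpow (by positivity) hpy hε)))
        (hRcard.trans ?_)) (by positivity) hApos.le)
    refine mul_le_mul_of_nonneg_left ?_ hδ0.le
    exact_mod_cast Finset.card_image_le
  have hZsieve : 2 * Z * Real.log (2 * (k₀ * N)) ≤ (primesBetween y).card * Real.log y := by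
    refine le_trans ?_ (hsieve.trans hprimes)
    gcongr
    exact mul_le_mul_of_nonneg_left (min_le_left _ _) hApos.le
  have hTcard : (T.card : ℝ) ≤ 2 * Z :=
    card_le_of_card_image_le hy hX hTX hTZ (by linarith) hZsieve
  obtain ⟨p, hp, hinj⟩ := exists_prime_forall_eq_zero hy hX hTX <| by
    refine lt_of_lt_of_le ?_ hZsieve
    calc T.card * Real.log (k₀ * N) ≤ 2 * Z * Real.log (k₀ * N) :=
          mul_le_mul_of_nonneg_right hTcard (Real.log_nonneg hX)
      _ < _ := by
          refine mul_lt_mul_of_pos_left (Real.log_lt_log (by linarith) (by linarith))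
            (by linarith)
  obtain ⟨hp, hyp, hpy⟩ := (mem_primesBetween (by linarith)).1 hp
  have := Fact.mk hp
  obtain ⟨R, ⟨r', hr', hR⟩, hSR, hRcard, -⟩ := h p hp hyp hpy
  have hκR : 2 * R.ncard ≤ κ * (S.image fun n : ℤ => (n : ZMod p)).card := by
    have : 2 * (R.ncard : ℝ) ≤ κ * (S.image fun n : ℤ => (n : ZMod p)).card := by
      calc 2 * (R.ncard : ℝ) ≤ 2 * δ⁻¹ * (S.image fun n : ℤ => (n : ZMod p)).card := by linarith
        _ ≤ _ := mul_le_mul_of_nonneg_right hκ (by positivity)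
    exact_mod_cast this
  obtain ⟨S', hS', Q, hQ, hSQ, h1, h2⟩ := exists_gap_of_gap_mod hne hR hSR hκR hk
    ((Nat.succ_le_succ (Nat.mul_le_mul_right _ hr')).trans hk') hinj
  have hTS : (T.card : ℝ) ≤ 2 * (A * δ⁻¹) * S.card := by
    refine hTcard.trans ?_
    rw [hZ, mul_assoc 2, mul_assoc A]
    gcongr
    exact min_le_right _ _
  refine ⟨S', hS', Q, r', hr', hQ, hSQ, ?_, ?_⟩
  · have h1' : (S.card : ℝ) * Q.card ≤ S'.card * T.card := by exact_mod_cast h1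
    refine le_of_mul_le_mul_left ?_ hScard
    calc (S.card : ℝ) * Q.card ≤ S'.card * (2 * (A * δ⁻¹) * S.card) :=
          h1'.trans (mul_le_mul_of_nonneg_left hTS (by positivity))
      _ = _ := by ring
  · have h2' : (S.card : ℝ) * S.card ≤ (4 * κ) ^ r' * (S'.card * T.card) := by exact_mod_cast h2
    refine le_of_mul_le_mul_left ?_ hScard
    calc (S.card : ℝ) * S.card ≤
          (4 * κ) ^ r * (S'.card * (2 * (A * δ⁻¹) * S.card)) := by
          refine h2'.trans ?_
          gcongr
          · linarith
      _ = _ := by ring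

end DenseInGAPs

theorem isGAP_singleton {G : Type*} [AddCommGroup G] (a : G) : IsGAP ({a} : Set G) 0 :=
  ⟨a, 0, 0, 0, by ext x; simp⟩

theorem exists_natCast_le_mul_inv {δ : ℝ} (hδ : δ ∈ Set.Ioo (0 : ℝ) 1) {r : ℕ} (hr : 0 < r) :
    ∃ κ k₀ : ℕ, 2 * δ⁻¹ ≤ κ ∧ 3 * (12 * κ + 1) ≤ k₀ ∧ r * (12 * κ + 1) + 1 ≤ k₀ ∧
      (κ : ℝ) ≤ 3 * δ⁻¹ ∧ (k₀ : ℝ) ≤ 112 * (r * δ⁻¹) := by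
  have hδ1 : 1 ≤ δ⁻¹ := (one_le_inv₀ hδ.1).2 hδ.2.le
  have hr1 : (1 : ℝ) ≤ r := by exact_mod_cast hr
  have hκ : (⌈2 * δ⁻¹⌉₊ : ℝ) ≤ 3 * δ⁻¹ := by
    linarith [Nat.ceil_lt_add_one (show 0 ≤ 2 * δ⁻¹ by linarith)]
  refine ⟨⌈2 * δ⁻¹⌉₊, 3 * (r * (12 * ⌈2 * δ⁻¹⌉₊ + 1)) + 1, Nat.le_ceil _, by nlinarith, by nlinarith,
    hκ, ?_⟩
  push_cast
  have h1 : (r : ℝ) * (12 * ⌈2 * δ⁻¹⌉₊ + 1) ≤ r * (37 * δ⁻¹) := by gcongr; linarith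
  nlinarith

theorem two_pow_le_exp (n : ℕ) : (2 : ℝ) ^ n ≤ Real.exp n := by
  rw [← Real.exp_one_pow]
  gcongr
  linarith [Real.add_one_le_exp 1]

theorem exists_natCast_pow_le_exp {δ : ℝ} (hδ : δ ∈ Set.Ioo (0 : ℝ) 1) {r : ℕ} (hr : 0 < r) {E : ℝ}
    (hΛE : r + Real.log δ⁻¹ ≤ E) (hrΛ : r * (r + Real.log δ⁻¹) ≤ E) :
    ∃ κ k₀ : ℕ, 2 * δ⁻¹ ≤ κ ∧ 3 * (12 * κ + 1) ≤ k₀ ∧ r * (12 * κ + 1) + 1 ≤ k₀ ∧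
      2 * (k₀ : ℝ) ≤ Real.exp (9 * E) ∧ (2 * (k₀ : ℝ)) ^ r ≤ Real.exp (9 * E) ∧
      (4 * (κ : ℝ)) ^ r ≤ Real.exp (5 * E) := by
  obtain ⟨κ, k₀, hκ, hk, hk', hκle, hk₀le⟩ := exists_natCast_le_mul_inv hδ hr
  have hr1 : (1 : ℝ) ≤ r := by exact_mod_cast hr
  have hδ0 : 0 < δ⁻¹ := inv_pos.2 hδ.1
  have hL : 0 < Real.log δ⁻¹ := Real.log_pos ((one_lt_inv₀ hδ.1).2 hδ.2)
  have hδexp : δ⁻¹ = Real.exp (Real.log δ⁻¹) := (Real.exp_log hδ0).symm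
  set L := Real.log δ⁻¹
  have hrδ : 0 < r * δ⁻¹ := mul_pos (by linarith) hδ0
  have hk₀exp : 2 * (k₀ : ℝ) ≤ Real.exp (9 * (r + L)) := by
    calc 2 * (k₀ : ℝ) ≤ 2 ^ 8 * (r * δ⁻¹) := by linarith
      _ ≤ Real.exp (8 : ℕ) * (Real.exp r * Real.exp L) := by
        rw [← hδexp]
        gcongr
        · exact two_pow_le_exp 8
        · linarith [Real.add_one_le_exp (r : ℝ)]
      _ = Real.exp (8 + (r + L)) := by rw [← Real.exp_add, ← Real.exp_add]; norm_num
      _ ≤ _ := Real.exp_le_exp.2 (by linarith)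
  have hκexp : 4 * (κ : ℝ) ≤ Real.exp (5 * (r + L)) := by
    calc 4 * (κ : ℝ) ≤ 2 ^ 4 * δ⁻¹ := by linarith
      _ ≤ Real.exp (4 : ℕ) * Real.exp L := by
        rw [← hδexp]
        gcongr
        exact two_pow_le_exp 4
      _ = Real.exp (4 + L) := by rw [← Real.exp_add]; norm_num
      _ ≤ _ := Real.exp_le_exp.2 (by linarith)
  refine ⟨κ, k₀, hκ, hk, hk', hk₀exp.trans (Real.exp_le_exp.2 (by linarith)), ?_, ?_⟩
  · calc (2 * (k₀ : ℝ)) ^ r ≤ Real.exp (9 * (r + L)) ^ r := by gcongr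
      _ = Real.exp (9 * (r * (r + L))) := by rw [← Real.exp_nat_mul]; ring_nf
      _ ≤ _ := Real.exp_le_exp.2 (by linarith)
  · calc (4 * (κ : ℝ)) ^ r ≤ Real.exp (5 * (r + L)) ^ r := by gcongr
      _ = Real.exp (5 * (r * (r + L))) := by rw [← Real.exp_nat_mul]; ring_nf
      _ ≤ _ := Real.exp_le_exp.2 (by linarith)

theorem sieve_inequality {ε y N B k : ℝ} (hε : ε ∈ Set.Ioo (0 : ℝ) 1) (hy : 1 ≤ y) (hN : 1 ≤ N)
    (hk : 1 ≤ k) (hB : 0 ≤ B) (hNy : Real.log N ≤ y ^ ((1 - ε) / 2))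
    (hBy : 128 * (B * k) ≤ y ^ ((1 - ε) / 2)) :
    2 * (B * (2 * y) ^ ε) * Real.log (2 * (k * N)) ≤ y / 16 := by
  set z := y ^ ((1 - ε) / 2) with hz
  have hy0 : 0 < y := by linarith
  have hz1 : 1 ≤ z := Real.one_le_rpow hy (by linarith [hε.2])
  have hyz : y ^ ε * (z * z) = y := by
    rw [hz, ← Real.rpow_add hy0, ← Real.rpow_add hy0]
    ring_nf
    exact Real.rpow_one y
  have h2 : (2 : ℝ) ^ ε ≤ 2 := by
    simpa using Real.rpow_le_rpow_of_exponent_le (show (1 : ℝ) ≤ 2 by norm_num) hε.2.le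
  have h2y : (2 * y) ^ ε ≤ 2 * y ^ ε := by
    rw [Real.mul_rpow (by norm_num) hy0.le]
    gcongr
  have hlog : Real.log (2 * (k * N)) ≤ 2 * k * z := by
    rw [← mul_assoc, Real.log_mul (by positivity) (by positivity)]
    have := Real.log_le_sub_one_of_pos (show 0 < 2 * k by linarith)
    nlinarith
  have hlog0 : 0 ≤ Real.log (2 * (k * N)) :=
    Real.log_nonneg (by nlinarith [one_le_mul_of_one_le_of_one_le hk hN])
  calc 2 * (B * (2 * y) ^ ε) * Real.log (2 * (k * N)) ≤ 2 * (B * (2 * y ^ ε)) * (2 * k * z) := by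
        gcongr
    _ = y ^ ε * z * (128 * (B * k)) / 16 := by ring
    _ ≤ y ^ ε * z * z / 16 := by gcongr
    _ = y / 16 := by rw [mul_assoc, hyz]

theorem stmt7 :
    ∀ ε : ℝ, ε ∈ Set.Ioo (0 : ℝ) 1 → ∀ η : ℝ, 0 < η →
      ∃ c₁ C₂ : ℝ, 0 < c₁ ∧ 0 < C₂ ∧
        ∀ r : ℕ, 0 < r → ∀ δ : ℝ, δ ∈ Set.Ioo (0 : ℝ) 1 → ∀ N : ℕ, 0 < N → ∀ y : ℝ,
          (Real.log N) ^ (2 / (1 - ε)) < y → y ≤ N →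
          ∀ S : Finset ℤ, S ⊆ Finset.Icc (1 : ℤ) N →
            (∀ p : ℕ, Nat.Prime p → y ≤ (p : ℝ) → (p : ℝ) ≤ 2 * y →
              ∃ R : Set (ZMod p), (∃ r' : ℕ, r' ≤ r ∧ IsGAP R r') ∧
                ↑(S.image fun n : ℤ => (n : ZMod p)) ⊆ R ∧
                (R.ncard : ℝ) ≤ δ⁻¹ * ((S.image fun n : ℤ => (n : ZMod p)).card : ℝ) ∧
                δ⁻¹ * ((S.image fun n : ℤ => (n : ZMod p)).card : ℝ) ≤ (p : ℝ) ^ ε) →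
            ∃ S' : Finset ℤ, S' ⊆ S ∧ ∃ Q : Set ℤ, ∃ r' : ℕ,
              (r' : ℝ) ≤ C₂ * ((r : ℝ) + Real.log δ⁻¹) ^ (3 + η) ∧
              IsGAP Q r' ∧ ↑S' ⊆ Q ∧
              c₁ * δ ^ C₂ * Real.exp (-(C₂ * r * ((r : ℝ) + Real.log δ⁻¹) ^ (3 + η))) *
                  (S.card : ℝ) ≤ (S'.card : ℝ) ∧
              (Q.ncard : ℝ) ≤ Real.exp (C₂ * ((r : ℝ) + Real.log δ⁻¹) ^ (3 + η)) *
                  (S'.card : ℝ) := by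
  intro ε hε η hη
  obtain ⟨y₀, hy₀, hprimes⟩ := eventually_le_card_primesBetween_mul_log
  have hε1 : 0 < 1 - ε := by linarith [hε.2]
  set W : ℝ := max 128 y₀ with hW
  have hW128 : 128 ≤ W := le_max_left _ _
  set C : ℝ := 2 + 48 / (1 - ε) with hC
  have hC50 : 50 ≤ C := by
    have : 48 ≤ 48 / (1 - ε) := by
      rw [le_div_iff₀ hε1]
      linarith [hε.1]
    linarith
  refine ⟨Real.exp (-W), C, Real.exp_pos _, by linarith, ?_⟩
  intro r hr δ hδ N hN y hNy hyN S hS h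
  have hr1 : (1 : ℝ) ≤ r := by exact_mod_cast hr
  have hN1 : (1 : ℝ) ≤ N := by exact_mod_cast hN
  have hδ0 : 0 < δ⁻¹ := inv_pos.2 hδ.1
  have hL : 0 < Real.log δ⁻¹ := Real.log_pos ((one_lt_inv₀ hδ.1).2 hδ.2)
  have hδexp : δ⁻¹ ≤ Real.exp (Real.log δ⁻¹) := (Real.exp_log hδ0).ge
  set L := Real.log δ⁻¹
  set Λ : ℝ := r + L
  have hΛ1 : 1 ≤ Λ := by linarith
  set E := Λ ^ (3 + η)
  have hEsq : Λ * Λ ≤ E := by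
    rw [← sq, ← Real.rpow_natCast]
    refine Real.rpow_le_rpow_of_exponent_le hΛ1 ?_
    push_cast
    linarith
  have hΛE : Λ ≤ E := by nlinarith
  have hE1 : 1 ≤ E := hΛ1.trans hΛE
  have hrE : (r : ℝ) ≤ E := by linarith
  have hrΛ : r * Λ ≤ E := (mul_le_mul_of_nonneg_right (by linarith) (by linarith)).trans hEsq
  have hECE : 50 * E ≤ C * E := mul_le_mul_of_nonneg_right hC50 (by linarith)
  -- It suffices to bound `S'` from below up to the factors `c₁` and `exp (C E)`.
  have hlower : ∀ m : ℝ, 0 ≤ m → δ ^ C * Real.exp (-(C * r * E)) * m ≤ Real.exp (-(C * E)) * m := by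
    intro m hm
    refine mul_le_mul_of_nonneg_right ?_ hm
    have h1 : δ ^ C ≤ 1 := Real.rpow_le_one hδ.1.le hδ.2.le (by linarith)
    have h2 : C * E ≤ C * r * E := by
      have hCE : 0 ≤ C * E := mul_nonneg (by linarith) (by linarith)
      nlinarith
    calc δ ^ C * Real.exp (-(C * r * E)) ≤ 1 * Real.exp (-(C * r * E)) := by gcongr
      _ ≤ _ := by rw [one_mul]; gcongr
  have hW1 : Real.exp (-W) ≤ 1 := Real.exp_le_one_iff.2 (by linarith)
  rcases S.eq_empty_or_nonempty with rfl | hne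
  · refine ⟨∅, subset_rfl, (gap (0 : ℤ) (0 : Fin 1 → ℤ) 1 0 : Set ℤ), 1, ?_, isGAP_gap _ _ _ _,
      by simp, by simp, by simp [gap]⟩
    push_cast
    linarith
  -- If `S` is small, a single point will do.
  have hsingle : Real.exp (-W) * Real.exp (-(C * E)) * S.card ≤ 1 →
      ∃ S' : Finset ℤ, S' ⊆ S ∧ ∃ Q : Set ℤ, ∃ r' : ℕ, (r' : ℝ) ≤ C * E ∧ IsGAP Q r' ∧
        ↑S' ⊆ Q ∧ Real.exp (-W) * δ ^ C * Real.exp (-(C * r * E)) * S.card ≤ S'.card ∧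
        (Q.ncard : ℝ) ≤ Real.exp (C * E) * S'.card := by
    intro hcard
    obtain ⟨s, hs⟩ := hne
    refine ⟨{s}, Finset.singleton_subset_iff.2 hs, {s}, 0, by rw [Nat.cast_zero]; linarith,
      isGAP_singleton s, by simp, ?_, ?_⟩
    · rw [Finset.card_singleton, Nat.cast_one, mul_assoc, mul_assoc, ← mul_assoc (δ ^ C)]
      rw [mul_assoc] at hcard
      exact (mul_le_mul_of_nonneg_left (hlower S.card (by positivity))
        (Real.exp_pos _).le).trans hcard
    · rw [Finset.card_singleton, Set.ncard_singleton, Nat.cast_one, mul_one]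
      exact Real.one_le_exp (by linarith)
  have hlogN : 0 ≤ Real.log N := Real.log_nonneg hN1
  have hypos : 0 < y := (Real.rpow_nonneg hlogN _).trans_lt hNy
  set z := y ^ ((1 - ε) / 2)
  have hyz : y ≤ z ^ (2 / (1 - ε)) := by
    rw [← Real.rpow_mul hypos.le, show (1 - ε) / 2 * (2 / (1 - ε)) = 1 by field_simp,
      Real.rpow_one]
  have hNz : Real.log N ≤ z := by
    have := Real.rpow_le_rpow (Real.rpow_nonneg hlogN _) hNy.le (show 0 ≤ (1 - ε) / 2 by linarith)
    rwa [← Real.rpow_mul hlogN, show 2 / (1 - ε) * ((1 - ε) / 2) = 1 by field_simp,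
      Real.rpow_one] at this
  rcases lt_or_ge z W with hzW | hzW
  · refine hsingle ?_
    have hSN : (S.card : ℝ) ≤ N := by
      have := Finset.card_le_card hS
      rw [Int.card_Icc] at this
      exact_mod_cast this.trans (by simp)
    have hSW : (S.card : ℝ) ≤ Real.exp W := by
      rw [← Real.exp_log (show (0 : ℝ) < N by linarith)] at hSN
      exact hSN.trans (Real.exp_le_exp.2 (hNz.trans hzW.le))
    calc Real.exp (-W) * Real.exp (-(C * E)) * S.card ≤ Real.exp (-W) * 1 * Real.exp W := by
          gcongr
          exact Real.exp_le_one_iff.2 (by linarith)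
      _ = 1 := by rw [mul_one, ← Real.exp_add, neg_add_cancel, Real.exp_zero]
  have hy1 : 1 < y := by
    by_contra! hy
    linarith [Real.rpow_le_one hypos.le hy (show 0 ≤ (1 - ε) / 2 by linarith)]
  have hzy : z ≤ y := by
    refine (Real.rpow_le_rpow_of_exponent_le hy1.le ?_).trans_eq (Real.rpow_one y)
    linarith [hε.1]
  have hprimes' := hprimes y (by linarith [le_max_right 128 y₀])
  obtain ⟨κ, k₀, hκ, hk, hk', hk₀exp, hA, hB⟩ := exists_natCast_pow_le_exp hδ hr hΛE hrΛ
  have hk₀1 : (1 : ℝ) ≤ k₀ := by exact_mod_cast (show 1 ≤ k₀ by omega)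
  rcases lt_or_ge z (128 * ((2 * k₀) ^ r * k₀)) with hzk | hzk
  · refine hsingle ?_
    have hS4 : (S.card : ℝ) ≤ 4 * y := by
      have hsieve := sieve_inequality hε hy1.le hN1 le_rfl zero_le_one hNz (by linarith)
      rw [one_mul, one_mul] at hsieve
      have hyε : (2 * y) ^ ε ≤ 2 * y := by
        simpa using Real.rpow_le_rpow_of_exponent_le (show 1 ≤ 2 * y by linarith) hε.2.le
      linarith [DenseInGAPs.card_le h hε.1.le hδ hN hS hy1 hprimes' hsieve]
    have hzexp : z ≤ Real.exp (24 * E) := by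
      calc z ≤ 2 ^ 6 * ((2 * k₀) ^ r * (2 * k₀)) := by linarith
        _ ≤ Real.exp (6 : ℕ) * (Real.exp (9 * E) * Real.exp (9 * E)) := by
          gcongr
          exact two_pow_le_exp 6
        _ = Real.exp (6 + (9 * E + 9 * E)) := by rw [← Real.exp_add, ← Real.exp_add]; norm_num
        _ ≤ _ := Real.exp_le_exp.2 (by linarith)
    have hSexp : (S.card : ℝ) ≤ Real.exp (C * E) := by
      calc (S.card : ℝ) ≤ 2 ^ 2 * z ^ (2 / (1 - ε)) := by linarith
        _ ≤ Real.exp (2 : ℕ) * Real.exp (24 * E) ^ (2 / (1 - ε)) := by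
          gcongr
          exact two_pow_le_exp 2
        _ = Real.exp (2 + 48 / (1 - ε) * E) := by
          rw [← Real.exp_mul, ← Real.exp_add]
          push_cast
          ring_nf
        _ ≤ _ := Real.exp_le_exp.2 (by rw [hC]; linarith)
    rw [mul_assoc]
    refine (mul_le_of_le_one_left (by positivity) hW1).trans ?_
    rwa [Real.exp_neg, inv_mul_le_iff₀ (Real.exp_pos _), mul_one]
  · obtain ⟨S', hS', Q, r', hr', hQ, hSQ, hQcard, hScard⟩ :=
      DenseInGAPs.exists_gap h hε.1.le hδ hN hS hne hy1 hprimes' hκ hk hk'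
        (sieve_inequality hε hy1.le hN1 hk₀1 (by positivity) hNz hzk)
    have hAδ : 2 * ((2 * (k₀ : ℝ)) ^ r * δ⁻¹) ≤ Real.exp (11 * E) := by
      calc 2 * ((2 * (k₀ : ℝ)) ^ r * δ⁻¹) ≤ Real.exp 1 * (Real.exp (9 * E) * Real.exp L) := by
            gcongr
            simpa using two_pow_le_exp 1
        _ = Real.exp (1 + (9 * E + L)) := by rw [← Real.exp_add, ← Real.exp_add]
        _ ≤ _ := Real.exp_le_exp.2 (by linarith)
    refine ⟨S', hS', Q, r', ?_, hQ, Finset.coe_subset.2 hSQ, ?_, ?_⟩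
    · have : (r' : ℝ) ≤ r := by exact_mod_cast hr'
      linarith
    · rw [mul_assoc, mul_assoc, ← mul_assoc (δ ^ C)]
      refine (mul_le_of_le_one_left ?_ hW1).trans ((hlower S.card (by positivity)).trans ?_)
      · have := Real.rpow_nonneg hδ.1.le C
        positivity
      · rw [Real.exp_neg, inv_mul_le_iff₀ (Real.exp_pos _)]
        refine hScard.trans ?_
        gcongr
        calc (4 * (κ : ℝ)) ^ r * (2 * ((2 * (k₀ : ℝ)) ^ r * δ⁻¹)) ≤
              Real.exp (5 * E) * Real.exp (11 * E) := by gcongr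
          _ = Real.exp (16 * E) := by rw [← Real.exp_add]; ring_nf
          _ ≤ _ := Real.exp_le_exp.2 (by linarith)
    · rw [Set.ncard_coe_finset]
      refine hQcard.trans ?_
      gcongr
      exact hAδ.trans (Real.exp_le_exp.2 (by linarith))
end

section
/- There exist an absolute constant C > 0 and, for each ε ∈ (0, 1/2), a threshold N₀(ε) such that the following holds. Let N > N₀(ε) be an integer and let y be a real number with (4C·log N)^{1/(2ε)} ≤ y ≤ N. Let 𝒫 be a set of primes in [y, 2y] with |𝒫| ≥ C·y^{1−2ε}·log N / log y. For each prime p ∈ 𝒫, let d_p ∈ {1, 2, …, p−1}, and let ℓ_p, r_p be integers with −p^{1/2−ε} ≤ ℓ_p ≤ 0 ≤ r_p ≤ p^{1/2−ε}. Let S be the set of all integers n ∈ {0, 1, …, N} such that for every p ∈ 𝒫 the residue of n·d_p mod p lies in the image mod p of the integer interval [ℓ_p, r_p]. Then S is an arithmetic progression of integers of length at most (2y)^{1/2−ε} + 1. -/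
/-- `A ⊆ ℤ` is an arithmetic progression with exactly `k` terms
(the empty set being the case `k = 0`). -/
def IsIntAPLen (A : Set ℤ) (k : ℕ) : Prop :=
  ∃ a d : ℤ, A = (fun j : ℕ => a + (j : ℤ) * d) '' {j : ℕ | j < k}

/-- If distinct primes, all at least `y`, divide `K ≠ 0`, then there are at most
`log K / log y` of them. -/
lemma card_mul_log_le_log_of_forall_prime_dvd {Ps : Finset ℕ} {y : ℝ} (hy : 1 ≤ y)
    (hP : ∀ p ∈ Ps, Nat.Prime p ∧ y ≤ (p : ℝ)) {K : ℕ} (hK : K ≠ 0)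
    (hdvd : ∀ p ∈ Ps, p ∣ K) : (Ps.card : ℝ) * Real.log y ≤ Real.log K := by
  have hprod : ∏ p ∈ Ps, p ∣ K :=
    Finset.prod_primes_dvd K (fun p hp => (hP p hp).1.prime) hdvd
  have hle : ∏ p ∈ Ps, p ≤ K := Nat.le_of_dvd (Nat.pos_of_ne_zero hK) hprod
  have hpow : y ^ Ps.card ≤ ∏ p ∈ Ps, (p : ℝ) := by
    rw [← Finset.prod_const]
    exact Finset.prod_le_prod (fun _ _ => by linarith) fun p hp => (hP p hp).2
  have hpowK : y ^ Ps.card ≤ (K : ℝ) := hpow.trans (by rw [← Nat.cast_prod]; exact_mod_cast hle)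
  rw [← Real.log_pow]
  exact Real.log_le_log (by positivity) hpowK

/-- If `p ∣ n * b p - m * a p` for sufficiently many primes `p`, with `a p` and `b p` small, then
`n * b p = m * a p` for one of these primes, which moreover does not divide `n`. -/
lemma exists_prime_mul_eq_mul {Ps : Finset ℕ} {y : ℝ} (hy : 1 ≤ y)
    (hP : ∀ p ∈ Ps, Nat.Prime p ∧ y ≤ (p : ℝ)) {N M : ℕ} (hM : 1 ≤ M) {n m : ℤ}
    (hn : 0 < n) (hnN : n ≤ N) (hm : 0 < m) (hmN : m ≤ N) {a b : ℕ → ℤ}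
    (ha : ∀ p ∈ Ps, |a p| ≤ M) (hb : ∀ p ∈ Ps, |b p| ≤ M)
    (hdvd : ∀ p ∈ Ps, (p : ℤ) ∣ n * b p - m * a p)
    (hcard : Real.log N + (2 * M + 1) ^ 2 * Real.log (2 * N * M) < Ps.card * Real.log y) :
    ∃ p ∈ Ps, ¬ (p : ℤ) ∣ n ∧ n * b p = m * a p := by
  by_contra! hcon
  set I : Finset (ℤ × ℤ) := Finset.Icc (-(M : ℤ)) M ×ˢ Finset.Icc (-(M : ℤ)) M with hI
  let f : ℤ × ℤ → ℕ := fun x => if n * x.2 = m * x.1 then 1 else (n * x.2 - m * x.1).natAbs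
  have hf0 : ∀ x, f x ≠ 0 := by
    intro x
    simp only [f]
    split_ifs with h
    · exact one_ne_zero
    · rwa [Ne, Int.natAbs_eq_zero, sub_eq_zero]
  have hN1 : 1 ≤ N := by omega
  have hfle : ∀ x ∈ I, f x ≤ 2 * N * M := by
    rintro ⟨u, v⟩ hx
    simp only [hI, Finset.mem_product, Finset.mem_Icc, ← abs_le] at hx
    simp only [f]
    split_ifs with h
    · have := Nat.mul_le_mul hN1 hM
      linarith
    · zify
      have h1 : |n * v| ≤ N * M := by
        rw [abs_mul, abs_of_pos hn]
        exact mul_le_mul hnN hx.2 (abs_nonneg _) (by positivity)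
      have h2 : |m * u| ≤ N * M := by
        rw [abs_mul, abs_of_pos hm]
        exact mul_le_mul hmN hx.1 (abs_nonneg _) (by positivity)
      have := abs_sub (n * v) (m * u)
      linarith
  have hK : n.natAbs * ∏ x ∈ I, f x ≠ 0 :=
    mul_ne_zero (by omega) (Finset.prod_ne_zero_iff.mpr fun x _ => hf0 x)
  have key := card_mul_log_le_log_of_forall_prime_dvd hy hP hK (by
    intro p hp
    by_cases hpn : (p : ℤ) ∣ n
    · exact Dvd.dvd.mul_right (Int.natCast_dvd.mp hpn) _
    · refine Dvd.dvd.mul_left ?_ _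
      have hmem : (a p, b p) ∈ I := by
        simp only [hI, Finset.mem_product, Finset.mem_Icc, ← abs_le]
        exact ⟨ha p hp, hb p hp⟩
      refine dvd_trans ?_ (Finset.dvd_prod_of_mem f hmem)
      simp only [f, if_neg (hcon p hp hpn)]
      exact Int.natCast_dvd.mp (hdvd p hp))
  have hlogK : Real.log ((n.natAbs * ∏ x ∈ I, f x : ℕ) : ℝ) ≤
      Real.log N + (2 * M + 1) ^ 2 * Real.log (2 * N * M) := by
    push_cast
    rw [Real.log_mul (by positivity)
      (Finset.prod_ne_zero_iff.mpr fun x _ => by exact_mod_cast hf0 x),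
      Real.log_prod (fun x _ => by exact_mod_cast hf0 x)]
    refine add_le_add (Real.log_le_log (by positivity) ?_) ?_
    · rw [Nat.cast_natAbs, abs_of_pos hn]
      exact_mod_cast hnN
    · have hcardI : (I.card : ℝ) = (2 * M + 1) ^ 2 := by
        have : ((M : ℤ) + 1 - -M).toNat = 2 * M + 1 := by omega
        simp only [hI, Finset.card_product, Int.card_Icc, this]
        push_cast
        ring
      rw [← hcardI, ← nsmul_eq_mul]
      refine Finset.sum_le_card_nsmul _ _ _ fun x hx => Real.log_le_log ?_ ?_
      · exact_mod_cast Nat.pos_of_ne_zero (hf0 x)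
      · exact_mod_cast hfle x hx
  linarith

/-- If the residues of `g * u * d` and `g * v * d` modulo `p` lie in the short interval `[l, r]`
around `0`, where `u` and `v` are small and coprime, then so do those of `g * j * d`
for `0 ≤ j ≤ v`. -/
lemma exists_residue_mem_Icc_of_coprime {p : ℕ} (hp : p.Prime) {M : ℕ} (hM : 2 * M ^ 2 < p)
    {l r g u v d : ℤ} (hlM : -M ≤ l) (hrM : r ≤ M) (hl : l ≤ 0) (hr : 0 ≤ r)
    (hu : 0 < u) (huM : u ≤ M) (hv : 0 < v) (hvM : v ≤ M) (huv : IsCoprime u v)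
    (hgu : ∃ i, l ≤ i ∧ i ≤ r ∧ (p : ℤ) ∣ g * u * d - i)
    (hgv : ∃ i, l ≤ i ∧ i ≤ r ∧ (p : ℤ) ∣ g * v * d - i) {j : ℤ} (hj : 0 ≤ j) (hjv : j ≤ v) :
    ∃ i, l ≤ i ∧ i ≤ r ∧ (p : ℤ) ∣ g * j * d - i := by
  obtain ⟨a, hla, har, hpa⟩ := hgu
  obtain ⟨b, hlb, hbr, hpb⟩ := hgv
  have hMp : 2 * (M : ℤ) ^ 2 < p := by exact_mod_cast hM
  have heq : u * b = v * a := by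
    have hdiv : (p : ℤ) ∣ u * b - v * a := by
      have heq : u * b - v * a = v * (g * u * d - a) - u * (g * v * d - b) := by ring
      exact heq ▸ dvd_sub (hpa.mul_left v) (hpb.mul_left u)
    have h1 : |u * b| ≤ M * M := by
      rw [abs_mul, abs_of_pos hu]
      exact mul_le_mul huM (abs_le.mpr ⟨by linarith, by linarith⟩) (abs_nonneg _) (by positivity)
    have h2 : |v * a| ≤ M * M := by
      rw [abs_mul, abs_of_pos hv]
      exact mul_le_mul hvM (abs_le.mpr ⟨by linarith, by linarith⟩) (abs_nonneg _) (by positivity)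
    have h3 := abs_sub (u * b) (v * a)
    exact sub_eq_zero.mp (Int.eq_zero_of_abs_lt_dvd hdiv (by nlinarith))
  obtain ⟨t, rfl⟩ : v ∣ b := huv.symm.dvd_of_dvd_mul_left ⟨a, heq⟩
  have hat : a = u * t := by
    have : v * a = v * (u * t) := by rw [← heq]; ring
    exact mul_left_cancel₀ hv.ne' this
  have hpu : ¬ (p : ℤ) ∣ u := fun h => by
    have := Int.le_of_dvd hu h
    nlinarith
  have hpt : (p : ℤ) ∣ g * d - t := by
    have : (p : ℤ) ∣ u * (g * d - t) := by
      have heq : u * (g * d - t) = g * u * d - a := by rw [hat]; ring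
      exact heq ▸ hpa
    exact ((Nat.prime_iff_prime_int.mp hp).dvd_or_dvd this).resolve_left hpu
  refine ⟨j * t, ?_, ?_, ?_⟩
  · rcases le_total 0 t with ht | ht
    · exact hl.trans (mul_nonneg hj ht)
    · exact hlb.trans (mul_le_mul_of_nonpos_right hjv ht)
  · rcases le_total 0 t with ht | ht
    · exact (mul_le_mul_of_nonneg_right hjv ht).trans hbr
    · exact (mul_nonpos_of_nonneg_of_nonpos hj ht).trans hr
  · have heq : g * j * d - j * t = j * (g * d - t) := by ring
    exact heq ▸ hpt.mul_left j

/-- A set of nonnegative integers containing `0` is an arithmetic progression as soon as, for any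
two positive elements `g * u` and `g * v` with `u` and `v` coprime, it contains all `g * j` with
`0 ≤ j ≤ v`, and all the `v` are bounded by `M`. -/
lemma exists_isIntAPLen_of_coprime_closed {S : Set ℤ} {M : ℕ} (h0 : (0 : ℤ) ∈ S)
    (hnonneg : ∀ n ∈ S, 0 ≤ n)
    (hS : ∀ g u v : ℤ, 0 < g → 0 < u → 0 < v → IsCoprime u v → g * u ∈ S → g * v ∈ S →
      v ≤ M ∧ ∀ j, 0 ≤ j → j ≤ v → g * j ∈ S) :
    ∃ k : ℕ, k ≤ M + 1 ∧ IsIntAPLen S k := by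
  classical
  by_cases hpos : ∃ g : ℕ, 0 < g ∧ (g : ℤ) ∈ S
  · obtain ⟨hg, hgS⟩ := Nat.find_spec hpos
    have hmin : ∀ n : ℕ, 0 < n → (n : ℤ) ∈ S → Nat.find hpos ≤ n :=
      fun n hn hnS => Nat.find_min' hpos ⟨hn, hnS⟩
    generalize Nat.find hpos = g at hg hgS hmin
    have hmul : ∀ n ∈ S, ∃ i : ℕ, n = g * i := by
      intro n hn
      rcases (hnonneg n hn).eq_or_lt with rfl | hn0
      · exact ⟨0, by simp⟩
      lift n to ℕ using hn0.le
      have hnpos : 0 < n := by exact_mod_cast hn0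
      obtain ⟨u, w, hcop, hu, hw⟩ := Nat.exists_coprime n g
      have hc : 0 < n.gcd g := Nat.gcd_pos_of_pos_right _ hg
      have hu0 : 0 < u := Nat.pos_of_mul_pos_right (hu ▸ hnpos)
      have hw0 : 0 < w := Nat.pos_of_mul_pos_right (hw ▸ hg)
      have hmem := (hS (n.gcd g) u w (by exact_mod_cast hc) (by exact_mod_cast hu0)
        (by exact_mod_cast hw0) (Nat.isCoprime_iff_coprime.mpr hcop)
        (by rw [mul_comm]; exact_mod_cast hu ▸ hn)
        (by rw [mul_comm]; exact_mod_cast hw ▸ hgS)).2 1 zero_le_one (by exact_mod_cast hw0)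
      rw [mul_one] at hmem
      have hle := hmin _ hc hmem
      have heq : n.gcd g = g := le_antisymm (Nat.gcd_le_right _ hg) hle
      obtain ⟨i, hi⟩ := Nat.gcd_eq_right_iff_dvd.mp heq
      exact ⟨i, by exact_mod_cast hi⟩
    have hgpos : (0 : ℤ) < g := by exact_mod_cast hg
    have hbound : ∀ i : ℕ, 0 < i → (g * i : ℤ) ∈ S →
        (i : ℤ) ≤ M ∧ ∀ j : ℤ, 0 ≤ j → j ≤ i → g * j ∈ S := fun i hi hiS =>
      hS g 1 i hgpos one_pos (by exact_mod_cast hi) isCoprime_one_left (by simpa using hgS) hiS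
    set K := Nat.findGreatest (fun i : ℕ => (g * i : ℤ) ∈ S) M
    have hM : 1 ≤ M := by
      have := (hbound 1 one_pos (by simpa using hgS)).1
      omega
    have hKS : (g * K : ℤ) ∈ S :=
      Nat.findGreatest_spec (P := fun i : ℕ => (g * i : ℤ) ∈ S) hM (by simpa using hgS)
    have hK1 : 1 ≤ K := Nat.le_findGreatest hM (by simpa using hgS)
    refine ⟨K + 1, by have := Nat.findGreatest_le (P := fun i : ℕ => (g * i : ℤ) ∈ S) M; omega,
      0, g, Set.ext fun n => ⟨fun hn => ?_, ?_⟩⟩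
    · obtain ⟨i, rfl⟩ := hmul n hn
      refine ⟨i, ?_, by ring⟩
      rcases Nat.eq_zero_or_pos i with rfl | hi
      · exact Nat.succ_pos _
      · exact Nat.lt_succ_of_le (Nat.le_findGreatest (by exact_mod_cast (hbound i hi hn).1) hn)
    · rintro ⟨i, hi, rfl⟩
      have hiK : i < K + 1 := hi
      have := (hbound K hK1 hKS).2 i (by positivity) (by omega)
      simpa [mul_comm] using this
  · refine ⟨1, by omega, 0, 0, Set.ext fun n => ⟨fun hn => ⟨0, by simp, ?_⟩, ?_⟩⟩
    · by_contra hne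
      have hn0 := hnonneg n hn
      lift n to ℕ using hn0
      exact hpos ⟨n, Nat.pos_of_ne_zero fun h => hne (by simp [h]), hn⟩
    · rintro ⟨i, -, rfl⟩
      simpa using h0

/-- The arithmetic part of the theorem: all the hypotheses on the sizes are expressed in terms of
the bound `M` for the residues. -/
lemma exists_isIntAPLen_of_small_residues {Ps : Finset ℕ} {y : ℝ} (hy : 1 ≤ y)
    (hP : ∀ p ∈ Ps, Nat.Prime p ∧ y ≤ (p : ℝ)) {N M : ℕ} (hM : 1 ≤ M)
    (hMy : 2 * (M : ℝ) ^ 2 < y)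
    (hcard : Real.log N + (2 * M + 1) ^ 2 * Real.log (2 * N * M) < Ps.card * Real.log y)
    {d l r : ℕ → ℤ} (hd : ∀ p ∈ Ps, ¬ (p : ℤ) ∣ d p)
    (hlr : ∀ p ∈ Ps, -M ≤ l p ∧ l p ≤ 0 ∧ 0 ≤ r p ∧ r p ≤ M) :
    ∃ k : ℕ, k ≤ M + 1 ∧ IsIntAPLen {n : ℤ | 0 ≤ n ∧ n ≤ N ∧
      ∀ p ∈ Ps, ∃ i, l p ≤ i ∧ i ≤ r p ∧ (p : ℤ) ∣ n * d p - i} k := by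
  refine exists_isIntAPLen_of_coprime_closed
    ⟨le_rfl, by positivity, fun p hp => ⟨0, (hlr p hp).2.1, (hlr p hp).2.2.1, by simp⟩⟩
    (fun n hn => hn.1) ?_
  rintro g u v hg hu hv huv ⟨-, hguN, hgu⟩ ⟨-, hgvN, hgv⟩
  have hMp : ∀ p ∈ Ps, 2 * M ^ 2 < p := fun p hp => by
    exact_mod_cast hMy.trans_le (hP p hp).2
  have huvM : u ≤ M ∧ v ≤ M := by
    choose! a hla har hpa using hgu
    choose! b hlb hbr hpb using hgv
    have ha : ∀ p ∈ Ps, |a p| ≤ M := fun p hp => by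
      have := hlr p hp
      exact abs_le.mpr ⟨by linarith [hla p hp], by linarith [har p hp]⟩
    have hb : ∀ p ∈ Ps, |b p| ≤ M := fun p hp => by
      have := hlr p hp
      exact abs_le.mpr ⟨by linarith [hlb p hp], by linarith [hbr p hp]⟩
    obtain ⟨p, hp, hpn, heq⟩ := exists_prime_mul_eq_mul hy hP hM (mul_pos hg hu) hguN
      (mul_pos hg hv) hgvN ha hb (fun p hp => by
        have heq : g * u * b p - g * v * a p =
            g * v * (g * u * d p - a p) - g * u * (g * v * d p - b p) := by ring
        exact heq ▸ dvd_sub ((hpa p hp).mul_left (g * v)) ((hpb p hp).mul_left (g * u))) hcard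
    have ha0 : a p ≠ 0 := by
      intro h
      have h1 := hpa p hp
      rw [h, sub_zero] at h1
      exact ((Nat.prime_iff_prime_int.mp (hP p hp).1).dvd_or_dvd h1).elim hpn (hd p hp)
    have hab : u * b p = v * a p := by
      apply mul_left_cancel₀ hg.ne'
      linarith
    have hb0 : b p ≠ 0 := by
      intro h
      rw [h, mul_zero] at hab
      exact (mul_ne_zero hv.ne' ha0) hab.symm
    have hua : u ∣ a p := huv.dvd_of_dvd_mul_left ⟨b p, hab.symm⟩
    have hvb : v ∣ b p := huv.symm.dvd_of_dvd_mul_left ⟨a p, hab⟩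
    exact ⟨(Int.le_of_dvd (abs_pos.mpr ha0) ((dvd_abs _ _).mpr hua)).trans (ha p hp),
      (Int.le_of_dvd (abs_pos.mpr hb0) ((dvd_abs _ _).mpr hvb)).trans (hb p hp)⟩
  refine ⟨huvM.2, fun j hj hjv => ⟨by positivity, ?_, fun p hp => ?_⟩⟩
  · exact (mul_le_mul_of_nonneg_left hjv hg.le).trans hgvN
  · obtain ⟨h1, h2, h3, h4⟩ := hlr p hp
    exact exists_residue_mem_Icc_of_coprime (hP p hp).1 (hMp p hp) h1 h4 h2 h3 hu huvM.1 hv huvM.2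
      huv (hgu p hp) (hgv p hp) hj hjv

theorem stmt8 :
    ∃ C : ℝ, 0 < C ∧ ∀ ε : ℝ, ε ∈ Set.Ioo (0 : ℝ) (1/2) → ∃ N₀ : ℕ,
      ∀ N : ℕ, N₀ < N → ∀ y : ℝ,
        (4 * C * Real.log N) ^ (1 / (2 * ε)) ≤ y → y ≤ N →
        ∀ Ps : Finset ℕ,
          (∀ p ∈ Ps, Nat.Prime p ∧ y ≤ (p : ℝ) ∧ (p : ℝ) ≤ 2 * y) →
          C * y ^ (1 - 2 * ε) * Real.log N / Real.log y ≤ (Ps.card : ℝ) →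
          ∀ d : ℕ → ℕ, (∀ p ∈ Ps, 1 ≤ d p ∧ d p ≤ p - 1) →
          ∀ l r : ℕ → ℤ,
            (∀ p ∈ Ps, -((p : ℝ) ^ ((1 : ℝ)/2 - ε)) ≤ (l p : ℝ) ∧ l p ≤ 0 ∧ 0 ≤ r p ∧
              (r p : ℝ) ≤ (p : ℝ) ^ ((1 : ℝ)/2 - ε)) →
          ∀ S : Set ℤ,
            S = {n : ℤ | 0 ≤ n ∧ n ≤ (N : ℤ) ∧ ∀ p ∈ Ps, ∃ j : ℤ, l p ≤ j ∧ j ≤ r p ∧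
                  ((n * (d p : ℤ) : ℤ) : ZMod p) = (j : ZMod p)} →
            ∃ k : ℕ, (k : ℝ) ≤ (2 * y) ^ ((1 : ℝ)/2 - ε) + 1 ∧ IsIntAPLen S k := by
  refine ⟨100, by norm_num, fun ε hε => ⟨3, ?_⟩⟩
  obtain ⟨hε0, hε1⟩ := hε
  intro N hN y hNy hyN Ps hPs hcard d hd l r hlr S hS
  have hN4 : (4 : ℝ) ≤ N := by exact_mod_cast hN
  have hlogN : 1 ≤ Real.log N := by
    rw [Real.le_log_iff_exp_le (by linarith)]
    linarith [Real.exp_one_lt_d9]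
  have hbase : (400 : ℝ) ≤ 4 * 100 * Real.log N := by linarith
  have hy1 : 1 < y :=
    (Real.one_lt_rpow (by linarith) (by positivity)).trans_le hNy
  have hyε : 400 ≤ y ^ (2 * ε) := by
    have h := Real.rpow_le_rpow (by positivity) hNy (by positivity : 0 ≤ 2 * ε)
    rw [← Real.rpow_mul (by linarith), one_div_mul_cancel (by positivity), Real.rpow_one] at h
    linarith
  set L : ℝ := (2 * y) ^ ((1 : ℝ) / 2 - ε) with hL
  set Y : ℝ := y ^ (1 - 2 * ε) with hY
  have hYpos : 0 < Y := by positivity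
  have hL1 : 1 ≤ L := Real.one_le_rpow (by linarith) (by linarith)
  have hLsq : L ^ 2 ≤ 2 * Y := by
    rw [hL, ← Real.rpow_natCast, ← Real.rpow_mul (by linarith),
      Real.mul_rpow (by norm_num) (by linarith)]
    have hexp : ((1 : ℝ) / 2 - ε) * (2 : ℕ) = 1 - 2 * ε := by push_cast; ring
    rw [hexp]
    refine mul_le_mul_of_nonneg_right ?_ hYpos.le
    exact Real.rpow_le_self_of_one_le one_le_two (by linarith)
  have hYy : 400 * Y ≤ y := by
    have : y ^ (2 * ε) * Y = y := by
      rw [hY, ← Real.rpow_add (by linarith)]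
      simp
    nlinarith
  set M : ℕ := ⌊L⌋₊ with hMdef
  have hM1 : 1 ≤ M := Nat.one_le_floor_iff _ |>.mpr hL1
  have hML : (M : ℝ) ≤ L := Nat.floor_le (by linarith)
  have hM1R : (1 : ℝ) ≤ M := by exact_mod_cast hM1
  have hMsq : (M : ℝ) ^ 2 ≤ 2 * Y := (pow_le_pow_left₀ (by positivity) hML 2).trans hLsq
  have hlogy : 0 < Real.log y := Real.log_pos hy1
  have hle_M : ∀ p ∈ Ps, ∀ z : ℤ, (z : ℝ) ≤ (p : ℝ) ^ ((1 : ℝ) / 2 - ε) → z ≤ M := by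
    intro p hp z hz
    have hzL : (z : ℝ) ≤ L :=
      hz.trans (Real.rpow_le_rpow (by positivity) (hPs p hp).2.2 (by linarith))
    rw [hMdef, Int.natCast_floor_eq_floor (by linarith)]
    exact Int.le_floor.mpr hzL
  have hsum : Real.log N + (2 * M + 1) ^ 2 * Real.log (2 * N * M) < Ps.card * Real.log y := by
    have hlog : Real.log (2 * N * M) ≤ 3 * Real.log N := by
      have hpow : 3 * Real.log N = Real.log ((N : ℝ) ^ 3) := by rw [Real.log_pow]; norm_num
      rw [hpow]
      refine Real.log_le_log (by positivity) ?_
      have hMN : (M : ℝ) ≤ N := by nlinarith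
      nlinarith [mul_le_mul_of_nonneg_left hMN (by positivity : (0 : ℝ) ≤ N), sq_nonneg (N : ℝ)]
    have hM9 : (2 * (M : ℝ) + 1) ^ 2 ≤ 18 * Y := by nlinarith
    have h1 : (2 * (M : ℝ) + 1) ^ 2 * Real.log (2 * N * M) ≤ 18 * Y * (3 * Real.log N) :=
      mul_le_mul hM9 hlog (Real.log_nonneg (by nlinarith)) (by positivity)
    have h2 : 100 * Y * Real.log N ≤ Ps.card * Real.log y := (div_le_iff₀ hlogy).mp hcard
    have hY2 : 1 ≤ 2 * Y := by nlinarith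
    nlinarith [mul_pos hYpos (by linarith : 0 < Real.log N)]
  obtain ⟨k, hk, hAP⟩ := exists_isIntAPLen_of_small_residues (d := fun p => (d p : ℤ)) (l := l)
    (r := r) hy1.le (fun p hp => ⟨(hPs p hp).1, (hPs p hp).2.1⟩) hM1 (by linarith) hsum
    (fun p hp hdvd => by
      obtain ⟨h1, h2⟩ := hd p hp
      have := Nat.le_of_dvd h1 (Int.natCast_dvd_natCast.mp hdvd)
      have := (hPs p hp).1.pos
      omega)
    (fun p hp => by
      obtain ⟨h1, h2, h3, h4⟩ := hlr p hp
      refine ⟨?_, h2, h3, hle_M p hp _ h4⟩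
      have := hle_M p hp (-l p) (by push_cast; linarith)
      linarith)
  refine ⟨k, ?_, ?_⟩
  · have : (k : ℝ) ≤ M + 1 := by exact_mod_cast hk
    linarith
  · rw [hS]
    have hcast : ∀ (p : ℕ) (n i : ℤ),
        ((n * (d p : ℤ) : ℤ) : ZMod p) = (i : ZMod p) ↔ (p : ℤ) ∣ n * (d p : ℤ) - i := by
      intro p n i
      rw [ZMod.intCast_eq_intCast_iff_dvd_sub, dvd_sub_comm]
    simpa only [hcast] using hAP
end

section
/- Let M be a positive integer, let P ⊆ ℤ be an arithmetic progression of length at most M^{1/2}/10, and let p be a prime with M ≤ p ≤ 2M. Let a, d ∈ ℤ/pℤ, let k be a nonnegative integer with k < p^{1/2}/10, and let Q be the set of all integers whose residue mod p lies in {a, a + d, a + 2d, …, a + kd} ⊆ ℤ/pℤ. Then P ∩ Q is either empty or an arithmetic progression of integers. -/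
theorem isIntAPLen_image_Icc (b e m n : ℤ) :
    IsIntAPLen ((fun t : ℤ => b + t * e) '' Set.Icc m n) (n - m + 1).toNat := by
  refine ⟨b + m * e, e, ?_⟩
  ext z
  simp only [Set.mem_image, Set.mem_Icc, Set.mem_ofPred_eq]
  constructor
  · rintro ⟨t, ⟨h1, h2⟩, rfl⟩
    refine ⟨(t - m).toNat, by omega, ?_⟩
    rw [Int.toNat_of_nonneg (by omega)]
    ring
  · rintro ⟨j, hj, rfl⟩
    exact ⟨m + j, ⟨by omega, by omega⟩, by ring⟩

/-- A nonempty bounded order-connected set of integers is an interval. -/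
theorem Int.exists_eq_Icc_of_bounded {T : Set ℤ} (hne : T.Nonempty) (hT : T.OrdConnected)
    {B : ℤ} (hB : ∀ t ∈ T, |t| ≤ B) : ∃ m n : ℤ, m ≤ n ∧ T = Set.Icc m n := by
  obtain ⟨m, hm, hm'⟩ := Int.exists_least_of_bdd (P := fun t => t ∈ T)
    ⟨-B, fun t ht => (abs_le.1 (hB t ht)).1⟩ hne
  obtain ⟨n, hn, hn'⟩ := Int.exists_greatest_of_bdd (P := fun t => t ∈ T)
    ⟨B, fun t ht => (abs_le.1 (hB t ht)).2⟩ hne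
  exact ⟨m, n, hm' n hn, Set.Subset.antisymm (fun t ht => ⟨hm' t ht, hn' t ht⟩) (hT.out hm hn)⟩

/-- The part of a line inside a box corresponds to an interval of parameters. -/
theorem exists_Icc_of_line_inter_box (i j u v L k : ℤ) (hu : u ≠ 0)
    (hi : 0 ≤ i) (hiL : i < L) (hj : 0 ≤ j) (hjk : j ≤ k) :
    ∃ m n : ℤ, m ≤ n ∧ ∀ t : ℤ,
      (0 ≤ i + t * u ∧ i + t * u < L ∧ 0 ≤ j + t * v ∧ j + t * v ≤ k) ↔ m ≤ t ∧ t ≤ n := by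
  set T : Set ℤ :=
    {t | 0 ≤ i + t * u ∧ i + t * u < L ∧ 0 ≤ j + t * v ∧ j + t * v ≤ k}
  have hne : T.Nonempty := ⟨0, by simp [T, *]⟩
  have hT : T.OrdConnected := by
    refine ⟨?_⟩
    rintro s ⟨h1, h2, h3, h4⟩ r ⟨h5, h6, h7, h8⟩ t ⟨hst, htr⟩
    refine ⟨?_, ?_, ?_, ?_⟩
    · rcases le_total 0 u with hu' | hu' <;> nlinarith
    · rcases le_total 0 u with hu' | hu' <;> nlinarith
    · rcases le_total 0 v with hv' | hv' <;> nlinarith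
    · rcases le_total 0 v with hv' | hv' <;> nlinarith
  have hB : ∀ t ∈ T, |t| ≤ L := by
    rintro t ⟨h1, h2, -, -⟩
    have h : |t * u| ≤ L := abs_le.2 ⟨by omega, by omega⟩
    rw [abs_mul] at h
    have := Int.one_le_abs hu
    nlinarith [abs_nonneg t]
  obtain ⟨m, n, hmn, h⟩ := Int.exists_eq_Icc_of_bounded hne hT hB
  exact ⟨m, n, hmn, fun t => Set.ext_iff.1 h t⟩

theorem ZMod.intCast_ne_zero_of_abs_lt {p : ℕ} {x : ℤ} (hx : x ≠ 0) (hxp : |x| < p) :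
    (x : ZMod p) ≠ 0 := by
  rw [Ne, ZMod.intCast_zmod_eq_zero_iff_dvd]
  exact fun h => hx (Int.eq_zero_of_abs_lt_dvd h hxp)

theorem hundred_mul_sq_le_of_le_rpow {L M : ℕ} (h : (L : ℝ) ≤ (M : ℝ) ^ ((1 : ℝ) / 2) / 10) :
    100 * L ^ 2 ≤ M := by
  rw [← Real.sqrt_eq_rpow] at h
  have h1 := Real.sq_sqrt (Nat.cast_nonneg (α := ℝ) M)
  have h2 : (100 * (L : ℝ) ^ 2) ≤ M := by
    nlinarith [Nat.cast_nonneg (α := ℝ) L, Real.sqrt_nonneg (M : ℝ)]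
  exact_mod_cast h2

/-- Solutions in a small box of a linear equation modulo `p` lie on a line: the admissible first
coordinates form an arithmetic progression. -/
theorem exists_progression_of_small_box {p : ℕ} [Fact p.Prime] {L k : ℤ}
    (hLp : L ≤ p) (hLk : 2 * (L * k) < p) (c d e : ZMod p) {S : Set ℤ}
    (hS : ∀ i, i ∈ S ↔ 0 ≤ i ∧ i < L ∧ ∃ j : ℤ, 0 ≤ j ∧ j ≤ k ∧ c + i * e = j * d)
    (hne : S.Nonempty) :
    ∃ i u m n : ℤ, m ≤ n ∧ S = (fun t => i + t * u) '' Set.Icc m n := by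
  by_cases hsub : S.Subsingleton
  · obtain ⟨i, hi⟩ := hne
    exact ⟨i, 0, 0, 0, le_rfl, by simp [hsub.eq_singleton_of_mem hi]⟩
  obtain ⟨i₂, hi₂, i, hi, hii⟩ : ∃ i₂ ∈ S, ∃ i ∈ S, i₂ ≠ i := by
    simpa [Set.Subsingleton] using hsub
  obtain ⟨hi0, hiL, j, hj0, hjk, hij⟩ := (hS i).1 hi
  obtain ⟨hi20, hi2L, j₂, hj20, hj2k, hij2⟩ := (hS i₂).1 hi₂
  have hx : i₂ - i ≠ 0 := sub_ne_zero.2 hii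
  have hxL : |i₂ - i| < L := abs_lt.2 ⟨by omega, by omega⟩
  have hxe : ((i₂ - i : ℤ) : ZMod p) * e = ((j₂ - j : ℤ) : ZMod p) * d := by
    push_cast
    linear_combination hij2 - hij
  obtain ⟨u, v, hu, huv, hline⟩ : ∃ u v : ℤ, u ≠ 0 ∧
      (u : ZMod p) * e = v * d ∧ ∀ i' ∈ S, ∃ t : ℤ, i' = i + t * u ∧
        0 ≤ j + t * v ∧ j + t * v ≤ k := by
    by_cases hd : d = 0
    · have he : e = 0 := by
        rw [hd, mul_zero] at hxe
        exact (mul_eq_zero.1 hxe).resolve_left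
          (ZMod.intCast_ne_zero_of_abs_lt hx (hxL.trans_le hLp))
      refine ⟨1, 0, one_ne_zero, by simp [he], fun i' _ => ⟨i' - i, by ring, ?_, ?_⟩⟩ <;>
        simpa
    · obtain ⟨g, u, v, hg, hcop, hgu, hgv⟩ := Int.exists_gcd_one' (m := i₂ - i) (n := j₂ - j)
        (Int.gcd_pos_of_ne_zero_left _ hx)
      have hu : u ≠ 0 := by rintro rfl; simp at hgu; omega
      have hg0 : ((g : ℤ) : ZMod p) ≠ 0 := by
        refine ZMod.intCast_ne_zero_of_abs_lt (by omega) ?_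
        have h1 := Int.one_le_abs hu
        rw [hgu, abs_mul] at hxL
        nlinarith [abs_nonneg (g : ℤ)]
      refine ⟨u, v, hu, ?_, fun i' hi' => ?_⟩
      · apply mul_left_cancel₀ hg0
        rw [hgu, hgv] at hxe
        push_cast at hxe ⊢
        linear_combination hxe
      · obtain ⟨h1, h2, j', h3, h4, h5⟩ := (hS i').1 hi'
        have hx'L : |i' - i| ≤ L := abs_le.2 ⟨by omega, by omega⟩
        have hy : |j₂ - j| ≤ k := abs_le.2 ⟨by omega, by omega⟩
        have hy' : |j' - j| ≤ k := abs_le.2 ⟨by omega, by omega⟩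
        have hdet : (i₂ - i) * (j' - j) - (i' - i) * (j₂ - j) = 0 := by
          by_contra hdet
          refine ZMod.intCast_ne_zero_of_abs_lt (p := p) hdet ?_ ?_
          · refine (abs_sub _ _).trans_lt ?_
            rw [abs_mul, abs_mul]
            have := mul_le_mul hxL.le hy' (abs_nonneg _) (by omega)
            have := mul_le_mul hx'L hy (abs_nonneg _) (by omega)
            omega
          · apply mul_right_cancel₀ hd
            push_cast at hxe ⊢
            linear_combination ((i₂ : ZMod p) - i) * (hij - h5) + ((i' : ZMod p) - i) * hxe
        have hg' : (g : ℤ) ≠ 0 := by omega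
        have hprop : u * (j' - j) = (i' - i) * v := by
          apply mul_left_cancel₀ hg'
          rw [hgu, hgv] at hdet
          linear_combination hdet
        obtain ⟨t, ht⟩ : u ∣ i' - i :=
          (Int.isCoprime_iff_gcd_eq_one.2 hcop).dvd_of_dvd_mul_right ⟨_, hprop.symm⟩
        have hjt : j' - j = t * v := by
          apply mul_left_cancel₀ hu
          rw [hprop, ht]
          ring
        exact ⟨t, by linear_combination ht, by omega, by omega⟩
  obtain ⟨m, n, hmn, hT⟩ := exists_Icc_of_line_inter_box i j u v L k hu hi0 hiL hj0 hjk
  refine ⟨i, u, m, n, hmn, Set.ext fun i' => ⟨fun hi' => ?_, ?_⟩⟩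
  · obtain ⟨t, rfl, h1, h2⟩ := hline i' hi'
    obtain ⟨h3, h4, -⟩ := (hS _).1 hi'
    exact ⟨t, (hT t).1 ⟨h3, h4, h1, h2⟩, rfl⟩
  · rintro ⟨t, ht, rfl⟩
    obtain ⟨h1, h2, h3, h4⟩ := (hT t).2 ht
    refine (hS _).2 ⟨h1, h2, j + t * v, h3, h4, ?_⟩
    push_cast
    linear_combination hij + (t : ZMod p) * huv

theorem stmt9 (M : ℕ) (hM : 0 < M) (P : Set ℤ) (L : ℕ)
    (hL : (L : ℝ) ≤ (M : ℝ) ^ ((1 : ℝ)/2) / 10) (hP : IsIntAPLen P L)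
    (p : ℕ) (hp : Nat.Prime p) (hMp : M ≤ p) (hpM : p ≤ 2 * M)
    (a d : ZMod p) (k : ℕ) (hk : (k : ℝ) < (p : ℝ) ^ ((1 : ℝ)/2) / 10)
    (Q : Set ℤ)
    (hQ : Q = {n : ℤ | ∃ j : ℕ, j ≤ k ∧ (n : ZMod p) = a + (j : ZMod p) * d}) :
    P ∩ Q = ∅ ∨ ∃ m : ℕ, 1 ≤ m ∧ IsIntAPLen (P ∩ Q) m := by
  have : Fact p.Prime := ⟨hp⟩
  refine or_iff_not_imp_left.2 fun hne => ?_
  obtain ⟨b, e, rfl⟩ := hP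
  have hL' : 100 * (L : ℤ) ^ 2 ≤ p := by
    exact_mod_cast (hundred_mul_sq_le_of_le_rpow hL).trans hMp
  have hk' : 100 * (k : ℤ) ^ 2 ≤ p := by exact_mod_cast hundred_mul_sq_le_of_le_rpow hk.le
  have hp0 : (0 : ℤ) < p := by exact_mod_cast hp.pos
  set S : Set ℤ := {i | 0 ≤ i ∧ i < L ∧
    ∃ j : ℤ, 0 ≤ j ∧ j ≤ k ∧ ((b : ZMod p) - a) + i * (e : ZMod p) = j * d}
  have hPQ : (fun j : ℕ => b + (j : ℤ) * e) '' {j : ℕ | j < L} ∩ Q =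
      (fun i : ℤ => b + i * e) '' S := by
    ext z
    rw [hQ]
    constructor
    · rintro ⟨⟨i, hi, rfl⟩, j, hj, h⟩
      refine ⟨i, ⟨by omega, by exact_mod_cast hi, j, by omega, by omega, ?_⟩, rfl⟩
      push_cast at h ⊢
      linear_combination h
    · rintro ⟨i, ⟨hi0, hi, j, hj0, hj, h⟩, rfl⟩
      lift i to ℕ using hi0
      lift j to ℕ using hj0
      refine ⟨⟨i, by exact_mod_cast hi, rfl⟩, j, by omega, ?_⟩
      push_cast at h ⊢
      linear_combination h
  rw [hPQ] at hne ⊢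
  obtain ⟨i, u, m, n, hmn, hSeq⟩ := exists_progression_of_small_box (p := p) (L := L) (k := k)
    (by nlinarith) (by nlinarith [sq_nonneg ((L : ℤ) - k)]) (b - a) d e (S := S)
    (fun _ => Iff.rfl) (Set.image_nonempty.1 (Set.nonempty_iff_ne_empty.2 hne))
  refine ⟨(n - m + 1).toNat, by omega, ?_⟩
  have h := isIntAPLen_image_Icc (b + i * e) (u * e) m n
  rw [hSeq, Set.image_image]
  simpa only [add_mul, add_assoc, mul_assoc] using h
end

section
/- There exist an absolute constant C > 0 and, for each ε ∈ (0, 1/2), a threshold N₀(ε) such that the following holds. Let N > N₀(ε) be an integer, let y be a real number with (4C·log N)^{1/(2ε)} ≤ y ≤ N, and let 𝒫 be a set of primes in [y, 2y] with |𝒫| ≥ C·y^{1−2ε}·log N / log y. For each p ∈ 𝒫, let d_p ∈ {1, …, p−1} and let ℓ_p, r_p be integers with −p^{1/2−ε} ≤ ℓ_p ≤ 0 ≤ r_p ≤ p^{1/2−ε}; let S be the set of all integers n ∈ {0, 1, …, N} such that for every p ∈ 𝒫 the residue of n·d_p mod p lies in the image mod p of the integer interval [ℓ_p, r_p]. If P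 ⊆ {0, 1, …, N} is an arithmetic progression of integers of length at most y^{1/2}/10, then P ∩ S is an arithmetic progression of integers (possibly empty). -/
/-- A finite set of integers that contains every `x + y - z` (`x`, `y`, `z` in the set) lying
between two of its elements is an arithmetic progression. -/
theorem exists_isIntAPLen_of_add_sub_mem {J : Set ℤ} (hfin : J.Finite)
    (hJ : ∀ x ∈ J, ∀ y ∈ J, ∀ z ∈ J, ∀ e ∈ J, ∀ f ∈ J,
      e ≤ x + y - z → x + y - z ≤ f → x + y - z ∈ J) :
    ∃ k : ℕ, IsIntAPLen J k := by
  rcases J.eq_empty_or_nonempty with rfl | hne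
  · exact ⟨0, 0, 0, by simp⟩
  obtain ⟨x₀, hx₀, hmin⟩ := Set.exists_min_image J id hfin hne
  obtain ⟨M, hM, hmax⟩ := Set.exists_max_image J id hfin hne
  simp only [id] at hmin hmax
  rcases (J \ {x₀}).eq_empty_or_nonempty with hsub | hne'
  · refine ⟨1, x₀, 0, ?_⟩
    have hJx : J = {x₀} := (Set.sdiff_eq_empty.mp hsub).antisymm (by simpa using hx₀)
    ext z
    simp [hJx, eq_comm]
  obtain ⟨x₁, ⟨hx₁, hx₁'⟩, hmin'⟩ := Set.exists_min_image (J \ {x₀}) id hfin.sdiff hne'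
  simp only [id] at hmin'
  have hlt : x₀ < x₁ := lt_of_le_of_ne (hmin _ hx₁) fun h => hx₁' (by simp [h])
  have descend : ∀ n : ℕ, ∀ z ∈ J, z - x₀ ≤ n → ∃ j : ℕ, z = x₀ + j * (x₁ - x₀) := by
    intro n
    induction n with
    | zero => exact fun z hz hn => ⟨0, by have := hmin z hz; push_cast at *; lia⟩
    | succ n ih =>
      intro z hz hn
      by_cases hzx : z = x₀
      · exact ⟨0, by simp [hzx]⟩
      have h₁ := hmin' z ⟨hz, hzx⟩
      obtain ⟨j, hj⟩ := ih (z + x₀ - x₁)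
        (hJ z hz x₀ hx₀ x₁ hx₁ x₀ hx₀ z hz (by lia) (by lia)) (by push_cast at hn; lia)
      exact ⟨j + 1, by push_cast; linarith⟩
  have ascend : ∀ j : ℕ, x₀ + j * (x₁ - x₀) ≤ M → x₀ + j * (x₁ - x₀) ∈ J := by
    intro j
    induction j with
    | zero => simpa using fun _ => hx₀
    | succ j ih =>
      intro hle
      have heq : x₀ + ((j + 1 : ℕ) : ℤ) * (x₁ - x₀) = (x₀ + j * (x₁ - x₀)) + x₁ - x₀ := by
        push_cast; ring
      rw [heq] at hle ⊢
      have hj := ih (by linarith)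
      exact hJ _ hj x₁ hx₁ x₀ hx₀ _ hj M hM (by linarith) hle
  obtain ⟨m, hm⟩ := descend (M - x₀).toNat M hM (Int.self_le_toNat _)
  refine ⟨m + 1, x₀, x₁ - x₀, ?_⟩
  ext z
  simp only [Set.mem_image, Set.mem_ofPred_eq]
  constructor
  · intro hz
    obtain ⟨j, hj⟩ := descend (z - x₀).toNat z hz (Int.self_le_toNat _)
    have hjm : (j : ℤ) * (x₁ - x₀) ≤ m * (x₁ - x₀) := by linarith [hmax z hz]
    have := le_of_mul_le_mul_right hjm (by linarith)
    exact ⟨j, by lia, hj.symm⟩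
  · rintro ⟨j, hj, rfl⟩
    refine ascend j ?_
    have hjm : (j : ℤ) ≤ m := by lia
    nlinarith

/-- The representatives in `[l, r]` of an affine function modulo `p`, taken on a set of indices of
diameter at most `L`, are affine in the index as soon as `2 * L * (r - l) < p`. -/
theorem mul_sub_eq_mul_sub_of_dvd {p L l r A B i j k ci cj ck : ℤ}
    (hp : 2 * L * (r - l) < p) (hik : |i - k| ≤ L) (hjk : |j - k| ≤ L)
    (hi : l ≤ ci ∧ ci ≤ r) (hj : l ≤ cj ∧ cj ≤ r) (hk : l ≤ ck ∧ ck ≤ r)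
    (di : p ∣ ci - (A + i * B)) (dj : p ∣ cj - (A + j * B)) (dk : p ∣ ck - (A + k * B)) :
    (i - k) * (cj - ck) = (j - k) * (ci - ck) := by
  have hdvd : p ∣ (i - k) * (cj - ck) - (j - k) * (ci - ck) := by
    have h := dvd_sub ((dvd_sub dj dk).mul_left (i - k)) ((dvd_sub di dk).mul_left (j - k))
    ring_nf at h ⊢
    exact h
  refine sub_eq_zero.mp (Int.eq_zero_of_abs_lt_dvd hdvd (lt_of_le_of_lt ?_ hp))
  have hL : 0 ≤ L := (abs_nonneg _).trans hik
  have h₁ : |i - k| * |cj - ck| ≤ L * (r - l) :=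
    mul_le_mul hik (abs_le.mpr (by constructor <;> linarith)) (abs_nonneg _) hL
  have h₂ : |j - k| * |ci - ck| ≤ L * (r - l) :=
    mul_le_mul hjk (abs_le.mpr (by constructor <;> linarith)) (abs_nonneg _) hL
  calc _ ≤ |(i - k) * (cj - ck)| + |(j - k) * (ci - ck)| := abs_sub _ _
    _ ≤ _ := by rw [abs_mul, abs_mul]; linarith

/-- The indices in `[0, L)` at which an affine function is congruent modulo `p` to an element of
`[l, r]` are closed under `x + y - z` between any two of them, if `2 * L * (r - l) < p`. -/
theorem exists_dvd_add_sub {p L l r A B x y z e f : ℤ} (hp : 2 * L * (r - l) < p)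
    (hJ : ∀ i ∈ ({x, y, z, e, f} : Set ℤ),
      (0 ≤ i ∧ i < L) ∧ ∃ c, l ≤ c ∧ c ≤ r ∧ p ∣ c - (A + i * B))
    (hew : e ≤ x + y - z) (hwf : x + y - z ≤ f) :
    ∃ c, l ≤ c ∧ c ≤ r ∧ p ∣ c - (A + (x + y - z) * B) := by
  obtain ⟨bx, cx, lx, rx, dx⟩ := hJ x (by simp)
  obtain ⟨bY, cy, ly, ry, dy⟩ := hJ y (by simp)
  obtain ⟨bz, cz, lz, rz, dz⟩ := hJ z (by simp)
  obtain ⟨be, ce, le, re, de⟩ := hJ e (by simp)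
  obtain ⟨bf, cf, lf, rf, df⟩ := hJ f (by simp)
  have habs {i : ℤ} (hi : 0 ≤ i ∧ i < L) : |i - e| ≤ L := abs_le.mpr (by lia)
  rcases (hew.trans hwf).eq_or_lt with hef | hef
  · exact ⟨ce, le, re, by rwa [show x + y - z = e by lia]⟩
  have hx := mul_sub_eq_mul_sub_of_dvd hp (habs bx) (habs bf) ⟨lx, rx⟩ ⟨lf, rf⟩ ⟨le, re⟩ dx df de
  have hy := mul_sub_eq_mul_sub_of_dvd hp (habs bY) (habs bf) ⟨ly, ry⟩ ⟨lf, rf⟩ ⟨le, re⟩ dy df de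
  have hz := mul_sub_eq_mul_sub_of_dvd hp (habs bz) (habs bf) ⟨lz, rz⟩ ⟨lf, rf⟩ ⟨le, re⟩ dz df de
  have hw : (f - e) * (cx + cy - cz) = (x + y - z - e) * cf + (f - (x + y - z)) * ce := by
    linear_combination hz - hx - hy
  refine ⟨cx + cy - cz, ?_, ?_, ?_⟩
  · refine le_of_mul_le_mul_left ?_ (sub_pos.mpr hef)
    nlinarith [mul_nonneg (sub_nonneg.mpr hew) (sub_nonneg.mpr lf),
      mul_nonneg (sub_nonneg.mpr hwf) (sub_nonneg.mpr le)]
  · refine le_of_mul_le_mul_left ?_ (sub_pos.mpr hef)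
    nlinarith [mul_nonneg (sub_nonneg.mpr hew) (sub_nonneg.mpr rf),
      mul_nonneg (sub_nonneg.mpr hwf) (sub_nonneg.mpr re)]
  · have h := dvd_sub (dvd_add dx dy) dz
    ring_nf at h ⊢
    exact h

theorem two_mul_mul_sub_lt_of_rpow {p L : ℕ} {l r : ℤ} {y ε : ℝ} (hp : 0 < p) (hε : 0 ≤ ε)
    (hy : 0 ≤ y) (hyp : y ≤ p) (hL : (L : ℝ) ≤ y ^ ((1 : ℝ) / 2) / 10)
    (hl : -((p : ℝ) ^ ((1 : ℝ) / 2 - ε)) ≤ l) (hr : (r : ℝ) ≤ (p : ℝ) ^ ((1 : ℝ) / 2 - ε)) :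
    2 * (L : ℤ) * (r - l) < p := by
  have hp1 : (1 : ℝ) ≤ p := by exact_mod_cast hp
  have hpow : (p : ℝ) ^ ((1 : ℝ) / 2 - ε) ≤ (p : ℝ) ^ ((1 : ℝ) / 2) :=
    Real.rpow_le_rpow_of_exponent_le hp1 (by linarith)
  have hy' : y ^ ((1 : ℝ) / 2) ≤ (p : ℝ) ^ ((1 : ℝ) / 2) :=
    Real.rpow_le_rpow hy hyp (by norm_num)
  simp only [← Real.sqrt_eq_rpow] at hpow hy' hL
  have hsq : √(p : ℝ) * √(p : ℝ) = p := Real.mul_self_sqrt (by linarith)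
  have hbound : (L : ℝ) * (r - l) ≤ √(p : ℝ) / 10 * (2 * √(p : ℝ)) :=
    (mul_le_mul_of_nonneg_left (by linarith : (r - l : ℝ) ≤ 2 * √(p : ℝ)) L.cast_nonneg).trans
      (mul_le_mul_of_nonneg_right (by linarith) (by positivity))
  have : (2 * L * (r - l) : ℝ) < p := by nlinarith
  exact_mod_cast this

theorem stmt10 :
    ∃ C : ℝ, 0 < C ∧ ∀ ε : ℝ, ε ∈ Set.Ioo (0 : ℝ) (1/2) → ∃ N₀ : ℕ,
      ∀ N : ℕ, N₀ < N → ∀ y : ℝ,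
        (4 * C * Real.log N) ^ (1 / (2 * ε)) ≤ y → y ≤ N →
        ∀ Ps : Finset ℕ,
          (∀ p ∈ Ps, Nat.Prime p ∧ y ≤ (p : ℝ) ∧ (p : ℝ) ≤ 2 * y) →
          C * y ^ (1 - 2 * ε) * Real.log N / Real.log y ≤ (Ps.card : ℝ) →
          ∀ d : ℕ → ℕ, (∀ p ∈ Ps, 1 ≤ d p ∧ d p ≤ p - 1) →
          ∀ l r : ℕ → ℤ,
            (∀ p ∈ Ps, -((p : ℝ) ^ ((1 : ℝ)/2 - ε)) ≤ (l p : ℝ) ∧ l p ≤ 0 ∧ 0 ≤ r p ∧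
              (r p : ℝ) ≤ (p : ℝ) ^ ((1 : ℝ)/2 - ε)) →
          ∀ S : Set ℤ,
            S = {n : ℤ | 0 ≤ n ∧ n ≤ (N : ℤ) ∧ ∀ p ∈ Ps, ∃ j : ℤ, l p ≤ j ∧ j ≤ r p ∧
                  ((n * (d p : ℤ) : ℤ) : ZMod p) = (j : ZMod p)} →
          ∀ P : Set ℤ, P ⊆ {n : ℤ | 0 ≤ n ∧ n ≤ (N : ℤ)} →
            (∃ L : ℕ, (L : ℝ) ≤ y ^ ((1 : ℝ)/2) / 10 ∧ IsIntAPLen P L) →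
            ∃ m : ℕ, IsIntAPLen (P ∩ S) m := by
  refine ⟨1, one_pos, fun ε hε => ⟨0, ?_⟩⟩
  intro N _ y hy _ Ps hPs _ d _ l r hlr S hS P hP ⟨L, hL, a, D, hPeq⟩
  have hy0 : 0 ≤ y :=
    (Real.rpow_nonneg (mul_nonneg (by norm_num) (Real.log_natCast_nonneg N)) _).trans hy
  let J : Set ℤ := {j | (0 ≤ j ∧ j < L) ∧ ∀ p ∈ Ps, ∃ c : ℤ, l p ≤ c ∧ c ≤ r p ∧
    (p : ℤ) ∣ c - (a * d p + j * (D * d p))}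
  have hJ : P ∩ S = (fun j : ℤ => a + j * D) '' J := by
    have hmem (p : ℕ) (j c : ℤ) : (((a + j * D) * (d p : ℤ) : ℤ) : ZMod p) = (c : ZMod p) ↔
        (p : ℤ) ∣ c - (a * d p + j * (D * d p)) := by
      rw [ZMod.intCast_eq_intCast_iff_dvd_sub, add_mul, mul_assoc j]
    ext n
    constructor
    · rintro ⟨hnP, hnS⟩
      rw [hPeq] at hnP
      obtain ⟨j, hj, rfl⟩ := hnP
      rw [hS] at hnS
      refine ⟨j, ⟨⟨by positivity, by exact_mod_cast hj⟩, fun p hp => ?_⟩, rfl⟩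
      obtain ⟨c, hlc, hcr, hc⟩ := hnS.2.2 p hp
      exact ⟨c, hlc, hcr, (hmem p j c).mp hc⟩
    · rintro ⟨j, ⟨⟨hj0, hjL⟩, hj⟩, rfl⟩
      lift j to ℕ using hj0
      have hjP : a + (j : ℤ) * D ∈ P := by
        rw [hPeq]
        exact ⟨j, by exact_mod_cast hjL, rfl⟩
      refine ⟨hjP, ?_⟩
      rw [hS]
      refine ⟨(hP hjP).1, (hP hjP).2, fun p hp => ?_⟩
      obtain ⟨c, hlc, hcr, hc⟩ := hj p hp
      exact ⟨c, hlc, hcr, (hmem p j c).mpr hc⟩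
  obtain ⟨k, b, q, hJk⟩ : ∃ k, IsIntAPLen J k := by
    refine exists_isIntAPLen_of_add_sub_mem
      ((Set.finite_Ico (0 : ℤ) L).subset fun j hj => hj.1) ?_
    intro u hu v hv w hw e he f hf hle hge
    refine ⟨⟨he.1.1.trans hle, hge.trans_lt hf.1.2⟩, fun p hp => ?_⟩
    obtain ⟨hprime, hyp, -⟩ := hPs p hp
    obtain ⟨hl, -, -, hr⟩ := hlr p hp
    refine exists_dvd_add_sub
      (two_mul_mul_sub_lt_of_rpow hprime.pos hε.1.le hy0 hyp hL hl hr) ?_ hle hge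
    rintro i (rfl | rfl | rfl | rfl | rfl)
    exacts [⟨hu.1, hu.2 p hp⟩, ⟨hv.1, hv.2 p hp⟩, ⟨hw.1, hw.2 p hp⟩, ⟨he.1, he.2 p hp⟩,
      ⟨hf.1, hf.2 p hp⟩]
  refine ⟨k, a + b * D, q * D, ?_⟩
  rw [hJ, hJk, Set.image_image]
  congr 1
  ext j
  ring
end

section
/- There exist an absolute constant C > 0 and, for each ε ∈ (0, 1/2), a threshold N₀(ε) such that the following holds. Let N > N₀(ε) be an integer, let y be a real number with (4C·log N)^{1/(2ε)} ≤ y ≤ N, and let 𝒫 be a set of primes in [y, 2y] with |𝒫| ≥ C·y^{1−2ε}·log N / log y. For each p ∈ 𝒫, let d_p ∈ {1, …, p−1} and let ℓ_p, r_p be integers with −p^{1/2−ε} ≤ ℓ_p ≤ 0 ≤ r_p ≤ p^{1/2−ε}; let S be the set of all integers n ∈ {0, 1, …, N} such that for every p ∈ 𝒫 the residue of n·d_p mod p lies in the image mod p of the integer interval [ℓ_p, r_p]. Let m ≥ 1, let a₁, …, a_m, b₁, …, b_m ∈ S, and let δ₁, …, δ_m, η₁, …, η_m be integers with Σᵢ|δᵢ|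 + Σᵢ|ηᵢ| ≤ 10. Write a = Σᵢ δᵢ·aᵢ and b = Σᵢ ηᵢ·bᵢ. Then |a| ≤ gcd(a, b) · (Σᵢ |δᵢ|) · (2y)^{1/2−ε}. -/
theorem Int.eq_zero_of_primes_dvd_of_abs_lt {D : ℤ} {T : Finset ℕ} {y : ℝ} (hy : 0 ≤ y)
    (hT : ∀ p ∈ T, p.Prime ∧ y ≤ (p : ℝ)) (hdvd : ∀ p ∈ T, (p : ℤ) ∣ D)
    (hD : |(D : ℝ)| < y ^ T.card) : D = 0 := by
  by_contra h0
  have h1 : (∏ p ∈ T, p) ∣ D.natAbs :=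
    Finset.prod_primes_dvd _ (fun p hp => (hT p hp).1.prime)
      (fun p hp => Int.natCast_dvd.mp (hdvd p hp))
  have h2 : ((∏ p ∈ T, p : ℕ) : ℝ) ≤ (D.natAbs : ℝ) := by
    exact_mod_cast Nat.le_of_dvd (Int.natAbs_pos.mpr h0) h1
  have h3 : y ^ T.card ≤ ∏ p ∈ T, (p : ℝ) := by
    rw [← Finset.prod_const]
    exact Finset.prod_le_prod (fun _ _ => hy) (fun p hp => (hT p hp).2)
  rw [Nat.cast_natAbs, Int.cast_abs] at h2
  push_cast at h2
  linarith

theorem Int.abs_le_gcd_mul_abs_of_mul_eq_mul {A B u v : ℤ} (hu : u ≠ 0)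
    (h : A * v = B * u) : |A| ≤ (Int.gcd A B : ℤ) * |u| := by
  by_cases hA : A = 0
  · subst hA
    simp only [abs_zero]
    positivity
  have h1 : A ∣ (Int.gcd (A * u) (B * u) : ℤ) :=
    Int.dvd_coe_gcd (dvd_mul_right _ _) ⟨v, h.symm⟩
  rw [Int.gcd_mul_right] at h1
  have h2 : 0 < ((Int.gcd A B * u.natAbs : ℕ) : ℤ) := by
    have := Int.gcd_pos_of_ne_zero_left B hA
    have := Int.natAbs_pos.mpr hu
    positivity
  have h3 := Int.le_of_dvd h2 ((abs_dvd _ _).mpr h1)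
  simpa using h3

/-- An integer combination of elements with small residues has a small residue. -/
theorem exists_small_residue_sum {m p : ℕ} {M : ℝ} (d : ℤ) (a δ : Fin m → ℤ)
    (h : ∀ i, ∃ j : ℤ, |(j : ℝ)| ≤ M ∧ ((a i * d : ℤ) : ZMod p) = (j : ZMod p)) :
    ∃ u : ℤ, |(u : ℝ)| ≤ (∑ i, |(δ i : ℝ)|) * M ∧ (p : ℤ) ∣ (∑ i, δ i * a i) * d - u := by
  choose j hj hjp using h
  refine ⟨∑ i, δ i * j i, ?_, ?_⟩
  · push_cast
    rw [Finset.sum_mul]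
    refine (Finset.abs_sum_le_sum_abs _ _).trans (Finset.sum_le_sum fun i _ => ?_)
    rw [abs_mul]
    exact mul_le_mul_of_nonneg_left (hj i) (abs_nonneg _)
  · rw [Finset.sum_mul, ← Finset.sum_sub_distrib]
    refine Finset.dvd_sum fun i _ => ?_
    have h1 : (p : ℤ) ∣ a i * d - j i := by
      rw [← ZMod.intCast_zmod_eq_zero_iff_dvd, Int.cast_sub, hjp, sub_self]
    have : δ i * a i * d - δ i * j i = δ i * (a i * d - j i) := by ring
    rw [this]
    exact h1.mul_left _

theorem abs_sum_mul_le_mul {m : ℕ} {K : ℝ} (a δ : Fin m → ℤ) (h : ∀ i, |(a i : ℝ)| ≤ K) :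
    |((∑ i, δ i * a i : ℤ) : ℝ)| ≤ (∑ i, |(δ i : ℝ)|) * K := by
  push_cast
  rw [Finset.sum_mul]
  refine (Finset.abs_sum_le_sum_abs _ _).trans (Finset.sum_le_sum fun i _ => ?_)
  rw [abs_mul]
  exact mul_le_mul_of_nonneg_left (h i) (abs_nonneg _)

theorem exists_card_fiber_ge {P : Finset ℕ} {M k : ℝ} (hM : 1 ≤ M) (hk : 0 ≤ k)
    (u v : ℕ → ℤ) (hu : ∀ p ∈ P, |(u p : ℝ)| ≤ 10 * M) (hv : ∀ p ∈ P, |(v p : ℝ)| ≤ 10 * M)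
    (hP : 441 * M ^ 2 * k ≤ (P.card : ℝ)) :
    ∃ x y : ℤ, |(x : ℝ)| ≤ 10 * M ∧ |(y : ℝ)| ≤ 10 * M ∧
      k ≤ ((P.filter fun p => u p = x ∧ v p = y).card : ℝ) := by
  have mem : ∀ z : ℤ, z ∈ Finset.Icc (-⌊10 * M⌋) ⌊10 * M⌋ ↔ |(z : ℝ)| ≤ 10 * M := by
    intro z
    rw [Finset.mem_Icc, ← abs_le, Int.le_floor, Int.cast_abs]
  set I := Finset.Icc (-⌊10 * M⌋) ⌊10 * M⌋ with hI
  have h0 : (0 : ℤ) ∈ I := by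
    rw [mem]
    simp only [Int.cast_zero, abs_zero]
    positivity
  have hcard : (I.card : ℝ) ≤ 21 * M := by
    have hfl : 0 ≤ ⌊10 * M⌋ := Int.floor_nonneg.mpr (by positivity)
    have h1 : (I.card : ℤ) = 2 * ⌊10 * M⌋ + 1 := by
      rw [hI, Int.card_Icc]
      omega
    have h2 : (I.card : ℝ) = 2 * (⌊10 * M⌋ : ℝ) + 1 := by exact_mod_cast h1
    have := Int.floor_le (10 * M)
    linarith
  obtain ⟨⟨x, y⟩, hxy, hle⟩ := Finset.exists_le_card_fiber_of_nsmul_le_card_of_maps_to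
    (s := P) (t := I ×ˢ I) (f := fun p => (u p, v p)) (b := k)
    (fun p hp => Finset.mem_product.mpr ⟨(mem _).mpr (hu p hp), (mem _).mpr (hv p hp)⟩)
    ⟨(0, 0), Finset.mem_product.mpr ⟨h0, h0⟩⟩ (by
      rw [nsmul_eq_mul, Finset.card_product]
      push_cast
      have : (I.card : ℝ) * I.card ≤ 441 * M ^ 2 := by
        calc (I.card : ℝ) * I.card ≤ (21 * M) * (21 * M) := by gcongr
          _ = 441 * M ^ 2 := by ring
      exact (mul_le_mul_of_nonneg_right this hk).trans hP)
  obtain ⟨hx, hy⟩ := Finset.mem_product.mp hxy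
  refine ⟨x, y, (mem _).mp hx, (mem _).mp hy, ?_⟩
  simpa [Prod.ext_iff] using hle


theorem stmt11 :
    ∃ C : ℝ, 0 < C ∧ ∀ ε : ℝ, ε ∈ Set.Ioo (0 : ℝ) (1/2) → ∃ N₀ : ℕ,
      ∀ N : ℕ, N₀ < N → ∀ y : ℝ,
        (4 * C * Real.log N) ^ (1 / (2 * ε)) ≤ y → y ≤ N →
        ∀ Ps : Finset ℕ,
          (∀ p ∈ Ps, Nat.Prime p ∧ y ≤ (p : ℝ) ∧ (p : ℝ) ≤ 2 * y) →
          C * y ^ (1 - 2 * ε) * Real.log N / Real.log y ≤ (Ps.card : ℝ) →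
          ∀ d : ℕ → ℕ, (∀ p ∈ Ps, 1 ≤ d p ∧ d p ≤ p - 1) →
          ∀ l r : ℕ → ℤ,
            (∀ p ∈ Ps, -((p : ℝ) ^ ((1 : ℝ)/2 - ε)) ≤ (l p : ℝ) ∧ l p ≤ 0 ∧ 0 ≤ r p ∧
              (r p : ℝ) ≤ (p : ℝ) ^ ((1 : ℝ)/2 - ε)) →
          ∀ S : Set ℤ,
            S = {n : ℤ | 0 ≤ n ∧ n ≤ (N : ℤ) ∧ ∀ p ∈ Ps, ∃ j : ℤ, l p ≤ j ∧ j ≤ r p ∧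
                  ((n * (d p : ℤ) : ℤ) : ZMod p) = (j : ZMod p)} →
          ∀ m : ℕ, 1 ≤ m →
          ∀ a b : Fin m → ℤ, (∀ i, a i ∈ S) → (∀ i, b i ∈ S) →
          ∀ δ η : Fin m → ℤ,
            (∑ i, |δ i|) + (∑ i, |η i|) ≤ 10 →
            ∀ A B : ℤ, A = ∑ i, δ i * a i → B = ∑ i, η i * b i →
              (|A| : ℝ) ≤ (Int.gcd A B : ℝ) * (∑ i, (|δ i| : ℝ)) *
                (2 * y) ^ ((1 : ℝ)/2 - ε) := by
  refine ⟨4410, by norm_num, ?_⟩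
  rintro ε ⟨hε0, hε⟩
  refine ⟨10, ?_⟩
  intro N hN y hy hyN Ps hPs hcard d hd l r hlr S hS m _ a b ha hb δ η hδη A B hA hB
  have hN' : (11 : ℝ) ≤ N := by exact_mod_cast hN
  have hlogN : 1 ≤ Real.log N := by
    rw [Real.le_log_iff_exp_le (by linarith)]
    linarith [Real.exp_one_lt_d9]
  have hy1 : 1 < y :=
    (Real.one_lt_rpow (by linarith) (by positivity)).trans_le hy
  have hlogy : 0 < Real.log y := Real.log_pos hy1
  have hexp : 0 < 1 / 2 - ε := by linarith
  set M : ℝ := (2 * y) ^ ((1 : ℝ) / 2 - ε) with hMdef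
  have hM1 : 1 ≤ M := Real.one_le_rpow (by linarith) hexp.le
  have hM2N : M ≤ 2 * N := by
    have : M ≤ (2 * y) ^ (1 : ℝ) :=
      Real.rpow_le_rpow_of_exponent_le (by linarith) (by linarith)
    rw [Real.rpow_one] at this
    linarith
  have hMsq : M ^ 2 ≤ 2 * y ^ (1 - 2 * ε) := by
    have h1 : M ^ 2 = (2 * y) ^ (1 - 2 * ε) := by
      rw [hMdef, ← Real.rpow_natCast, ← Real.rpow_mul (by linarith)]
      congr 1
      push_cast
      ring
    rw [h1, Real.mul_rpow (by norm_num) (by linarith)]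
    have h2 : (2 : ℝ) ^ (1 - 2 * ε) ≤ 2 ^ (1 : ℝ) :=
      Real.rpow_le_rpow_of_exponent_le (by norm_num) (by linarith)
    rw [Real.rpow_one] at h2
    gcongr
  have hsum : (∑ i, |(δ i : ℝ)|) + (∑ i, |(η i : ℝ)|) ≤ 10 := by exact_mod_cast hδη
  have hδ0 : 0 ≤ ∑ i, |(δ i : ℝ)| := Finset.sum_nonneg fun _ _ => abs_nonneg _
  have hη0 : 0 ≤ ∑ i, |(η i : ℝ)| := Finset.sum_nonneg fun _ _ => abs_nonneg _
  have hSN : ∀ n ∈ S, |(n : ℝ)| ≤ N := by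
    intro n hn
    rw [hS] at hn
    have h0 : (0 : ℝ) ≤ n := by exact_mod_cast hn.1
    rw [abs_of_nonneg h0]
    exact_mod_cast hn.2.1
  have hSres : ∀ n ∈ S, ∀ p ∈ Ps, ∃ j : ℤ, |(j : ℝ)| ≤ M ∧
      ((n * (d p : ℤ) : ℤ) : ZMod p) = (j : ZMod p) := by
    intro n hn p hp
    rw [hS] at hn
    obtain ⟨j, hlj, hjr, hj⟩ := hn.2.2 p hp
    obtain ⟨hl, -, -, hr⟩ := hlr p hp
    have hpM : (p : ℝ) ^ ((1 : ℝ) / 2 - ε) ≤ M :=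
      Real.rpow_le_rpow (by positivity) (hPs p hp).2.2 hexp.le
    have hlj' : (l p : ℝ) ≤ j := by exact_mod_cast hlj
    have hjr' : (j : ℝ) ≤ r p := by exact_mod_cast hjr
    exact ⟨j, abs_le.mpr ⟨by linarith, by linarith⟩, hj⟩
  have hures : ∀ p, ∃ u : ℤ, p ∈ Ps →
      |(u : ℝ)| ≤ (∑ i, |(δ i : ℝ)|) * M ∧ (p : ℤ) ∣ A * d p - u := by
    intro p
    by_cases hp : p ∈ Ps
    · obtain ⟨u, hu⟩ := exists_small_residue_sum (d p) a δ fun i => hSres _ (ha i) p hp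
      exact ⟨u, fun _ => hA ▸ hu⟩
    · exact ⟨0, fun h => absurd h hp⟩
  have hvres : ∀ p, ∃ v : ℤ, p ∈ Ps →
      |(v : ℝ)| ≤ (∑ i, |(η i : ℝ)|) * M ∧ (p : ℤ) ∣ B * d p - v := by
    intro p
    by_cases hp : p ∈ Ps
    · obtain ⟨v, hv⟩ := exists_small_residue_sum (d p) b η fun i => hSres _ (hb i) p hp
      exact ⟨v, fun _ => hB ▸ hv⟩
    · exact ⟨0, fun h => absurd h hp⟩
  choose u hu using hures
  choose v hv using hvres
  have hAN : |(A : ℝ)| ≤ 10 * N := by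
    rw [hA]
    refine (abs_sum_mul_le_mul a δ fun i => hSN _ (ha i)).trans ?_
    gcongr
    linarith
  have hBN : |(B : ℝ)| ≤ 10 * N := by
    rw [hB]
    refine (abs_sum_mul_le_mul b η fun i => hSN _ (hb i)).trans ?_
    gcongr
    linarith
  have hk : 0 < 5 * Real.log N / Real.log y := by positivity
  obtain ⟨x, z, hx, hz, hT⟩ := exists_card_fiber_ge hM1 hk.le u v
    (fun p hp => (hu p hp).1.trans (by gcongr; linarith))
    (fun p hp => (hv p hp).1.trans (by gcongr; linarith))
    (le_trans (by
      calc 441 * M ^ 2 * (5 * Real.log N / Real.log y)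
          ≤ 441 * (2 * y ^ (1 - 2 * ε)) * (5 * Real.log N / Real.log y) := by gcongr
        _ = 4410 * y ^ (1 - 2 * ε) * Real.log N / Real.log y := by ring) hcard)
  set T := Ps.filter fun p => u p = x ∧ v p = z with hTdef
  have hTmem : ∀ p ∈ T, p ∈ Ps ∧ u p = x ∧ v p = z := fun p hp => Finset.mem_filter.mp hp
  have hTprime : ∀ p ∈ T, p.Prime ∧ y ≤ (p : ℝ) := fun p hp =>
    ⟨(hPs p (hTmem p hp).1).1, (hPs p (hTmem p hp).1).2.1⟩
  have hyT : (N : ℝ) ^ 5 ≤ y ^ T.card := by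
    rw [← Real.log_le_log_iff (by positivity) (by positivity), Real.log_pow, Real.log_pow]
    rw [div_le_iff₀ hlogy] at hT
    exact_mod_cast hT
  have hN5 : 400 * (N : ℝ) ^ 2 < N ^ 5 := by
    have h3 : (11 : ℝ) ^ 3 ≤ (N : ℝ) ^ 3 := by gcongr
    have h2 : 0 < (N : ℝ) ^ 2 := by positivity
    nlinarith
  have hAz : A * z = B * x := by
    rw [← sub_eq_zero]
    refine Int.eq_zero_of_primes_dvd_of_abs_lt (by linarith) hTprime (fun p hp => ?_)
      (lt_of_le_of_lt ?_ (hN5.trans_le hyT))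
    · obtain ⟨hp', rfl, rfl⟩ := hTmem p hp
      have : A * v p - B * u p = B * (A * d p - u p) - A * (B * d p - v p) := by ring
      rw [this]
      exact dvd_sub ((hu p hp').2.mul_left _) ((hv p hp').2.mul_left _)
    · push_cast
      calc |(A : ℝ) * z - B * x| ≤ |(A : ℝ) * z| + |(B : ℝ) * x| := abs_sub _ _
        _ = |(A : ℝ)| * |(z : ℝ)| + |(B : ℝ)| * |(x : ℝ)| := by rw [abs_mul, abs_mul]
        _ ≤ (10 * N) * (10 * (2 * N)) + (10 * N) * (10 * (2 * N)) := by
          gcongr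
          · exact hz.trans (by gcongr)
          · exact hx.trans (by gcongr)
        _ = 400 * (N : ℝ) ^ 2 := by ring
  by_cases hx0 : x = 0
  · have hA0 : A = 0 := by
      refine Int.eq_zero_of_primes_dvd_of_abs_lt (by linarith) hTprime (fun p hp => ?_)
        (lt_of_le_of_lt ?_ (hN5.trans_le hyT))
      · obtain ⟨hp', hup, -⟩ := hTmem p hp
        have h1 := (hu p hp').2
        rw [hup, hx0, sub_zero] at h1
        refine ((Nat.prime_iff_prime_int.mp (hTprime p hp).1).dvd_or_dvd h1).resolve_right ?_
        intro h2
        have h3 := Nat.le_of_dvd (hd p hp').1 (Int.natCast_dvd_natCast.mp h2)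
        have := hd p hp'
        omega
      · nlinarith
    rw [hA0]
    simp only [Int.cast_zero, abs_zero]
    positivity
  · have hTne : T.Nonempty := by
      rw [← Finset.card_pos]
      exact_mod_cast hk.trans_le hT
    obtain ⟨p, hp⟩ := hTne
    obtain ⟨hp', hup, -⟩ := hTmem p hp
    have h1 := (hu p hp').1
    rw [hup] at h1
    have h2 : |(A : ℝ)| ≤ (Int.gcd A B : ℝ) * |(x : ℝ)| := by
      exact_mod_cast Int.abs_le_gcd_mul_abs_of_mul_eq_mul hx0 hAz
    rw [mul_assoc]
    exact h2.trans (by gcongr)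
end

section
/- Let G be an abelian group, let r be a positive integer, let δ ∈ (0, 1], let S ⊆ G be a finite nonempty set, and let R be a GAP over G of rank at most r with S ⊆ R and |R| ≤ δ^{−1}·|S|. Then E(S) ≥ δ·2^{−r}·|S|³. -/
/-- The additive energy of a finite subset of an abelian group:
the number of quadruples `(a,b,c,d) ∈ S⁴` with `a + b = c + d`. -/
def addEnergy {G : Type*} [AddCommGroup G] [DecidableEq G] (S : Finset G) : ℕ :=
  (((S ×ˢ S) ×ˢ S ×ˢ S).filter fun x => x.1.1 + x.1.2 = x.2.1 + x.2.2).card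

open scoped Pointwise in
/-- Cauchy-Schwarz lower bound for the additive energy in terms of the sumset. -/
theorem card_pow_four_le_card_add_mul_addEnergy {G : Type*} [AddCommGroup G] [DecidableEq G]
    (S : Finset G) : S.card ^ 4 ≤ (S + S).card * addEnergy S := by
  have h := Finset.le_card_add_mul_addEnergy S S
  have he : Finset.addEnergy S S = addEnergy S := by
    unfold Finset.addEnergy addEnergy
    refine Finset.card_bij' (fun x _ => ((x.1.1, x.2.1), (x.1.2, x.2.2)))
      (fun x _ => ((x.1.1, x.2.1), (x.1.2, x.2.2))) ?_ ?_ ?_ ?_ <;> simp +contextual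
  rw [he] at h
  calc S.card ^ 4 = S.card ^ 2 * S.card ^ 2 := by ring
    _ ≤ _ := h

theorem IsGAP.finite {G : Type*} [AddCommGroup G] {P : Set G} {r : ℕ} (hP : IsGAP P r) :
    P.Finite := by
  obtain ⟨a, v, M, L, rfl⟩ := hP
  refine ((Set.finite_Icc M L).image fun n => a + ∑ i, n i • v i).subset ?_
  rintro x ⟨n, hn, rfl⟩
  exact ⟨n, ⟨fun i => (hn i).1, fun i => (hn i).2⟩, rfl⟩

open scoped Pointwise in
/-- The sumset `P + P` of a generalized arithmetic progression of rank `r` is covered by `2 ^ r`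
translates of `P`. -/
theorem IsGAP.exists_add_subset {G : Type*} [AddCommGroup G] [DecidableEq G] {P : Set G} {r : ℕ}
    (hP : IsGAP P r) : ∃ T : Finset G, T.card ≤ 2 ^ r ∧ P + P ⊆ P + (T : Set G) := by
  obtain ⟨a, v, M, L, rfl⟩ := hP
  refine ⟨Finset.univ.image fun ε : Fin r → Bool =>
    a + ∑ i, (if ε i then L i else M i) • v i, ?_, ?_⟩
  · exact Finset.card_image_le.trans (by simp)
  · rintro _ ⟨_, ⟨m, hm, rfl⟩, _, ⟨n, hn, rfl⟩, rfl⟩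
    refine ⟨a + ∑ i, (m i + n i - if M i + L i ≤ m i + n i then L i else M i) • v i,
      ⟨_, fun i => ?_, rfl⟩,
      a + ∑ i, (if M i + L i ≤ m i + n i then L i else M i) • v i, ?_, ?_⟩
    · have := hm i
      have := hn i
      split_ifs <;> omega
    · simp only [Finset.coe_image, Finset.coe_univ, Set.image_univ, Set.mem_range]
      exact ⟨fun i => decide (M i + L i ≤ m i + n i), by simp⟩
    · simp only [sub_smul, add_smul, Finset.sum_sub_distrib, Finset.sum_add_distrib]
      abel

open scoped Pointwise in
theorem IsGAP.card_add_le {G : Type*} [AddCommGroup G] [DecidableEq G] {P : Set G} {r : ℕ}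
    (hP : IsGAP P r) {S : Finset G} (hS : ↑S ⊆ P) : (S + S).card ≤ 2 ^ r * P.ncard := by
  obtain ⟨T, hT, hPT⟩ := hP.exists_add_subset
  lift P to Finset G using hP.finite
  have hsub : S + S ⊆ P + T := by
    rw [← Finset.coe_subset]
    push_cast
    exact (Set.add_subset_add hS hS).trans hPT
  rw [Set.ncard_coe_finset]
  calc (S + S).card ≤ (P + T).card := Finset.card_le_card hsub
    _ ≤ P.card * T.card := Finset.card_add_le
    _ ≤ 2 ^ r * P.card := by rw [mul_comm]; gcongr

/-- A dense finite subset of a generalized arithmetic progression has large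
additive energy. -/
theorem IsGAP.card_pow_four_le {G : Type*} [AddCommGroup G] [DecidableEq G] {P : Set G} {r : ℕ}
    (hP : IsGAP P r) {S : Finset G} (hS : ↑S ⊆ P) :
    S.card ^ 4 ≤ 2 ^ r * P.ncard * addEnergy S :=
  (card_pow_four_le_card_add_mul_addEnergy S).trans (Nat.mul_le_mul_right _ (hP.card_add_le hS))

theorem stmt14 {G : Type*} [AddCommGroup G] [DecidableEq G] (r : ℕ) (hr : 0 < r)
    (δ : ℝ) (hδ : δ ∈ Set.Ioc (0 : ℝ) 1) (S : Finset G) (hS : S.Nonempty)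
    (R : Set G) (hR : ∃ r' : ℕ, r' ≤ r ∧ IsGAP R r') (hSR : ↑S ⊆ R)
    (hcard : (R.ncard : ℝ) ≤ δ⁻¹ * (S.card : ℝ)) :
    δ * 2 ^ (-(r : ℝ)) * (S.card : ℝ) ^ 3 ≤ (addEnergy S : ℝ) := by
  obtain ⟨r', hr', hR⟩ := hR
  have hδ0 : 0 < δ := hδ.1
  have hS0 : (0 : ℝ) < S.card := by exact_mod_cast hS.card_pos
  have hmul : (S.card : ℝ) ^ 3 * S.card ≤ (2 ^ r * δ⁻¹ * addEnergy S) * S.card := by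
    calc (S.card : ℝ) ^ 3 * S.card = (S.card : ℝ) ^ 4 := by ring
      _ ≤ (2 : ℝ) ^ r' * R.ncard * addEnergy S := by exact_mod_cast hR.card_pow_four_le hSR
      _ ≤ 2 ^ r * (δ⁻¹ * S.card) * addEnergy S := by
        gcongr
        norm_num
      _ = (2 ^ r * δ⁻¹ * addEnergy S) * S.card := by ring
  have hcube := le_of_mul_le_mul_right hmul hS0
  rw [Real.rpow_neg zero_le_two, Real.rpow_natCast]
  calc δ * (2 ^ r)⁻¹ * (S.card : ℝ) ^ 3 ≤ δ * (2 ^ r)⁻¹ * (2 ^ r * δ⁻¹ * addEnergy S) := by gcongr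
    _ = addEnergy S := by field_simp
end
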